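/- Reverse Hölder inequality, scalar-H case (estimate (AB') in the proof of Theorem 1.4, Case 2, for classical solutions). Let n ≥ 3, Ω ⊆ ℝⁿ a domain, 2 ≤ k ≤ n, f : Ω×ℝ×ℝⁿ → ℝ positive and C^{1,1}_loc, H₂ : Ω×ℝ×ℝⁿ → ℝ C^{1,1}_loc, and H(x,z,ξ) := H₂(x,z,ξ)I. Fix concentric balls with closure(B_{2R}) ⊂ Ω and M > 0, and set β := (k+1)n/((k+1)n−2k). Then there is a constant C, depending only on n, k, R, f, H₂ and M, such that for every u ∈ C²(Ω) satisfying σ_k(A_H[u]) = f(x,u,∇u)^k and λ(A_H[u]) ∈ Γ_k^+ on Ω, every constant C₁ ∈ [0,M] with Δu + C₁ ≥ 1 and |∇²u| ≤ Δu + C₁ pointwise on B_{2R}, and with sup_{B_{2R}}(|u|+|∇u|) ≤ M and ∫_{B_{2R}}(Δu+C₁)^{(k+1)n/2} ≤ M, one has for all q > (k+1)n/2 − k and all ρ ∈ (0,R/3]: (∫_{B_{R+ρ}} (Δu+C₁)^{βq})^{1/β} ≤ (Cq/ρ²) ∫_{B_{R+3ρ}} (Δu+C₁)^{q+k}. -/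

import Mathlib

open MeasureTheory Metric Set Matrix

noncomputable section

/-- The `k`-th elementary symmetric polynomial of the eigenvalues of an `n × n` real
matrix, defined via the coefficients of the characteristic polynomial. -/
def esymmMat {n : ℕ} (k : ℕ) (A : Matrix (Fin n) (Fin n) ℝ) : ℝ :=
  (-1 : ℝ) ^ k * A.charpoly.coeff (n - k)

/-- `λ(A) ∈ Γ_k^+`, i.e. `σ_j(A) > 0` for all `1 ≤ j ≤ k`. -/
def GammaPlus {n : ℕ} (k : ℕ) (A : Matrix (Fin n) (Fin n) ℝ) : Prop :=
  ∀ j : ℕ, 1 ≤ j → j ≤ k → 0 < esymmMat j A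

/-- The Newton tensors `T_0(A) = I`, `T_j(A) = σ_j(A) I - T_{j-1}(A) A`. -/
def newtonT {n : ℕ} : ℕ → Matrix (Fin n) (Fin n) ℝ → Matrix (Fin n) (Fin n) ℝ
  | 0, _ => 1
  | (j + 1), A => esymmMat (j + 1) A • (1 : Matrix (Fin n) (Fin n) ℝ) - newtonT j A * A

/-- `i`-th partial derivative. -/
def pd {n : ℕ} (i : Fin n) (w : (Fin n → ℝ) → ℝ) (x : Fin n → ℝ) : ℝ :=
  fderiv ℝ w x (Pi.single i 1)

/-- Gradient as a vector. -/
def grad {n : ℕ} (w : (Fin n → ℝ) → ℝ) (x : Fin n → ℝ) : Fin n → ℝ :=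
  fun i => pd i w x

/-- Hessian matrix. -/
def hess {n : ℕ} (w : (Fin n → ℝ) → ℝ) (x : Fin n → ℝ) : Matrix (Fin n) (Fin n) ℝ :=
  Matrix.of fun i j => pd i (pd j w) x

/-- Squared Euclidean norm of a vector. -/
def normSq {n : ℕ} (ξ : Fin n → ℝ) : ℝ := ∑ i, ξ i ^ 2

/-- Euclidean norm of a vector. -/
def vnorm {n : ℕ} (ξ : Fin n → ℝ) : ℝ := Real.sqrt (∑ i, ξ i ^ 2)

/-- Operator norm of a matrix, viewed as a linear map between Euclidean spaces. -/
def matNorm {n : ℕ} (M : Matrix (Fin n) (Fin n) ℝ) : ℝ :=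
  ‖LinearMap.toContinuousLinearMap (Matrix.toEuclideanLin M)‖

/-- Laplacian. -/
def lapl {n : ℕ} (w : (Fin n → ℝ) → ℝ) (x : Fin n → ℝ) : ℝ := ∑ l, pd l (pd l w) x

/-- `W^{2,p}` norm (with classical derivatives) on a set. -/
def W2pNorm {n : ℕ} (p : ℝ) (w : (Fin n → ℝ) → ℝ) (B : Set (Fin n → ℝ)) : ℝ :=
  (∫ x in B, (|w x| ^ p + vnorm (grad w x) ^ p + matNorm (hess w x) ^ p)) ^ (1 / p)

/-- `C^{1,1}_loc` on a set: continuously differentiable with locally Lipschitz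
first derivatives. -/
def C11On {E F : Type*} [NormedAddCommGroup E] [NormedSpace ℝ E]
    [NormedAddCommGroup F] [NormedSpace ℝ F] (f : E → F) (s : Set E) : Prop :=
  ContDiffOn ℝ 1 f s ∧
    ∀ x ∈ s, ∃ (K : NNReal) (t : Set E), t ∈ nhdsWithin x s ∧
      LipschitzOnWith K (fderivWithin ℝ f s) t

/-- First order difference quotient `∇_l^h`. -/
def dq {n : ℕ} (l : Fin n) (h : ℝ) (w : (Fin n → ℝ) → ℝ) (x : Fin n → ℝ) : ℝ :=
  (w (x + h • (Pi.single l 1 : Fin n → ℝ)) - w x) / h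

/-- Second order difference quotient `Δ_{ll}^h`. -/
def ddq {n : ℕ} (l : Fin n) (h : ℝ) (w : (Fin n → ℝ) → ℝ) (x : Fin n → ℝ) : ℝ :=
  (w (x + h • (Pi.single l 1 : Fin n → ℝ)) - 2 * w x + w (x - h • (Pi.single l 1 : Fin n → ℝ))) / h ^ 2

/-- `L^s` seminorm (as an extended real number) of a function on a set. -/
def lpN {n : ℕ} (s : ℝ) (w : (Fin n → ℝ) → ℝ) (S : Set (Fin n → ℝ)) : ENNReal :=
  (∫⁻ x in S, ENNReal.ofReal (|w x| ^ s)) ^ (1 / s)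

end

/-- Elementary symmetric polynomial of the variables indexed by `s`. -/
noncomputable def es {ι : Type*} (s : Finset ι) (k : ℕ) (x : ι → ℝ) : ℝ :=
  ∑ t ∈ s.powersetCard k, ∏ i ∈ t, x i

theorem es_zero {ι : Type*} (s : Finset ι) (x : ι → ℝ) : es s 0 x = 1 := by
  simp [es]

theorem es_one {ι : Type*} (s : Finset ι) (x : ι → ℝ) : es s 1 x = ∑ i ∈ s, x i := by
  simp [es, Finset.powersetCard_one]

theorem es_empty_succ {ι : Type*} (k : ℕ) (x : ι → ℝ) : es (∅ : Finset ι) (k + 1) x = 0 := by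
  unfold es
  rw [Finset.powersetCard_eq_empty.2 (by simp)]; simp

theorem es_insert {ι : Type*} [DecidableEq ι] {s : Finset ι} {a : ι} (ha : a ∉ s) (k : ℕ)
    (x : ι → ℝ) : es (insert a s) (k + 1) x = es s (k + 1) x + x a * es s k x := by
  have h := Multiset.powersetCard_cons k a s.val
  have : ∀ (t : Finset ι) (k : ℕ), es t k x = ((t.val.powersetCard k).map
      (fun m => (m.map x).prod)).sum := by
    intro t k
    rw [es, ← Finset.esymm_map_val, Multiset.esymm, Multiset.powersetCard_map, Multiset.map_map]
    rfl
  rw [this, this, this, Finset.insert_val_of_notMem ha, Multiset.powersetCard_cons]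
  simp [Multiset.sum_map_mul_left]

theorem es_erase {ι : Type*} [DecidableEq ι] {s : Finset ι} {a : ι} (ha : a ∈ s) (k : ℕ)
    (x : ι → ℝ) : es s (k + 1) x = es (s.erase a) (k + 1) x + x a * es (s.erase a) k x := by
  conv_lhs => rw [← Finset.insert_erase ha]
  exact es_insert (Finset.notMem_erase a s) k x

/-- Algebraic directional derivative of `es s (k+1)`. -/
noncomputable def des {ι : Type*} [DecidableEq ι] (s : Finset ι) (k : ℕ) (x y : ι → ℝ) : ℝ :=
  ∑ i ∈ s, y i * es (s.erase i) k x

theorem des_zero {ι : Type*} [DecidableEq ι] (s : Finset ι) (x y : ι → ℝ) :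
    des s 0 x y = ∑ i ∈ s, y i := by
  simp [des, es_zero]

theorem des_insert {ι : Type*} [DecidableEq ι] {s : Finset ι} {a : ι} (ha : a ∉ s) (k : ℕ)
    (x y : ι → ℝ) :
    des (insert a s) (k + 1) x y = y a * es s (k + 1) x + des s (k + 1) x y + x a * des s k x y := by
  unfold des
  rw [Finset.sum_insert ha, Finset.erase_insert ha, Finset.mul_sum, add_assoc,
    ← Finset.sum_add_distrib]
  congr 1
  refine Finset.sum_congr rfl fun i hi => ?_
  have hne : a ≠ i := fun h => ha (h ▸ hi)
  rw [Finset.erase_insert_of_ne hne, es_insert (fun h => ha (Finset.mem_of_mem_erase h))]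
  ring

theorem des_self {ι : Type*} [DecidableEq ι] (s : Finset ι) (x : ι → ℝ) :
    ∀ k : ℕ, des s k x x = (k + 1) * es s (k + 1) x := by
  induction s using Finset.induction_on with
  | empty => intro k; simp [des, es_empty_succ]
  | insert a s ha ih =>
    intro k
    cases k with
    | zero => rw [des_zero, es_one]; simp
    | succ k =>
      rw [des_insert ha, ih, ih, es_insert ha]; push_cast; ring

theorem sum_es_erase {ι : Type*} [DecidableEq ι] (s : Finset ι) (x : ι → ℝ) :
    ∀ k : ℕ, des s k x (fun _ => 1) = ((s.card : ℝ) - k) * es s k x := by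
  induction s using Finset.induction_on with
  | empty =>
    intro k
    cases k with
    | zero => simp [des]
    | succ k => simp [des, es_empty_succ]
  | insert a s ha ih =>
    intro k
    cases k with
    | zero => rw [des_zero, es_zero]; simp
    | succ k =>
      rw [des_insert ha, ih, ih, es_insert ha, Finset.card_insert_of_notMem ha]; push_cast; ring

theorem hasDerivAt_es {ι : Type*} [DecidableEq ι] (s : Finset ι) (x y : ι → ℝ) :
    ∀ k : ℕ, HasDerivAt (fun t : ℝ => es s (k + 1) (fun i => x i + t * y i)) (des s k x y) 0 := by
  induction s using Finset.induction_on with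
  | empty => intro k; simp only [des, es_empty_succ, Finset.sum_empty]; exact hasDerivAt_const _ _
  | insert a s ha ih =>
    intro k
    have hl : HasDerivAt (fun t : ℝ => x a + t * y a) (y a) 0 := by
      simpa using ((hasDerivAt_id (0 : ℝ)).mul_const (y a)).const_add (x a)
    cases k with
    | zero =>
      have := (ih 0).add (hl.mul_const 1)
      simp only [es_insert ha, es_zero] at this ⊢
      refine this.congr_deriv ?_
      rw [des_zero, des_zero, Finset.sum_insert ha]; ring
    | succ k =>
      have := (ih (k+1)).add (hl.mul (ih k))
      simp only [es_insert ha] at this ⊢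
      refine this.congr_deriv ?_
      rw [des_insert ha]; simp; ring

theorem es_smul {ι : Type*} (s : Finset ι) (k : ℕ) (x : ι → ℝ) (t : ℝ) :
    es s k (fun i => t * x i) = t ^ k * es s k x := by
  unfold es
  rw [Finset.mul_sum]
  refine Finset.sum_congr rfl fun u hu => ?_
  rw [Finset.prod_mul_distrib, Finset.prod_const, (Finset.mem_powersetCard.1 hu).2]

/-! ### Newton's inequality -/

theorem newton_of_splits_aux (m : Multiset ℝ) (x : ℝ) :
    0 ≤ ((m.map fun a => Polynomial.X - Polynomial.C a).prod.derivative.eval x) ^ 2 -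
      (m.map fun a => Polynomial.X - Polynomial.C a).prod.eval x *
      ((m.map fun a => Polynomial.X - Polynomial.C a).prod.derivative.derivative.eval x) := by
  induction m using Multiset.induction_on with
  | empty => simp
  | cons a m ih =>
    set g := (m.map fun a => Polynomial.X - Polynomial.C a).prod
    simp only [Multiset.map_cons, Multiset.prod_cons]
    simp only [Polynomial.derivative_mul, Polynomial.derivative_add, Polynomial.derivative_sub,
      Polynomial.derivative_X, Polynomial.derivative_C, Polynomial.eval_add, Polynomial.eval_mul,
      Polynomial.eval_sub, Polynomial.eval_X, Polynomial.eval_C, sub_zero, Polynomial.derivative_one,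
      zero_mul, zero_add, one_mul, Polynomial.eval_one]
    nlinarith [mul_nonneg (sq_nonneg (x - a)) ih, sq_nonneg (g.eval x)]

theorem newton_of_splits (p : Polynomial ℝ) (hp : p.Splits) (x : ℝ) :
    p.eval x * p.derivative.derivative.eval x ≤ (p.derivative.eval x) ^ 2 := by
  have h := newton_of_splits_aux p.roots x
  rw [hp.eq_prod_roots]
  simp only [Polynomial.derivative_mul, Polynomial.derivative_C, zero_mul, zero_add,
    Polynomial.eval_mul, Polynomial.eval_C]
  nlinarith [mul_nonneg (sq_nonneg p.leadingCoeff) h]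

theorem splits_derivative (p : Polynomial ℝ) (hp : p.Splits) : p.derivative.Splits := by
  rw [Polynomial.splits_iff_card_roots] at hp ⊢
  have h1 := Polynomial.card_roots_le_derivative p
  have h2 := Polynomial.natDegree_derivative_le p
  have h3 := p.derivative.card_roots'
  rcases Nat.eq_zero_or_pos p.natDegree with h0 | h0
  · omega
  · omega

theorem splits_iterate_derivative (p : Polynomial ℝ) (hp : p.Splits) (m : ℕ) :
    (Polynomial.derivative^[m] p).Splits := by
  induction m with
  | zero => exact hp
  | succ m ih => rw [Function.iterate_succ_apply']; exact splits_derivative _ ih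

theorem es_newton {ι : Type*} (s : Finset ι) (k : ℕ) (x : ι → ℝ) :
    es s (k + 2) x * es s k x ≤ es s (k + 1) x ^ 2 := by
  classical
  by_cases hk : s.card < k + 2
  · have : es s (k + 2) x = 0 := by
      unfold es; rw [Finset.powersetCard_eq_empty.2 hk]; simp
    rw [this, zero_mul]; exact sq_nonneg _
  obtain ⟨m, hm⟩ : ∃ m, s.card = m + k + 2 := ⟨s.card - (k + 2), by omega⟩
  set p : Polynomial ℝ := ∏ i ∈ s, (Polynomial.X + Polynomial.C (x i)) with hpdef
  have hps : p.Splits := by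
    apply Polynomial.Splits.prod
    intro i _
    exact Polynomial.Splits.X_add_C _
  have hc : ∀ j, j ≤ s.card → p.coeff (s.card - j) = es s j x := by
    intro j hj
    rw [hpdef, Finset.prod_X_add_C_coeff s x (by omega), es]
    congr 2
    omega
  have hq := newton_of_splits _ (splits_iterate_derivative p hps m) 0
  rw [← Function.iterate_succ_apply' Polynomial.derivative m,
    ← Function.iterate_succ_apply' Polynomial.derivative (m+1)] at hq
  simp only [← Polynomial.coeff_zero_eq_eval_zero, Polynomial.coeff_iterate_derivative] at hq
  have e0 := hc (k+2) (by omega)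
  have e1 := hc (k+1) (by omega)
  have e2 := hc k (by omega)
  rw [show s.card - (k+2) = m by omega] at e0
  rw [show s.card - (k+1) = m+1 by omega] at e1
  rw [show s.card - k = m+2 by omega] at e2
  simp only [zero_add, Nat.succ_eq_add_one, show m + 1 + 1 = m + 2 from rfl, e0, e1, e2,
    Nat.descFactorial_self, nsmul_eq_mul, Nat.factorial_succ (m+1), Nat.factorial_succ m] at hq
  push_cast at hq
  have hfac : (0:ℝ) < (m.factorial : ℝ) := by positivity
  have h2 : ((m:ℝ) + 2) * (es s (k+2) x * es s k x) ≤ (m + 1) * es s (k+1) x ^ 2 := by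
    have h3 : 0 < (m.factorial : ℝ)^2 * (m + 1) := by positivity
    refine le_of_mul_le_mul_left ?_ h3
    nlinarith [hq]
  rcases le_total (es s (k+2) x * es s k x) 0 with h0 | h0
  · exact h0.trans (sq_nonneg _)
  · have : (0:ℝ) < m + 1 := by positivity
    refine le_of_mul_le_mul_left ?_ this
    nlinarith

/-! ### Gårding cones -/

def Gam {ι : Type*} (s : Finset ι) (k : ℕ) (x : ι → ℝ) : Prop := ∀ j ≤ k, 0 < es s j x

theorem Gam.mono {ι : Type*} {s : Finset ι} {k m : ℕ} {x : ι → ℝ} (h : Gam s k x) (hm : m ≤ k) :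
    Gam s m x := fun j hj => h j (hj.trans hm)

theorem Gam.erase {ι : Type*} [DecidableEq ι] {s : Finset ι} {x : ι → ℝ} {i : ι} (hi : i ∈ s) :
    ∀ {k : ℕ}, Gam s (k + 1) x → Gam (s.erase i) k x := by
  intro k
  induction k with
  | zero => intro _ j hj; obtain rfl : j = 0 := by omega
            rw [es_zero]; exact one_pos
  | succ k ih =>
    intro h j hj
    have h1 := ih (h.mono (by omega))
    rcases Nat.lt_or_ge j (k+1) with hjk | hjk
    · exact h1 j (by omega)
    obtain rfl : j = k + 1 := by omega
    by_contra hcon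
    push Not at hcon
    have a := h (k+1) (by omega)
    have b := h (k+2) (by omega)
    rw [es_erase hi] at a b
    have c := h1 k le_rfl
    have d := es_newton (s.erase i) k x
    set A := es (s.erase i) k x
    set B := es (s.erase i) (k+1) x
    set C := es (s.erase i) (k+2) x
    have hC : -(x i * B) < C := by linarith
    have : B ^ 2 < C * A := by nlinarith
    linarith

theorem es_lower {ι : Type*} [DecidableEq ι] {s : Finset ι} {x : ι → ℝ} {i : ι} (hi : i ∈ s) :
    ∀ {k : ℕ}, Gam s (k + 1) x → es s (k + 1) x ≤ es s 1 x * es (s.erase i) k x := by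
  intro k
  induction k with
  | zero => intro _; rw [es_zero]; simp
  | succ k ih =>
    intro h
    have h1 := ih (h.mono (by omega))
    have g := Gam.erase hi h
    have c := g k (by omega)
    have c1 := g (k+1) (by omega)
    have d := es_newton (s.erase i) k x
    have s1 : 0 < es s 1 x := h 1 (by omega)
    rw [es_erase hi (k+1)]
    rw [es_erase hi k] at h1
    set A := es (s.erase i) k x
    set B := es (s.erase i) (k+1) x
    set C := es (s.erase i) (k+2) x
    refine le_of_mul_le_mul_right ?_ c
    nlinarith

theorem sq_div_add_le {a b y z : ℝ} (hy : 0 < y) (hz : 0 < z) {w : ℝ} (hw : y + z ≤ w) :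
    (a + b) ^ 2 / w ≤ a ^ 2 / y + b ^ 2 / z := by
  have h1 : (a + b)^2 / w ≤ (a+b)^2 / (y + z) := by gcongr
  refine h1.trans ?_
  rw [div_add_div _ _ hy.ne' hz.ne', div_le_div_iff₀ (by positivity) (by positivity)]
  nlinarith [sq_nonneg (a * z - b * y)]

theorem q_identity {ι : Type*} [DecidableEq ι] {s : Finset ι} {x : ι → ℝ} {k : ℕ}
    (h : Gam s (k + 1) x) :
    (k + 2) * (es s (k + 2) x / es s (k + 1) x) =
      ∑ i ∈ s, (x i - x i ^ 2 / (es s (k + 1) x / es (s.erase i) k x)) := by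
  have h0 := h (k+1) le_rfl
  have h1 := des_self s x (k+1)
  push_cast at h1
  rw [show (k:ℝ) + 2 = k + 1 + 1 by ring, ← mul_div_assoc, ← h1, des, Finset.sum_div]
  refine Finset.sum_congr rfl fun i hi => ?_
  have h2 := (Gam.erase hi h) k le_rfl
  have h3 := es_erase hi k x
  field_simp
  rw [h3]; ring

theorem q_superadd {ι : Type*} [DecidableEq ι] (k : ℕ) : ∀ (s : Finset ι) (x y : ι → ℝ),
    Gam s k x → Gam s k y → Gam s k (fun i => x i + y i) ∧
    es s (k+1) x / es s k x + es s (k+1) y / es s k y ≤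
      es s (k+1) (fun i => x i + y i) / es s k (fun i => x i + y i) := by
  induction k with
  | zero =>
    intro s x y _ _
    refine ⟨fun j hj => ?_, ?_⟩
    · obtain rfl : j = 0 := by omega
      rw [es_zero]; exact one_pos
    · simp [es_zero, es_one, Finset.sum_add_distrib]
  | succ k ih =>
    intro s x y hx hy
    obtain ⟨g, hq⟩ := ih s x y (hx.mono (by omega)) (hy.mono (by omega))
    have gk : Gam s (k+1) (fun i => x i + y i) := by
      intro j hj
      rcases Nat.lt_or_ge j (k+1) with hjk | hjk
      · exact g j (by omega)
      obtain rfl : j = k + 1 := by omega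
      have a := div_pos (hx (k+1) le_rfl) (hx k (by omega))
      have b := div_pos (hy (k+1) le_rfl) (hy k (by omega))
      have c := g k le_rfl
      have d : 0 < es s (k+1) (fun i => x i + y i) / es s k (fun i => x i + y i) := by linarith
      exact (div_pos_iff_of_pos_right c).1 d
    refine ⟨gk, ?_⟩
    have hk : (0:ℝ) < k + 2 := by positivity
    refine le_of_mul_le_mul_left ?_ hk
    rw [mul_add, q_identity hx, q_identity hy, q_identity gk, ← Finset.sum_add_distrib]
    refine Finset.sum_le_sum fun i hi => ?_
    have ex := Gam.erase hi hx
    have ey := Gam.erase hi hy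
    have ez := Gam.erase hi gk
    have h1 := (ih (s.erase i) x y ex ey).2
    have hw : es s (k+1) x / es (s.erase i) k x + es s (k+1) y / es (s.erase i) k y ≤
        es s (k+1) (fun i => x i + y i) / es (s.erase i) k (fun i => x i + y i) := by
      have t : ∀ z : ι → ℝ, Gam (s.erase i) k z → es s (k+1) z / es (s.erase i) k z =
          z i + es (s.erase i) (k+1) z / es (s.erase i) k z := by
        intro z hz
        have := hz k le_rfl
        rw [es_erase hi]; field_simp; ring
      rw [t _ ex, t _ ey, t _ ez]; linarith
    have := sq_div_add_le (a := x i) (b := y i) (div_pos (hx (k+1) le_rfl) (ex k le_rfl))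
      (div_pos (hy (k+1) le_rfl) (ey k le_rfl)) hw
    linarith

theorem es_eq_prod_q {ι : Type*} {s : Finset ι} {x : ι → ℝ} {k : ℕ} (h : Gam s k x) :
    es s k x = ∏ j ∈ Finset.range k, (es s (j+1) x / es s j x) := by
  induction k with
  | zero => simp [es_zero]
  | succ k ih =>
    rw [Finset.prod_range_succ, ← ih (h.mono (by omega))]
    have := h k (by omega)
    field_simp

theorem amgm_sum {k : ℕ} (r : ℕ → ℝ) (hr : ∀ j, j < k + 1 → 0 < r j) {b : ℝ} (hb : 0 < b)
    (h : ∏ j ∈ Finset.range (k+1), r j = b ^ (k+1)) :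
    (k + 1) * b ≤ ∑ j ∈ Finset.range (k+1), r j := by
  have h2 := Real.geom_mean_le_arith_mean_weighted (Finset.range (k+1))
    (fun _ => (1:ℝ)/(k+1)) r (fun _ _ => by positivity)
    (by simp; field_simp) (fun j hj => (hr j (Finset.mem_range.1 hj)).le)
  rw [Real.finsetProd_rpow _ _ (fun j hj => (hr j (Finset.mem_range.1 hj)).le), h,
    ← Real.rpow_natCast, ← Real.rpow_mul hb.le] at h2
  push_cast at h2
  rw [mul_one_div_cancel (by positivity), Real.rpow_one, ← Finset.mul_sum, one_div,
    ← div_eq_inv_mul, le_div_iff₀ (by positivity)] at h2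
  linarith

theorem garding_vec {ι : Type*} [DecidableEq ι] {s : Finset ι} {x y : ι → ℝ} {k : ℕ}
    (hx : Gam s (k+1) x) (hy : Gam s (k+1) y) {a b : ℝ} (ha : 0 < a) (hb : 0 < b)
    (hxa : es s (k+1) x = a ^ (k+1)) (hyb : es s (k+1) y = b ^ (k+1)) :
    (k + 1) * a ^ k * b ≤ des s k x y := by
  set p : ℕ → ℝ := fun j => es s (j+1) x / es s j x with hp
  set q : ℕ → ℝ := fun j => es s (j+1) y / es s j y with hq
  have pp : ∀ j, j < k+1 → 0 < p j := fun j hj => div_pos (hx _ (by omega)) (hx _ (by omega))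
  have qp : ∀ j, j < k+1 → 0 < q j := fun j hj => div_pos (hy _ (by omega)) (hy _ (by omega))
  have hP : HasDerivAt (fun t : ℝ => ∏ j ∈ Finset.range (k+1), (p j + t * q j))
      (∑ j ∈ Finset.range (k+1), (∏ l ∈ (Finset.range (k+1)).erase j, p l) * q j) 0 := by
    have := HasDerivAt.fun_finsetProd (u := Finset.range (k+1)) (f := fun j (t:ℝ) => p j + t * q j)
      (f' := q) (x := 0) (fun j _ => by
        simpa using ((hasDerivAt_id (0 : ℝ)).mul_const (q j)).const_add (p j))
    simpa using this
  have hE := hasDerivAt_es s x y k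
  have hge : ∀ t : ℝ, 0 < t → ∏ j ∈ Finset.range (k+1), (p j + t * q j) ≤
      es s (k+1) (fun i => x i + t * y i) := by
    intro t ht
    have hty : Gam s (k+1) (fun i => t * y i) := by
      intro j hj; rw [es_smul]; exact mul_pos (by positivity) (hy j hj)
    have g := (q_superadd (k+1) s x _ hx hty).1
    rw [es_eq_prod_q g]
    refine Finset.prod_le_prod (fun j hj => ?_) (fun j hj => ?_)
    · have := Finset.mem_range.1 hj
      have := pp j this; have := qp j (by assumption); positivity
    · have hj' := Finset.mem_range.1 hj
      have := (q_superadd j s x _ (hx.mono (by omega)) (hty.mono (by omega))).2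
      rw [es_smul, es_smul] at this
      refine le_trans (le_of_eq ?_) this
      have h0 := hy j (by omega)
      simp only [hp, hq]; congr 1; field_simp; ring
  have h0 : ∏ j ∈ Finset.range (k+1), (p j + 0 * q j) = es s (k+1) (fun i => x i + 0 * y i) := by
    simp only [zero_mul, add_zero]
    rw [es_eq_prod_q hx]
  have hD := hE.sub hP
  have hle : (∑ j ∈ Finset.range (k+1), (∏ l ∈ (Finset.range (k+1)).erase j, p l) * q j)
      ≤ des s k x y := by
    have hs := hD.tendsto_slope_zero_right
    have : 0 ≤ des s k x y -
        (∑ j ∈ Finset.range (k+1), (∏ l ∈ (Finset.range (k+1)).erase j, p l) * q j) := by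
      refine ge_of_tendsto hs ?_
      filter_upwards [self_mem_nhdsWithin] with t ht
      have ht : 0 < t := ht
      have := hge t ht
      simp only [zero_add, Pi.sub_apply, smul_eq_mul]
      rw [h0]
      have : 0 < t⁻¹ := by positivity
      apply mul_nonneg this.le
      linarith
    linarith
  refine le_trans ?_ hle
  have hprod : ∏ j ∈ Finset.range (k+1), p j = a^(k+1) := by rw [← hxa, es_eq_prod_q hx]
  have hprodq : ∏ j ∈ Finset.range (k+1), q j = b^(k+1) := by rw [← hyb, es_eq_prod_q hy]
  have hsum : (∑ j ∈ Finset.range (k+1), (∏ l ∈ (Finset.range (k+1)).erase j, p l) * q j) =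
      a^(k+1) * ∑ j ∈ Finset.range (k+1), q j / p j := by
    rw [Finset.mul_sum]
    refine Finset.sum_congr rfl fun j hj => ?_
    rw [← hprod, ← Finset.mul_prod_erase _ _ hj]
    have := pp j (Finset.mem_range.1 hj)
    field_simp
  rw [hsum]
  have hba : 0 < b / a := by positivity
  have := amgm_sum (k := k) (fun j => q j / p j) (fun j hj => div_pos (qp j hj) (pp j hj)) hba
    (by rw [Finset.prod_div_distrib, hprod, hprodq, div_pow])
  calc (k + 1) * a ^ k * b = a^(k+1) * ((k+1) * (b/a)) := by field_simp; ring
    _ ≤ _ := by gcongr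

theorem exists_spec {n : ℕ} (A : Matrix (Fin n) (Fin n) ℝ) (hA : Aᵀ = A) :
    ∃ (U : Matrix (Fin n) (Fin n) ℝ) (l : Fin n → ℝ), U * Uᵀ = 1 ∧ Uᵀ * U = 1 ∧
      A = U * diagonal l * Uᵀ ∧ (∀ j ≤ n, esymmMat j A = es Finset.univ j l) ∧
      (∀ j ≤ n, newtonT j A = U * diagonal (fun i => es (Finset.univ.erase i) j l) * Uᵀ) := by
  have hH : A.IsHermitian := by
    rw [Matrix.IsHermitian, Matrix.conjTranspose_eq_transpose_of_trivial]; exact hA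
  set U : Matrix (Fin n) (Fin n) ℝ := (hH.eigenvectorUnitary).1 with hU
  set l := hH.eigenvalues with hl
  have h1 : U * Uᵀ = 1 := by
    have := Unitary.coe_mul_star_self hH.eigenvectorUnitary
    rw [Unitary.coe_star] at this
    rwa [Matrix.star_eq_conjTranspose, Matrix.conjTranspose_eq_transpose_of_trivial] at this
  have h2 : Uᵀ * U = 1 := by
    have := Unitary.coe_star_mul_self hH.eigenvectorUnitary
    try rw [Unitary.coe_star] at this
    rwa [Matrix.star_eq_conjTranspose, Matrix.conjTranspose_eq_transpose_of_trivial] at this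
  have h3 : A = U * diagonal l * Uᵀ := by
    have := hH.spectral_theorem
    rw [Unitary.conjStarAlgAut_apply, Matrix.star_eq_conjTranspose,
      Matrix.conjTranspose_eq_transpose_of_trivial] at this
    exact this
  have h4 : ∀ j ≤ n, esymmMat j A = es Finset.univ j l := by
    intro j hj
    unfold esymmMat
    rw [hH.charpoly_eq]
    have := Multiset.prod_X_sub_C_coeff (Multiset.map l (Finset.univ : Finset (Fin n)).val)
      (k := n - j) (by simp)
    rw [Multiset.map_map] at this
    have h5 : (∏ i, (Polynomial.X - Polynomial.C (hH.eigenvalues i)) : Polynomial ℝ).coeff (n - j) =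
        (-1) ^ j * es Finset.univ j l := by
      rw [es, ← Finset.esymm_map_val]
      have e : n - (n - j) = j := by omega
      rw [Multiset.card_map, Finset.card_val, Finset.card_univ, Fintype.card_fin, e] at this
      exact this
    simp only [RCLike.ofReal_real_eq_id, id] at *
    rw [h5, ← mul_assoc, ← mul_pow]; simp
  refine ⟨U, l, h1, h2, h3, h4, ?_⟩
  intro j
  induction j with
  | zero => intro _; simp [newtonT, es_zero, h1]
  | succ j ih =>
    intro hj
    rw [newtonT, ih (by omega), h4 _ hj]
    have e1 : U * diagonal (fun i => es (Finset.univ.erase i) j l) * Uᵀ * A =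
        U * diagonal (fun i => es (Finset.univ.erase i) j l * l i) * Uᵀ := by
      conv_lhs => rw [h3]
      rw [← diagonal_mul_diagonal]
      calc U * diagonal (fun i => es (Finset.univ.erase i) j l) * Uᵀ * (U * diagonal l * Uᵀ)
          = U * diagonal (fun i => es (Finset.univ.erase i) j l) * (Uᵀ * U) * diagonal l * Uᵀ := by
            simp only [Matrix.mul_assoc]
        _ = _ := by rw [h2]; simp only [Matrix.mul_assoc, Matrix.mul_one, Matrix.one_mul]
    have e2 : (es Finset.univ (j+1) l) • (1 : Matrix (Fin n) (Fin n) ℝ) =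
        U * Matrix.diagonal (fun _ => es Finset.univ (j+1) l) * Uᵀ := by
      rw [← smul_one_eq_diagonal, mul_smul_comm, smul_mul_assoc, Matrix.mul_one, h1]
    rw [e1, e2, ← Matrix.sub_mul, ← Matrix.mul_sub, diagonal_sub]
    congr 3
    ext i
    rw [es_erase (Finset.mem_univ i)]; ring

theorem trace_conj {n : ℕ} (U X : Matrix (Fin n) (Fin n) ℝ) (h2 : Uᵀ * U = 1) :
    trace (U * X * Uᵀ) = trace X := by
  rw [trace_mul_comm, ← Matrix.mul_assoc, h2, Matrix.one_mul]

theorem trace_newtonT {n : ℕ} (A : Matrix (Fin n) (Fin n) ℝ) (hA : Aᵀ = A) {j : ℕ} (hj : j ≤ n) :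
    trace (newtonT j A) = ((n : ℝ) - j) * esymmMat j A := by
  obtain ⟨U, l, h1, h2, h3, h4, h5⟩ := exists_spec A hA
  rw [h5 j hj, h4 j hj, trace_conj _ _ h2, trace_diagonal]
  have := sum_es_erase (Finset.univ : Finset (Fin n)) l j
  simpa [des] using this

theorem trace_newtonT_mul {n : ℕ} (A : Matrix (Fin n) (Fin n) ℝ) (hA : Aᵀ = A) {j : ℕ}
    (hj : j + 1 ≤ n) :
    trace (newtonT j A * A) = ((j : ℝ) + 1) * esymmMat (j + 1) A := by
  have h1 := trace_newtonT A hA (j := j) (by omega)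
  have h2 := trace_newtonT A hA (j := j+1) hj
  rw [newtonT, trace_sub, trace_smul, trace_one] at h2
  simp at h2
  linarith

theorem newtonT_symm {n : ℕ} (A : Matrix (Fin n) (Fin n) ℝ) (hA : Aᵀ = A) {j : ℕ} (hj : j ≤ n) :
    (newtonT j A)ᵀ = newtonT j A := by
  obtain ⟨U, l, h1, h2, h3, h4, h5⟩ := exists_spec A hA
  rw [h5 j hj]; simp [Matrix.transpose_mul, Matrix.mul_assoc]

theorem newtonT_comm {n : ℕ} (A : Matrix (Fin n) (Fin n) ℝ) (j : ℕ) :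
    A * newtonT j A = newtonT j A * A := by
  induction j with
  | zero => simp [newtonT]
  | succ j ih =>
    rw [newtonT, Matrix.mul_sub, Matrix.sub_mul, ← Matrix.mul_assoc, ih]; simp

theorem esymmMat_zero {n : ℕ} (A : Matrix (Fin n) (Fin n) ℝ) : esymmMat 0 A = 1 := by
  have := A.charpoly_monic
  have h2 := A.charpoly_natDegree_eq_dim
  unfold esymmMat
  rw [Polynomial.Monic, Polynomial.leadingCoeff, h2] at this
  simpa using this

/-- Bilinear form associated with a matrix. -/
def qf {n : ℕ} (T : Matrix (Fin n) (Fin n) ℝ) (a b : Fin n → ℝ) : ℝ :=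
  ∑ i, ∑ m, T i m * a i * b m

theorem qf_eq {n : ℕ} (T : Matrix (Fin n) (Fin n) ℝ) (a b : Fin n → ℝ) :
    qf T a b = a ⬝ᵥ (T *ᵥ b) := by
  simp only [qf, dotProduct, mulVec, Finset.mul_sum]
  refine Finset.sum_congr rfl fun i _ => Finset.sum_congr rfl fun j _ => by ring

theorem Gam_of_GammaPlus {n k : ℕ} {A : Matrix (Fin n) (Fin n) ℝ} {l : Fin n → ℝ}
    (h4 : ∀ j ≤ n, esymmMat j A = es Finset.univ j l) (hk : k ≤ n) (h : GammaPlus k A) :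
    Gam Finset.univ k l := by
  intro j hj
  rcases Nat.eq_zero_or_pos j with rfl | h0
  · rw [es_zero]; exact one_pos
  · rw [← h4 j (by omega)]; exact h j h0 hj

theorem newtonT_lower {n k : ℕ} (A : Matrix (Fin n) (Fin n) ℝ) (hA : Aᵀ = A) (hk : k + 1 ≤ n)
    (h : GammaPlus (k+1) A) (a : Fin n → ℝ) :
    esymmMat (k+1) A * ∑ i, a i ^ 2 ≤ esymmMat 1 A * qf (newtonT k A) a a := by
  obtain ⟨U, l, h1, h2, h3, h4, h5⟩ := exists_spec A hA
  have hG := Gam_of_GammaPlus h4 hk h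
  set c := Uᵀ *ᵥ a with hc
  have hac : ∑ i, a i ^ 2 = ∑ i, c i ^ 2 := by
    have : c ⬝ᵥ c = a ⬝ᵥ a := by
      rw [hc, Matrix.dotProduct_mulVec, ← Matrix.mulVec_transpose, Matrix.mulVec_mulVec,
        Matrix.transpose_transpose, h1, Matrix.one_mulVec]
    simpa [dotProduct, sq] using this.symm
  have hq : qf (newtonT k A) a a = ∑ i, es (Finset.univ.erase i) k l * c i ^ 2 := by
    rw [qf_eq, h5 k (by omega), ← Matrix.mulVec_mulVec, ← hc, ← Matrix.mulVec_mulVec,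
      Matrix.dotProduct_mulVec, ← Matrix.mulVec_transpose, ← hc]
    simp only [dotProduct, mulVec_diagonal]
    refine Finset.sum_congr rfl fun i _ => by ring
  rw [hac, hq, h4 _ hk, h4 1 (by omega), Finset.mul_sum, Finset.mul_sum]
  refine Finset.sum_le_sum fun i _ => ?_
  have := es_lower (Finset.mem_univ i) hG
  rw [← mul_assoc]
  gcongr

theorem qf_nonneg {n k : ℕ} (A : Matrix (Fin n) (Fin n) ℝ) (hA : Aᵀ = A) (hk : k + 1 ≤ n)
    (h : GammaPlus (k+1) A) (a : Fin n → ℝ) : 0 ≤ qf (newtonT k A) a a := by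
  have h1 := newtonT_lower A hA hk h a
  have h2 := h 1 (by omega) (by omega)
  have h3 := h (k+1) (by omega) (by omega)
  have h4 : 0 ≤ ∑ i, a i ^ 2 := Finset.sum_nonneg fun i _ => sq_nonneg _
  have := mul_nonneg h3.le h4
  exact nonneg_of_mul_nonneg_right (this.trans h1) h2

theorem es_perm {n : ℕ} (σ : Equiv.Perm (Fin n)) (j : ℕ) (x : Fin n → ℝ) :
    es Finset.univ j (fun i => x (σ i)) = es Finset.univ j x := by
  rw [es, es, ← Finset.esymm_map_val, ← Finset.esymm_map_val]
  congr 1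
  have : Multiset.map (fun i => x (σ i)) Finset.univ.val =
      Multiset.map x (Multiset.map σ (Finset.univ : Finset (Fin n)).val) := by
    rw [Multiset.map_map]; rfl
  rw [this]
  congr 1
  exact Multiset.map_univ_val_equiv σ

theorem garding_mat {n k : ℕ} (A B : Matrix (Fin n) (Fin n) ℝ) (hA : Aᵀ = A) (hB : Bᵀ = B)
    (hk : k + 1 ≤ n) (gA : GammaPlus (k+1) A) (gB : GammaPlus (k+1) B) {a b : ℝ}
    (ha : 0 < a) (hb : 0 < b) (hAa : esymmMat (k+1) A = a ^ (k+1))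
    (hBb : esymmMat (k+1) B = b ^ (k+1)) :
    (k + 1) * a ^ k * b ≤ trace (newtonT k A * B) := by
  obtain ⟨U, l, h1, h2, h3, h4, h5⟩ := exists_spec A hA
  obtain ⟨V, m, g1, g2, g3, g4, g5⟩ := exists_spec B hB
  have hl := Gam_of_GammaPlus h4 hk gA
  have hm := Gam_of_GammaPlus g4 hk gB
  set W := Uᵀ * V with hW
  have W1 : W * Wᵀ = 1 := by
    rw [hW, Matrix.transpose_mul, Matrix.transpose_transpose]
    calc Uᵀ * V * (Vᵀ * U) = Uᵀ * (V * Vᵀ) * U := by simp only [Matrix.mul_assoc]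
      _ = 1 := by rw [g1, Matrix.mul_one, h2]
  have W2 : Wᵀ * W = 1 := by
    rw [hW, Matrix.transpose_mul, Matrix.transpose_transpose]
    calc Vᵀ * U * (Uᵀ * V) = Vᵀ * (U * Uᵀ) * V := by simp only [Matrix.mul_assoc]
      _ = 1 := by rw [h1, Matrix.mul_one, g2]
  set P : Matrix (Fin n) (Fin n) ℝ := Matrix.of fun i j => W i j ^ 2 with hP
  have hPd : P ∈ doublyStochastic ℝ (Fin n) := by
    rw [mem_doublyStochastic_iff_sum]
    refine ⟨fun i j => sq_nonneg _, fun i => ?_, fun j => ?_⟩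
    · have := congrFun (congrFun W1 i) i
      simpa [Matrix.mul_apply, hP, sq] using this
    · have := congrFun (congrFun W2 j) j
      simpa [Matrix.mul_apply, hP, sq] using this
  obtain ⟨w, w0, w1, wP⟩ := exists_eq_sum_perm_of_mem_doublyStochastic hPd
  set d : Fin n → ℝ := fun i => es (Finset.univ.erase i) k l with hd
  have htr : trace (newtonT k A * B) = ∑ i, ∑ j, d i * m j * P i j := by
    rw [h5 k (by omega), g3]
    have : trace (U * diagonal d * Uᵀ * (V * diagonal m * Vᵀ)) =
        trace (diagonal d * W * diagonal m * Wᵀ) := by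
      rw [hW, Matrix.transpose_mul, Matrix.transpose_transpose]
      calc trace (U * diagonal d * Uᵀ * (V * diagonal m * Vᵀ))
          = trace (U * (diagonal d * Uᵀ * (V * diagonal m * Vᵀ))) := by
            simp only [Matrix.mul_assoc]
        _ = trace ((diagonal d * Uᵀ * (V * diagonal m * Vᵀ)) * U) := trace_mul_comm _ _
        _ = _ := by simp only [Matrix.mul_assoc]
    rw [this, trace]
    refine Finset.sum_congr rfl fun i _ => ?_
    rw [Matrix.diag_apply, Matrix.mul_apply]
    refine Finset.sum_congr rfl fun j _ => ?_
    rw [Matrix.mul_diagonal, Matrix.diagonal_mul, Matrix.transpose_apply, hP, Matrix.of_apply]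
    ring
  have hkey : ∀ σ : Equiv.Perm (Fin n), (k+1) * a^k * b ≤ ∑ i, d i * m (σ i) := by
    intro σ
    have hm' : Gam Finset.univ (k+1) (fun i => m (σ i)) := by
      intro j hj; rw [es_perm]; exact hm j hj
    have := garding_vec hl hm' ha hb (by rw [← h4 _ hk, hAa]) (by rw [es_perm, ← g4 _ hk, hBb])
    refine this.trans (le_of_eq ?_)
    exact Finset.sum_congr rfl fun i _ => by rw [hd]; ring
  have hperm : ∀ σ : Equiv.Perm (Fin n),
      ∑ i, ∑ j, d i * m j * (σ.permMatrix ℝ) i j = ∑ i, d i * m (σ i) := by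
    intro σ
    refine Finset.sum_congr rfl fun i _ => ?_
    have := congrFun (Matrix.permMatrix_mulVec (σ := σ) (v := m)) i
    rw [Matrix.mulVec, dotProduct] at this
    simp only [Function.comp] at this
    rw [← this, Finset.mul_sum]
    refine Finset.sum_congr rfl fun j _ => by ring
  rw [htr, ← wP]
  have : ∑ i, ∑ j, d i * m j * (∑ σ : Equiv.Perm (Fin n), w σ • σ.permMatrix ℝ) i j =
      ∑ σ : Equiv.Perm (Fin n), w σ * ∑ i, d i * m (σ i) := by
    calc ∑ i, ∑ j, d i * m j * (∑ σ : Equiv.Perm (Fin n), w σ • σ.permMatrix ℝ) i j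
        = ∑ i, ∑ j, ∑ σ : Equiv.Perm (Fin n), w σ * (d i * m j * (σ.permMatrix ℝ) i j) := by
          refine Finset.sum_congr rfl fun i _ => Finset.sum_congr rfl fun j _ => ?_
          rw [Matrix.sum_apply, Finset.mul_sum]
          refine Finset.sum_congr rfl fun σ _ => ?_
          rw [Matrix.smul_apply, smul_eq_mul]; ring
      _ = ∑ i, ∑ σ : Equiv.Perm (Fin n), ∑ j, w σ * (d i * m j * (σ.permMatrix ℝ) i j) :=
          Finset.sum_congr rfl fun i _ => Finset.sum_comm
      _ = ∑ σ : Equiv.Perm (Fin n), ∑ i, ∑ j, w σ * (d i * m j * (σ.permMatrix ℝ) i j) :=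
          Finset.sum_comm
      _ = _ := by
          refine Finset.sum_congr rfl fun σ _ => ?_
          rw [← hperm, Finset.mul_sum]
          refine Finset.sum_congr rfl fun i _ => ?_
          rw [Finset.mul_sum]
  rw [this]
  calc (k+1) * a^k * b = ∑ σ : Equiv.Perm (Fin n), w σ * ((k+1) * a^k * b) := by
        rw [← Finset.sum_mul, w1, one_mul]
    _ ≤ _ := Finset.sum_le_sum fun σ _ => mul_le_mul_of_nonneg_left (hkey σ) (w0 σ)

theorem qf_cauchy {n : ℕ} (T : Matrix (Fin n) (Fin n) ℝ) (hT : Tᵀ = T)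
    (h : ∀ a, 0 ≤ qf T a a) (a b : Fin n → ℝ) {r : ℝ} (hr : 0 < r) :
    |qf T a b| ≤ r * qf T a a + qf T b b / r := by
  have hsym : qf T b a = qf T a b := by
    unfold qf; rw [Finset.sum_comm]
    refine Finset.sum_congr rfl fun i _ => Finset.sum_congr rfl fun j _ => ?_
    have := congrFun (congrFun hT i) j
    rw [Matrix.transpose_apply] at this
    rw [this]; ring
  have key : ∀ e : ℝ, qf T (fun i => r * a i + e * b i) (fun i => r * a i + e * b i) =
      r^2 * qf T a a + e * r * 2 * qf T a b + e^2 * qf T b b := by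
    intro e
    have : qf T (fun i => r * a i + e * b i) (fun i => r * a i + e * b i) =
      r^2 * qf T a a + e * r * qf T a b + e * r * qf T b a + e^2 * qf T b b := by
      unfold qf
      simp only [Finset.mul_sum, ← Finset.sum_add_distrib]
      refine Finset.sum_congr rfl fun i _ => Finset.sum_congr rfl fun j _ => by ring
    rw [this, hsym]; ring
  have k1 := key 1
  have k2 := key (-1)
  have n1 := h (fun i => r * a i + 1 * b i)
  have n2 := h (fun i => r * a i + (-1) * b i)
  rw [k1] at n1; rw [k2] at n2
  have ha := h a
  have hb := h b
  have e : r * qf T a a + qf T b b / r = (r^2 * qf T a a + qf T b b) / r := by field_simp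
  rw [abs_le, e, ← neg_div, div_le_iff₀ hr, le_div_iff₀ hr]
  have h0 := mul_nonneg (sq_nonneg r) ha
  constructor <;> nlinarith

/-- Auxiliary matrices for the differentiation of `σ_j`. -/
noncomputable def XX {n : ℕ} (A : Matrix (Fin n) (Fin n) ℝ) : ℕ → ℕ → Matrix (Fin n) (Fin n) ℝ
  | 0, _ => 0
  | (j+1), m => trace (A ^ m) • newtonT j A - newtonT j A * A ^ m - XX A j (m+1)

theorem newtonT_pow_comm {n : ℕ} (A : Matrix (Fin n) (Fin n) ℝ) (j m : ℕ) :
    A ^ m * newtonT j A = newtonT j A * A ^ m := by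
  have : Commute A (newtonT j A) := newtonT_comm A j
  exact (this.pow_left m).eq

theorem newtonT_succ {n : ℕ} (A : Matrix (Fin n) (Fin n) ℝ) (j : ℕ) :
    newtonT (j+1) A = esymmMat (j + 1) A • (1 : Matrix (Fin n) (Fin n) ℝ) - newtonT j A * A := rfl

theorem XX_succ {n : ℕ} (A : Matrix (Fin n) (Fin n) ℝ) (j m : ℕ) :
    XX A (j+1) m = trace (A ^ m) • newtonT j A - newtonT j A * A ^ m - XX A j (m+1) := rfl

theorem XX_id {n : ℕ} (A : Matrix (Fin n) (Fin n) ℝ) (j : ℕ) : ∀ m,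
    XX A (j+1) m + XX A j m * A = trace (newtonT j A * A ^ m) • 1 - newtonT j A * A ^ m := by
  induction j with
  | zero => intro m; simp [XX, newtonT]
  | succ j ih =>
    intro m
    have h := ih (m+1)
    rw [XX_succ A (j+1), XX_succ A j m]
    have e : XX A (j+1) (m+1) = trace (newtonT j A * A ^ (m+1)) • 1 - newtonT j A * A ^ (m+1)
        - XX A j (m+1) * A := by rw [← h]; abel
    have e2 : newtonT (j+1) A * A ^ m = esymmMat (j+1) A • A ^ m - newtonT j A * A ^ (m+1) := by
      rw [newtonT_succ, Matrix.sub_mul, smul_mul_assoc, Matrix.one_mul, Matrix.mul_assoc, ← pow_succ']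
    rw [e, e2, newtonT_succ]
    have e3 : newtonT j A * A ^ m * A = newtonT j A * A ^ (m+1) := by
      rw [Matrix.mul_assoc, ← pow_succ]
    rw [Matrix.sub_mul, Matrix.sub_mul, smul_mul_assoc, e3, trace_sub, trace_smul, smul_sub, sub_smul,
      smul_smul, smul_eq_mul, mul_comm (trace (A^m))]
    abel

theorem XX_one {n : ℕ} (A : Matrix (Fin n) (Fin n) ℝ) (hA : Aᵀ = A) (j : ℕ) (hj : j ≤ n) :
    XX A j 1 = (j : ℝ) • newtonT j A := by
  induction j with
  | zero => simp [XX]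
  | succ j ih =>
    have h := XX_id A j 1
    rw [pow_one, trace_newtonT_mul A hA hj, ih (by omega)] at h
    have : XX A (j+1) 1 = ((j:ℝ)+1) • newtonT (j+1) A := by
      rw [eq_sub_of_add_eq h, newtonT_succ, smul_mul_assoc, smul_sub, smul_smul, add_smul _ _ (newtonT j A * A), one_smul]
      abel
    rw [this]; push_cast; rfl

/-- formal derivative of `newtonT j`. -/
noncomputable def dN {n : ℕ} (A A' : Matrix (Fin n) (Fin n) ℝ) : ℕ → Matrix (Fin n) (Fin n) ℝ
  | 0 => 0
  | (j+1) => trace (newtonT j A * A') • 1 - dN A A' j * A - newtonT j A * A'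

theorem dN_trace {n : ℕ} (A A' : Matrix (Fin n) (Fin n) ℝ) (j : ℕ) : ∀ m,
    trace (dN A A' j * A ^ m) = trace (XX A j m * A') := by
  induction j with
  | zero => intro m; simp [dN, XX]
  | succ j ih =>
    intro m
    have h := ih (m+1)
    rw [dN, XX_succ]
    have e1 : dN A A' j * A * A ^ m = dN A A' j * A ^ (m+1) := by
      rw [Matrix.mul_assoc, ← pow_succ']
    have e2 : trace (newtonT j A * A' * A ^ m) = trace (newtonT j A * A ^ m * A') := by
      rw [trace_mul_comm, ← Matrix.mul_assoc, newtonT_pow_comm]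
    simp only [Matrix.sub_mul, trace_sub, smul_mul_assoc, Matrix.one_mul, trace_smul, e1, e2, h,
      smul_eq_mul]
    ring

theorem dN_trace_one {n : ℕ} (A A' : Matrix (Fin n) (Fin n) ℝ) (hA : Aᵀ = A) (j : ℕ) (hj : j ≤ n) :
    trace (dN A A' j * A) = j * trace (newtonT j A * A') := by
  have := dN_trace A A' j 1
  rw [pow_one, XX_one A hA j hj, smul_mul_assoc, trace_smul] at this
  simpa using this

theorem hasDerivAt_matmul {n : ℕ} {A B : ℝ → Matrix (Fin n) (Fin n) ℝ}
    {A' B' : Matrix (Fin n) (Fin n) ℝ} {t : ℝ}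
    (hA : ∀ i m, HasDerivAt (fun s => A s i m) (A' i m) t)
    (hB : ∀ i m, HasDerivAt (fun s => B s i m) (B' i m) t) (i m : Fin n) :
    HasDerivAt (fun s => (A s * B s) i m) ((A' * B t + A t * B') i m) t := by
  simp only [Matrix.mul_apply, Matrix.add_apply, ← Finset.sum_add_distrib]
  exact HasDerivAt.fun_sum fun l _ => (hA i l).mul (hB l m)

theorem hasDerivAt_trace {n : ℕ} {A : ℝ → Matrix (Fin n) (Fin n) ℝ}
    {A' : Matrix (Fin n) (Fin n) ℝ} {t : ℝ}
    (hA : ∀ i m, HasDerivAt (fun s => A s i m) (A' i m) t) :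
    HasDerivAt (fun s => trace (A s)) (trace A') t := by
  simp only [trace, diag_apply]
  exact HasDerivAt.fun_sum fun l _ => hA l l

theorem esymmMat_succ {n : ℕ} (A : Matrix (Fin n) (Fin n) ℝ) (hA : Aᵀ = A) {j : ℕ} (hj : j + 1 ≤ n) :
    esymmMat (j+1) A = trace (newtonT j A * A) / ((j:ℝ)+1) := by
  rw [trace_newtonT_mul A hA hj]; field_simp

theorem hasDerivAt_newtonT {n : ℕ} {A : ℝ → Matrix (Fin n) (Fin n) ℝ}
    {A' : Matrix (Fin n) (Fin n) ℝ} {t : ℝ} (hs : ∀ s, (A s)ᵀ = A s)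
    (hA : ∀ i m, HasDerivAt (fun s => A s i m) (A' i m) t) (j : ℕ) (hj : j ≤ n) :
    (∀ i m, HasDerivAt (fun s => newtonT j (A s) i m) (dN (A t) A' j i m) t) ∧
    (j + 1 ≤ n → HasDerivAt (fun s => esymmMat (j+1) (A s)) (trace (newtonT j (A t) * A')) t) := by
  induction j with
  | zero =>
    refine ⟨fun i m => ?_, fun h => ?_⟩
    · simp only [newtonT, dN, Matrix.zero_apply]; exact hasDerivAt_const _ _
    · have := hasDerivAt_trace hA
      simp only [newtonT, Matrix.one_mul]
      have e : (fun s => esymmMat (0+1) (A s)) = fun s => trace (A s) := by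
        ext s; rw [esymmMat_succ (A s) (hs s) h]; simp [newtonT]
      rw [e]; exact this
  | succ j ih =>
    obtain ⟨h1, h2⟩ := ih (by omega)
    have h3 := h2 hj
    have h4 : ∀ i m, HasDerivAt (fun s => newtonT (j+1) (A s) i m) (dN (A t) A' (j+1) i m) t := by
      intro i m
      have := (h3.mul_const ((1 : Matrix (Fin n) (Fin n) ℝ) i m)).sub (hasDerivAt_matmul h1 hA i m)
      refine HasDerivAt.congr_deriv (f := fun s => newtonT (j+1) (A s) i m) (f' := _) this ?_
      rw [dN]; simp only [Matrix.sub_apply, Matrix.smul_apply, smul_eq_mul, Matrix.add_apply]; ring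
    refine ⟨h4, fun hj2 => ?_⟩
    have := (hasDerivAt_trace (fun i m => hasDerivAt_matmul h4 hA i m)).div_const ((((j+1:ℕ)):ℝ)+1)
    have e : (fun s => esymmMat (j+1+1) (A s)) =
        fun s => trace (newtonT (j+1) (A s) * A s) / ((((j+1:ℕ)):ℝ)+1) := by
      ext s; rw [esymmMat_succ (A s) (hs s) hj2]
    rw [e]
    refine HasDerivAt.congr_deriv this ?_
    rw [trace_add, dN_trace_one _ _ (hs t) _ hj]
    have : (((j+1:ℕ)):ℝ)+1 ≠ 0 := by positivity
    field_simp

theorem newtonT_contDiff {n : ℕ} {E : Type*} [NormedAddCommGroup E] [NormedSpace ℝ E]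
    {r : WithTop ℕ∞} {A : E → Matrix (Fin n) (Fin n) ℝ} (hs : ∀ s, (A s)ᵀ = A s)
    (hA : ∀ i m, ContDiff ℝ r (fun s => A s i m)) (j : ℕ) (hj : j ≤ n) :
    (∀ i m, ContDiff ℝ r (fun s => newtonT j (A s) i m)) ∧
    ContDiff ℝ r (fun s => esymmMat j (A s)) := by
  induction j with
  | zero => simp only [esymmMat_zero, newtonT]; exact ⟨fun _ _ => contDiff_const, contDiff_const⟩
  | succ j ih =>
    obtain ⟨h1, h2⟩ := ih (by omega)
    have hm : ∀ i m, ContDiff ℝ r (fun s => (newtonT j (A s) * A s) i m) := by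
      intro i m
      simp only [Matrix.mul_apply]
      exact ContDiff.sum fun l _ => (h1 i l).mul (hA l m)
    have h3 : ContDiff ℝ r (fun s => esymmMat (j+1) (A s)) := by
      have e : (fun s => esymmMat (j+1) (A s)) =
        fun s => trace (newtonT j (A s) * A s) / ((j:ℝ)+1) := by
        ext s; rw [esymmMat_succ (A s) (hs s) hj]
      rw [e]
      simp only [trace, diag_apply]
      exact (ContDiff.sum fun l _ => hm l l).div_const _
    refine ⟨fun i m => ?_, h3⟩
    simp only [newtonT_succ, Matrix.sub_apply, Matrix.smul_apply, smul_eq_mul]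
    exact (h3.mul contDiff_const).sub (hm i m)

theorem newtonT_tendsto {n : ℕ} {ι : Type*} {F : Filter ι}
    {A : ι → Matrix (Fin n) (Fin n) ℝ} {B : Matrix (Fin n) (Fin n) ℝ} (hs : ∀ s, (A s)ᵀ = A s)
    (hB : Bᵀ = B)
    (hA : ∀ i m, Filter.Tendsto (fun s => A s i m) F (nhds (B i m))) (j : ℕ) (hj : j ≤ n) :
    (∀ i m, Filter.Tendsto (fun s => newtonT j (A s) i m) F (nhds (newtonT j B i m))) ∧
    Filter.Tendsto (fun s => esymmMat j (A s)) F (nhds (esymmMat j B)) := by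
  induction j with
  | zero =>
    simp only [esymmMat_zero, newtonT]; exact ⟨fun _ _ => tendsto_const_nhds, tendsto_const_nhds⟩
  | succ j ih =>
    obtain ⟨h1, h2⟩ := ih (by omega)
    have hm : ∀ i m, Filter.Tendsto (fun s => (newtonT j (A s) * A s) i m) F
        (nhds ((newtonT j B * B) i m)) := by
      intro i m
      simp only [Matrix.mul_apply]
      exact tendsto_finsetSum _ fun l _ => (h1 i l).mul (hA l m)
    have h3 : Filter.Tendsto (fun s => esymmMat (j+1) (A s)) F (nhds (esymmMat (j+1) B)) := by
      have e : (fun s => esymmMat (j+1) (A s)) =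
        fun s => trace (newtonT j (A s) * A s) / ((j:ℝ)+1) := by
        ext s; rw [esymmMat_succ (A s) (hs s) hj]
      rw [e, esymmMat_succ B hB hj]
      simp only [trace, diag_apply]
      exact (tendsto_finsetSum _ fun l _ => hm l l).div_const _
    refine ⟨fun i m => ?_, h3⟩
    simp only [newtonT_succ, Matrix.sub_apply, Matrix.smul_apply, smul_eq_mul]
    exact (h3.mul tendsto_const_nhds).sub (hm i m)

theorem newtonT_bound {n : ℕ} (j : ℕ) (hj : j ≤ n) : ∃ C : ℝ, 0 ≤ C ∧
    ∀ (A : Matrix (Fin n) (Fin n) ℝ) (a : ℝ), Aᵀ = A → 0 ≤ a → (∀ i m, |A i m| ≤ a) →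
      (∀ i m, |newtonT j A i m| ≤ C * a ^ j) ∧ |esymmMat j A| ≤ C * a ^ j := by
  induction j with
  | zero =>
    refine ⟨1, zero_le_one, fun A a hA ha h => ?_⟩
    simp only [esymmMat_zero, newtonT, pow_zero, mul_one, abs_one, le_refl, and_true]
    intro i m
    by_cases him : i = m <;> simp [him, Matrix.one_apply]
  | succ j ih =>
    obtain ⟨C, hC, h⟩ := ih (by omega)
    refine ⟨n * (n * C) + n * C, by positivity, fun A a hA ha hAa => ?_⟩
    obtain ⟨h1, h2⟩ := h A a hA ha hAa
    have hm : ∀ i m, |(newtonT j A * A) i m| ≤ n * C * a ^ (j+1) := by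
      intro i m
      rw [Matrix.mul_apply]
      refine (Finset.abs_sum_le_sum_abs _ _).trans ?_
      refine (Finset.sum_le_sum (g := fun _ => C * a^j * a) fun l _ => ?_).trans (le_of_eq ?_)
      · rw [abs_mul]; exact mul_le_mul (h1 i l) (hAa l m) (abs_nonneg _) (by positivity)
      · simp; ring
    have h3 : |esymmMat (j+1) A| ≤ n * (n * C) * a ^ (j+1) := by
      rw [esymmMat_succ A hA hj, abs_div, abs_of_pos (by positivity : (0:ℝ) < (j:ℝ)+1)]
      have : |trace (newtonT j A * A)| ≤ n * (n * C) * a ^ (j+1) := by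
        refine (Finset.abs_sum_le_sum_abs _ _).trans ?_
        refine (Finset.sum_le_sum (g := fun _ => n * C * a^(j+1)) fun l _ => hm l l).trans (le_of_eq ?_)
        simp; ring
      refine (div_le_self (abs_nonneg _) ?_).trans this
      have : (0:ℝ) ≤ j := by positivity
      linarith
    have hp : 0 ≤ n * C * a ^ (j+1) := by positivity
    refine ⟨fun i m => ?_, by rw [add_mul]; linarith⟩
    rw [newtonT_succ, Matrix.sub_apply, Matrix.smul_apply, smul_eq_mul, add_mul]
    refine (abs_sub _ _).trans (add_le_add ?_ (hm i m))
    rw [abs_mul]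
    have : |(1 : Matrix (Fin n) (Fin n) ℝ) i m| ≤ 1 := by
      by_cases him : i = m <;> simp [him, Matrix.one_apply]
    calc _ ≤ n * (n * C) * a ^ (j+1) * 1 := mul_le_mul h3 this (abs_nonneg _) (by positivity)
      _ = _ := mul_one _

/-- The vector `(n-j) ∑ h_i T_{j-1}^{im}`. -/
noncomputable def DD {n : ℕ} (A : Matrix (Fin n) (Fin n) ℝ) (h : Fin n → ℝ) : ℕ → Fin n → ℝ
  | 0, _ => 0
  | (j+1), m => ((n:ℝ) - j - 1) * ∑ i, h i * newtonT j A i m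

theorem DD_mul {n : ℕ} (A : Matrix (Fin n) (Fin n) ℝ) (h : Fin n → ℝ) (j : ℕ) (m : Fin n) :
    ∑ l, DD A h j l * A l m =
      ((n:ℝ) - j) * (esymmMat j A * h m - ∑ i, h i * newtonT j A i m) := by
  cases j with
  | zero => simp [DD, esymmMat_zero, newtonT, Matrix.one_apply]
  | succ j =>
    simp only [DD, newtonT_succ, Matrix.sub_apply, Matrix.smul_apply, Matrix.one_apply,
      Matrix.mul_apply, smul_eq_mul, mul_sub, Finset.sum_sub_distrib, mul_ite, mul_one, mul_zero,
      Finset.sum_ite_eq', Finset.mem_univ, if_true]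
    have : ∑ l, ((n:ℝ) - j - 1) * (∑ i, h i * newtonT j A i l) * A l m =
      ((n:ℝ) - j - 1) * ∑ i, h i * ∑ l, newtonT j A i l * A l m := by
      simp only [Finset.mul_sum, Finset.sum_mul]
      rw [Finset.sum_comm]
      refine Finset.sum_congr rfl fun i _ => Finset.sum_congr rfl fun l _ => by ring
    rw [this]
    push_cast; ring

theorem div_alg {n : ℕ} (A : Matrix (Fin n) (Fin n) ℝ) (hA : Aᵀ = A)
    (B : Fin n → Matrix (Fin n) (Fin n) ℝ) (h : Fin n → ℝ)
    (hB : ∀ i l m, B m l i - B i l m = - h m * (1 : Matrix (Fin n) (Fin n) ℝ) l i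
      + h i * (1 : Matrix (Fin n) (Fin n) ℝ) l m) (j : ℕ) (hj : j ≤ n) (m : Fin n) :
    ∑ i, dN A (B i) j i m = - DD A h j m := by
  induction j generalizing m with
  | zero => simp [dN, DD]
  | succ j ih =>
    have ih := ih (by omega)
    have e1 : ∀ i, dN A (B i) (j+1) i m = trace (newtonT j A * B i) * (1 : Matrix (Fin n) (Fin n) ℝ) i m
        - ∑ l, dN A (B i) j i l * A l m - ∑ l, newtonT j A i l * B i l m := by
      intro i
      simp only [dN, Matrix.sub_apply, Matrix.smul_apply, smul_eq_mul, Matrix.mul_apply]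
    simp only [e1, Finset.sum_sub_distrib]
    have e2 : ∑ i, ∑ l, dN A (B i) j i l * A l m = - ∑ l, DD A h j l * A l m := by
      rw [Finset.sum_comm, ← Finset.sum_neg_distrib]
      refine Finset.sum_congr rfl fun l _ => ?_
      rw [← Finset.sum_mul, ih l]; ring
    have e3 : ∑ i, trace (newtonT j A * B i) * (1 : Matrix (Fin n) (Fin n) ℝ) i m =
        ∑ i, ∑ l, newtonT j A i l * B m l i := by
      simp only [Matrix.one_apply, mul_ite, mul_one, mul_zero, Finset.sum_ite_eq', Finset.mem_univ,
        if_true, trace, diag_apply, Matrix.mul_apply]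
    have e4 : ∑ i, ∑ l, newtonT j A i l * B m l i - ∑ i, ∑ l, newtonT j A i l * B i l m
        = - h m * trace (newtonT j A) + ∑ i, h i * newtonT j A i m := by
      simp only [← Finset.sum_sub_distrib, ← mul_sub, hB, mul_add, Finset.sum_add_distrib]
      congr 1
      · simp only [Matrix.one_apply, mul_ite, mul_one, mul_zero, Finset.sum_ite_eq', Finset.mem_univ,
        if_true, trace, diag_apply, Finset.mul_sum]
        refine Finset.sum_congr rfl fun i _ => by ring
      · simp only [Matrix.one_apply, mul_ite, mul_one, mul_zero, Finset.sum_ite_eq', Finset.mem_univ,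
        if_true, trace, diag_apply, Finset.mul_sum]
        refine Finset.sum_congr rfl fun i _ => by ring
    rw [e2, e3, DD_mul]
    rw [trace_newtonT A hA (by omega)] at e4
    rw [DD]
    linarith

/-! ### partial derivatives -/

theorem hasDerivAt_pd {n : ℕ} {w : (Fin n → ℝ) → ℝ} {x : Fin n → ℝ} (h : DifferentiableAt ℝ w x)
    (i : Fin n) : HasDerivAt (fun s : ℝ => w (x + s • (Pi.single i 1 : Fin n → ℝ))) (pd i w x) 0 :=
  h.hasFDerivAt.hasLineDerivAt _

theorem pd_sub {n : ℕ} {f g : (Fin n → ℝ) → ℝ} {x : Fin n → ℝ} (hf : DifferentiableAt ℝ f x)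
    (hg : DifferentiableAt ℝ g x) (i : Fin n) :
    pd i (fun y => f y - g y) x = pd i f x - pd i g x := by
  unfold pd; rw [fderiv_fun_sub hf hg]; rfl

theorem pd_add {n : ℕ} {f g : (Fin n → ℝ) → ℝ} {x : Fin n → ℝ} (hf : DifferentiableAt ℝ f x)
    (hg : DifferentiableAt ℝ g x) (i : Fin n) :
    pd i (fun y => f y + g y) x = pd i f x + pd i g x := by
  unfold pd; rw [fderiv_fun_add hf hg]; rfl

theorem pd_mul {n : ℕ} {f g : (Fin n → ℝ) → ℝ} {x : Fin n → ℝ} (hf : DifferentiableAt ℝ f x)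
    (hg : DifferentiableAt ℝ g x) (i : Fin n) :
    pd i (fun y => f y * g y) x = f x * pd i g x + pd i f x * g x := by
  unfold pd; rw [fderiv_fun_mul hf hg]
  simp only [ContinuousLinearMap.add_apply, ContinuousLinearMap.smul_apply, smul_eq_mul]
  ring

theorem pd_mul_const {n : ℕ} {f : (Fin n → ℝ) → ℝ} {x : Fin n → ℝ} (hf : DifferentiableAt ℝ f x)
    (c : ℝ) (i : Fin n) :
    pd i (fun y => f y * c) x = pd i f x * c := by
  unfold pd; rw [fderiv_mul_const hf]
  simp only [ContinuousLinearMap.smul_apply, smul_eq_mul]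
  ring

theorem pd_hasCompactSupport {n : ℕ} {f : (Fin n → ℝ) → ℝ} (hf : HasCompactSupport f) (i : Fin n) :
    HasCompactSupport (pd i f) := by
  unfold pd
  exact hf.fderiv_apply ℝ _

theorem contDiff_pd {n : ℕ} {r s : WithTop ℕ∞} {w : (Fin n → ℝ) → ℝ} (h : ContDiff ℝ r w) (hs : s + 1 ≤ r)
    (i : Fin n) : ContDiff ℝ s (pd i w) := by
  unfold pd
  exact (h.fderiv_right hs).clm_apply contDiff_const

theorem pd_comm {n : ℕ} {w : (Fin n → ℝ) → ℝ} {x : Fin n → ℝ} (h : ContDiffAt ℝ 2 w x)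
    (i j : Fin n) : pd i (pd j w) x = pd j (pd i w) x := by
  have hs : IsSymmSndFDerivAt ℝ w x := h.isSymmSndFDerivAt (by simp)
  have hd : DifferentiableAt ℝ (fderiv ℝ w) x :=
    (h.fderiv_right (m := 1) (by norm_num)).differentiableAt (by norm_num)
  have e : ∀ a b : Fin n, pd a (pd b w) x = fderiv ℝ (fderiv ℝ w) x (Pi.single a 1) (Pi.single b 1) := by
    intro a b
    unfold pd
    rw [fderiv_clm_apply hd (differentiableAt_const _)]
    simp
  rw [e, e]; exact hs _ _

theorem hess_symm {n : ℕ} {w : (Fin n → ℝ) → ℝ} {x : Fin n → ℝ} (h : ContDiffAt ℝ 2 w x) :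
    (hess w x)ᵀ = hess w x := by
  ext i j; simp only [hess, Matrix.transpose_apply, Matrix.of_apply]; exact pd_comm h j i

theorem augm_symm {n : ℕ} {w : (Fin n → ℝ) → ℝ} {x : Fin n → ℝ} (h : ContDiffAt ℝ 2 w x) (c : ℝ) :
    (hess w x - c • (1 : Matrix (Fin n) (Fin n) ℝ))ᵀ = hess w x - c • 1 := by
  rw [Matrix.transpose_sub, hess_symm h]; simp

theorem pd_newtonT {n : ℕ} {A : (Fin n → ℝ) → Matrix (Fin n) (Fin n) ℝ} (hs : ∀ x, (A x)ᵀ = A x)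
    (hA : ∀ i m, ContDiff ℝ 1 (fun x => A x i m)) (j : ℕ) (hj : j ≤ n) (a i m : Fin n) (x : Fin n → ℝ) :
    pd a (fun x => newtonT j (A x) i m) x = dN (A x) (Matrix.of fun i m => pd a (fun x => A x i m) x) j i m := by
  have h1 := (newtonT_contDiff hs hA j hj).1 i m
  have h2 := hasDerivAt_pd (h1.differentiable (by norm_num) x) a
  have h3 := (hasDerivAt_newtonT (A := fun s : ℝ => A (x + s • (Pi.single a 1 : Fin n → ℝ)))
    (A' := Matrix.of fun i m => pd a (fun x => A x i m) x) (t := 0) (fun s => hs _)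
    (fun i m => hasDerivAt_pd ((hA i m).differentiable (by norm_num) x) a) j hj).1 i m
  simp only [zero_smul, add_zero] at h3
  exact h2.unique h3

theorem div_newtonT {n : ℕ} {u h : (Fin n → ℝ) → ℝ} (hu : ContDiff ℝ 3 u) (hh : ContDiff ℝ 1 h)
    (j : ℕ) (hj : j ≤ n) (m : Fin n) (x : Fin n → ℝ) :
    ∑ i, pd i (fun x => newtonT j (hess u x - h x • (1 : Matrix (Fin n) (Fin n) ℝ)) i m) x
      = - DD (hess u x - h x • (1 : Matrix (Fin n) (Fin n) ℝ)) (grad h x) j m := by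
  have h2 : ContDiff ℝ 2 u := hu.of_le (by norm_num)
  have hp : ∀ i, ContDiff ℝ 2 (pd i u) := fun i => contDiff_pd hu (by norm_num) i
  have hpp : ∀ i l, ContDiff ℝ 1 (pd l (pd i u)) := fun i l => contDiff_pd (hp i) (by norm_num) l
  have hs : ∀ x, (hess u x - h x • (1 : Matrix (Fin n) (Fin n) ℝ))ᵀ = hess u x - h x • 1 :=
    fun x => augm_symm h2.contDiffAt _
  have hA : ∀ i m, ContDiff ℝ 1 (fun x => (hess u x - h x • (1 : Matrix (Fin n) (Fin n) ℝ)) i m) := by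
    intro i m
    simp only [Matrix.sub_apply, Matrix.smul_apply, hess, Matrix.of_apply, smul_eq_mul]
    exact (hpp m i).sub (hh.mul contDiff_const)
  simp only [pd_newtonT hs hA j hj]
  refine div_alg _ (hs x) (fun i => Matrix.of fun a b => pd i (fun x => (hess u x - h x • (1 : Matrix (Fin n) (Fin n) ℝ)) a b) x) _ ?_ j hj m
  intro i l m
  have key : ∀ a b c, pd a (fun x => (hess u x - h x • (1 : Matrix (Fin n) (Fin n) ℝ)) b c) x =
      pd a (pd b (pd c u)) x - pd a h x * (1 : Matrix (Fin n) (Fin n) ℝ) b c := by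
    intro a b c
    simp only [Matrix.sub_apply, Matrix.smul_apply, hess, Matrix.of_apply, smul_eq_mul]
    have d1 : DifferentiableAt ℝ (pd b (pd c u)) x := (hpp c b).differentiable (by norm_num) x
    have d2 : DifferentiableAt ℝ h x := hh.differentiable (by norm_num) x
    rw [pd_sub d1 (d2.mul_const _), pd_mul_const d2]
  simp only [Matrix.of_apply, key, grad]
  have s1 : pd m (pd l (pd i u)) x = pd i (pd l (pd m u)) x := by
    have e1 : pd l (pd i u) = pd i (pd l u) := by ext y; exact pd_comm h2.contDiffAt _ _
    have e2 : pd l (pd m u) = pd m (pd l u) := by ext y; exact pd_comm h2.contDiffAt _ _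
    rw [e1, e2]; exact pd_comm (hp l).contDiffAt _ _
  rw [s1]; ring

theorem ibp {n : ℕ} {ψ g : (Fin n → ℝ) → ℝ} (hψ : ContDiff ℝ 1 ψ) (hc : HasCompactSupport ψ)
    (hg : ContDiff ℝ 1 g) (i : Fin n) :
    ∫ x, pd i ψ x * g x = - ∫ x, ψ x * pd i g x := by
  have c1 : Continuous (pd i ψ) := (contDiff_pd (s := 0) hψ (by norm_num) i).continuous
  have c2 : Continuous (pd i g) := (contDiff_pd (s := 0) hg (by norm_num) i).continuous
  have hc1 : HasCompactSupport (pd i ψ) := by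
    unfold pd
    exact hc.fderiv_apply ℝ _
  have := integral_mul_fderiv_eq_neg_fderiv_mul_of_integrable (μ := volume) (𝕜 := ℝ) (f := ψ) (g := g)
    (v := (Pi.single i 1 : Fin n → ℝ))
    ((c1.mul hg.continuous).integrable_of_hasCompactSupport hc1.mul_right)
    ((hψ.continuous.mul c2).integrable_of_hasCompactSupport hc.mul_right)
    ((hψ.continuous.mul hg.continuous).integrable_of_hasCompactSupport hc.mul_right)
    (fun x _ => hψ.differentiable (by norm_num) x) (fun x _ => hg.differentiable (by norm_num) x)
  unfold pd
  linarith

theorem weak_div_smooth {n : ℕ} {u h ψ : (Fin n → ℝ) → ℝ} (hu : ContDiff ℝ 3 u) (hh : ContDiff ℝ 1 h)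
    (hψ : ContDiff ℝ 1 ψ) (hc : HasCompactSupport ψ)
    (j : ℕ) (hj : j ≤ n) (m : Fin n) :
    ∫ x, ∑ i, pd i ψ x * newtonT j (hess u x - h x • (1 : Matrix (Fin n) (Fin n) ℝ)) i m
      = ∫ x, ψ x * DD (hess u x - h x • (1 : Matrix (Fin n) (Fin n) ℝ)) (grad h x) j m := by
  have h2 : ContDiff ℝ 2 u := hu.of_le (by norm_num)
  have hp : ∀ i, ContDiff ℝ 2 (pd i u) := fun i => contDiff_pd hu (by norm_num) i
  have hpp : ∀ i l, ContDiff ℝ 1 (pd l (pd i u)) := fun i l => contDiff_pd (hp i) (by norm_num) l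
  have hs : ∀ x, (hess u x - h x • (1 : Matrix (Fin n) (Fin n) ℝ))ᵀ = hess u x - h x • 1 :=
    fun x => augm_symm h2.contDiffAt _
  have hA : ∀ i m, ContDiff ℝ 1 (fun x => (hess u x - h x • (1 : Matrix (Fin n) (Fin n) ℝ)) i m) := by
    intro i m
    simp only [Matrix.sub_apply, Matrix.smul_apply, hess, Matrix.of_apply, smul_eq_mul]
    exact (hpp m i).sub (hh.mul contDiff_const)
  have hT := fun i => (newtonT_contDiff hs hA j hj).1 i m
  have hc1 : ∀ i, HasCompactSupport (pd i ψ) := fun i => by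
    unfold pd
    exact hc.fderiv_apply ℝ _
  have cψ : ∀ i, Continuous (pd i ψ) := fun i => (contDiff_pd (s := 0) hψ (by norm_num) i).continuous
  have cT : ∀ i, Continuous (pd i (fun x => newtonT j (hess u x - h x • (1 : Matrix (Fin n) (Fin n) ℝ)) i m)) :=
    fun i => (contDiff_pd (s := 0) (hT i) (by norm_num) i).continuous
  set S : Fin n → (Fin n → ℝ) → ℝ := fun i x => newtonT j (hess u x - h x • (1 : Matrix (Fin n) (Fin n) ℝ)) i m with hS
  have I1 : ∀ i ∈ (Finset.univ : Finset (Fin n)), Integrable (fun x => pd i ψ x * S i x) := fun i _ =>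
    ((cψ i).mul (hT i).continuous).integrable_of_hasCompactSupport (hc1 i).mul_right
  have I2 : ∀ i ∈ (Finset.univ : Finset (Fin n)), Integrable (fun x => ψ x * pd i (S i) x) := fun i _ =>
    (hψ.continuous.mul (cT i)).integrable_of_hasCompactSupport hc.mul_right
  calc ∫ x, ∑ i, pd i ψ x * S i x = ∑ i, ∫ x, pd i ψ x * S i x := integral_finsetSum _ I1
    _ = ∑ i, - ∫ x, ψ x * pd i (S i) x := Finset.sum_congr rfl fun i _ => ibp hψ hc (hT i) i
    _ = - ∫ x, ∑ i, ψ x * pd i (S i) x := by rw [integral_finsetSum _ I2, Finset.sum_neg_distrib]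
    _ = ∫ x, - ∑ i, ψ x * pd i (S i) x := (integral_neg _).symm
    _ = _ := by
      refine integral_congr_ae (Filter.Eventually.of_forall fun x => ?_)
      have := div_newtonT hu hh j hj m x
      simp only [← Finset.mul_sum]
      rw [this]; ring

/-- A sequence of bump functions. -/
noncomputable def bmp {n : ℕ} (m : ℕ) : ContDiffBump (0 : Fin n → ℝ) where
  rIn := 1 / (2 * ((m : ℝ) + 1))
  rOut := 1 / ((m : ℝ) + 1)
  rIn_pos := by positivity
  rIn_lt_rOut := by
    apply one_div_lt_one_div_of_lt (by positivity)
    have : (0:ℝ) ≤ m := by positivity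
    linarith

/-- Mollification. -/
noncomputable def mol {n : ℕ} (m : ℕ) (g : (Fin n → ℝ) → ℝ) : (Fin n → ℝ) → ℝ :=
  convolution ((bmp m).normed volume) g (ContinuousLinearMap.lsmul ℝ ℝ) volume

theorem mol_contDiff {n : ℕ} (m : ℕ) {g : (Fin n → ℝ) → ℝ} (hg : Continuous g) :
    ContDiff ℝ 3 (mol m g) := by
  unfold mol
  exact (bmp m).hasCompactSupport_normed.contDiff_convolution_left _ ((bmp m).contDiff_normed (n := 3))
    hg.locallyIntegrable

theorem mol_pd {n : ℕ} (m : ℕ) {g : (Fin n → ℝ) → ℝ} (hg : ContDiff ℝ 1 g) (hc : HasCompactSupport g)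
    (i : Fin n) : pd i (mol m g) = mol m (pd i g) := by
  ext x
  have hf : LocallyIntegrable ((bmp m : ContDiffBump (0 : Fin n → ℝ)).normed volume) volume :=
    ((bmp m).continuous_normed).locallyIntegrable
  have := hc.hasFDerivAt_convolution_right (ContinuousLinearMap.lsmul ℝ ℝ) hf hg x
  unfold pd mol
  rw [this.fderiv, convolution_precompR_apply _ hf (hc.fderiv ℝ) (hg.continuous_fderiv one_ne_zero)]

theorem mol_dist {n : ℕ} (m : ℕ) {g : (Fin n → ℝ) → ℝ} (hg : Continuous g) {x : Fin n → ℝ} {z ε : ℝ}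
    (hε : 0 ≤ ε) (h : ∀ y ∈ ball x (1 / ((m:ℝ)+1)), |g y - z| ≤ ε) : |mol m g x - z| ≤ ε := by
  have := dist_convolution_le (μ := volume) (f := (bmp m : ContDiffBump (0 : Fin n → ℝ)).normed volume) (g := g) (x₀ := x) (z₀ := z)
    (R := 1 / ((m:ℝ)+1)) hε
    (bmp m).support_normed_eq.subset (bmp m).nonneg_normed (bmp m).integral_normed
    hg.aestronglyMeasurable (fun y hy => by rw [Real.dist_eq]; exact h y hy)
  rwa [Real.dist_eq] at this

theorem mol_bound {n : ℕ} (m : ℕ) {g : (Fin n → ℝ) → ℝ} (hg : Continuous g) {K : ℝ} (hK : 0 ≤ K)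
    {x : Fin n → ℝ}
    (h : ∀ y ∈ ball x (1 / ((m:ℝ)+1)), |g y| ≤ K) : |mol m g x| ≤ K := by
  have := mol_dist m hg (x := x) (z := 0) hK (fun y hy => by rw [sub_zero]; exact h y hy)
  simpa using this

theorem mol_tendsto {n : ℕ} {g : (Fin n → ℝ) → ℝ} (hg : Continuous g) (x : Fin n → ℝ) :
    Filter.Tendsto (fun m => mol m g x) Filter.atTop (nhds (g x)) := by
  rw [Metric.tendsto_atTop]
  intro ε hε
  obtain ⟨δ, hδ, h⟩ := Metric.continuousAt_iff.1 hg.continuousAt (ε/2) (by positivity)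
  obtain ⟨N, hN⟩ := exists_nat_one_div_lt hδ
  refine ⟨N, fun m hm => ?_⟩
  rw [Real.dist_eq]
  refine (mol_dist m hg (by positivity : (0:ℝ) ≤ ε/2) fun y hy => ?_).trans_lt (by linarith)
  have : 1 / ((m:ℝ)+1) ≤ 1 / ((N:ℝ)+1) := Nat.one_div_le_one_div hm
  have := h (show dist y x < δ from (mem_ball.1 hy).trans_le (this.trans hN.le))
  rw [Real.dist_eq] at this; exact this.le

theorem mol_shift {n : ℕ} (m : ℕ) (g : (Fin n → ℝ) → ℝ) (x s : Fin n → ℝ) :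
    mol m (fun y => g (y + s)) x = mol m g (x + s) := by
  unfold mol convolution
  congr 1; ext t; beta_reduce; rw [show x - t + s = x + s - t by abel]

theorem mol_sub {n : ℕ} (m : ℕ) {g g2 : (Fin n → ℝ) → ℝ} (hg : Continuous g) (hg2 : Continuous g2) (x : Fin n → ℝ) :
    mol m (fun y => g y - g2 y) x = mol m g x - mol m g2 x := by
  unfold mol convolution
  have : ∀ f : (Fin n → ℝ) → ℝ, Continuous f → Integrable (fun t => ((ContinuousLinearMap.lsmul ℝ ℝ) ((bmp m : ContDiffBump (0 : Fin n → ℝ)).normed volume t)) (f (x - t))) := by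
    intro f hf
    simp only [ContinuousLinearMap.lsmul_apply, smul_eq_mul]
    refine Continuous.integrable_of_hasCompactSupport ((bmp m).continuous_normed.mul (hf.comp (by fun_prop))) ?_
    exact ((bmp m).hasCompactSupport_normed).mul_right
  rw [← integral_sub (this g hg) (this g2 hg2)]
  congr 1; ext t; simp [mul_sub]

theorem mol_lip {n : ℕ} (m : ℕ) {g : (Fin n → ℝ) → ℝ} (hg : Continuous g) {x : Fin n → ℝ} {L r : ℝ}
    (hL : 0 ≤ L) (hr : 1 / ((m:ℝ)+1) < r)
    (h : ∀ y ∈ ball x r, ∀ z ∈ ball x r, |g y - g z| ≤ L * ‖y - z‖) (i : Fin n) :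
    |pd i (mol m g) x| ≤ L := by
  have hd := ((mol_contDiff m hg).differentiable (by norm_num) x).hasFDerivAt
  have : ‖fderiv ℝ (mol m g) x‖ ≤ L := by
    refine hd.le_of_lip' hL ?_
    have hpos : 0 < r - 1 / ((m:ℝ)+1) := by linarith
    filter_upwards [Metric.ball_mem_nhds x hpos] with y hy
    have e : mol m g y - mol m g x = mol m (fun z => g (z + (y - x)) - g z) x := by
      have hgs : Continuous fun z => g (z + (y - x)) := by fun_prop
      rw [mol_sub m hgs hg, mol_shift]; simp
    rw [e, Real.norm_eq_abs]
    refine mol_bound m (by fun_prop) (by positivity) fun z hz => ?_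
    have hz' := mem_ball.1 hz
    have hy' := mem_ball.1 hy
    have := h (z + (y - x)) ?_ z ?_
    · simpa using this
    · rw [mem_ball, dist_eq_norm] at *
      calc ‖z + (y - x) - x‖ = ‖(z - x) + (y - x)‖ := by congr 1; abel
        _ ≤ _ := norm_add_le _ _
        _ < r := by linarith
    · rw [mem_ball]; linarith
  unfold pd
  rw [← Real.norm_eq_abs]
  refine (ContinuousLinearMap.le_opNorm _ _).trans ?_
  rw [Pi.norm_single]; simpa using this

theorem bounded_of_compact {n : ℕ} {g : (Fin n → ℝ) → ℝ} (hg : Continuous g) (hc : HasCompactSupport g) :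
    ∃ K, 0 ≤ K ∧ ∀ x, |g x| ≤ K := by
  obtain ⟨K, hK⟩ := hg.bounded_above_of_compact_support hc
  exact ⟨|K|, abs_nonneg _, fun x => (hK x).trans (le_abs_self _)⟩

theorem DD_tendsto {n : ℕ} {ι : Type*} {F : Filter ι}
    {A : ι → Matrix (Fin n) (Fin n) ℝ} {B : Matrix (Fin n) (Fin n) ℝ} (hs : ∀ s, (A s)ᵀ = A s)
    (hB : Bᵀ = B) (h : Fin n → ℝ)
    (hA : ∀ i m, Filter.Tendsto (fun s => A s i m) F (nhds (B i m))) (j : ℕ) (hj : j ≤ n) (m : Fin n) :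
    Filter.Tendsto (fun s => DD (A s) h j m) F (nhds (DD B h j m)) := by
  cases j with
  | zero => simp only [DD]; exact tendsto_const_nhds
  | succ j =>
    simp only [DD]
    exact (tendsto_finsetSum _ fun i _ => ((newtonT_tendsto hs hB hA j (by omega)).1 i m).const_mul _).const_mul _

theorem DD_cont {n : ℕ} {A : (Fin n → ℝ) → Matrix (Fin n) (Fin n) ℝ} (hs : ∀ s, (A s)ᵀ = A s)
    {h : (Fin n → ℝ) → (Fin n → ℝ)} (hh : ∀ i, Continuous fun x => h x i)
    (hA : ∀ i m, Continuous (fun s => A s i m)) (j : ℕ) (hj : j ≤ n) (m : Fin n) :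
    Continuous fun x => DD (A x) (h x) j m := by
  cases j with
  | zero => simp only [DD]; exact continuous_const
  | succ j =>
    simp only [DD]
    have := fun i => ((newtonT_contDiff (r := 0) hs (fun i m => contDiff_zero.2 (hA i m)) j (by omega)).1 i m).continuous
    exact continuous_const.mul (continuous_finset_sum _ fun i _ => (hh i).mul (this i))

theorem DD_bound {n : ℕ} (j : ℕ) (hj : j ≤ n) : ∃ C : ℝ, 0 ≤ C ∧
    ∀ (A : Matrix (Fin n) (Fin n) ℝ) (h : Fin n → ℝ) (a b : ℝ), Aᵀ = A → 0 ≤ a → (∀ i m, |A i m| ≤ a) →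
      0 ≤ b → (∀ i, |h i| ≤ b) → ∀ m, |DD A h j m| ≤ C * (b * a ^ (j-1)) := by
  cases j with
  | zero => exact ⟨0, le_refl _, fun A h a b _ _ _ _ _ m => by simp [DD]⟩
  | succ j =>
    obtain ⟨C, hC, H⟩ := newtonT_bound (n := n) j (by omega)
    refine ⟨n * (n * C), by positivity, fun A h a b hA ha hAa hb hh m => ?_⟩
    simp only [DD, Nat.add_sub_cancel]
    rw [abs_mul]
    have h1 : |(n:ℝ) - j - 1| ≤ n := by
      have : ((j:ℝ) + 1) ≤ n := by exact_mod_cast hj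
      have : (0:ℝ) ≤ j := by positivity
      rw [abs_of_nonneg (by linarith)]; linarith
    have h2 : |∑ i, h i * newtonT j A i m| ≤ n * (b * (C * a ^ j)) := by
      refine (Finset.abs_sum_le_sum_abs _ _).trans ?_
      refine (Finset.sum_le_sum (g := fun _ => b * (C * a^j)) fun l _ => ?_).trans (le_of_eq (by simp))
      rw [abs_mul]
      exact mul_le_mul (hh l) ((H A a hA ha hAa).1 l m) (abs_nonneg _) hb
    calc _ ≤ (n:ℝ) * (n * (b * (C * a ^ j))) := mul_le_mul h1 h2 (abs_nonneg _) (by positivity)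
      _ = _ := by ring

/-- Weak divergence formula for Newton tensors of `C²` functions. -/
theorem weak_div {n : ℕ} {u h ψ : (Fin n → ℝ) → ℝ} (hu : ContDiff ℝ 2 u) (huc : HasCompactSupport u)
    (hh : ContDiff ℝ 1 h) (hψ : ContDiff ℝ 1 ψ) (hc : HasCompactSupport ψ)
    (j : ℕ) (hj : j ≤ n) (m : Fin n) :
    ∫ x, ∑ i, pd i ψ x * newtonT j (hess u x - h x • (1 : Matrix (Fin n) (Fin n) ℝ)) i m
      = ∫ x, ψ x * DD (hess u x - h x • (1 : Matrix (Fin n) (Fin n) ℝ)) (grad h x) j m := by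
  have hp : ∀ i, ContDiff ℝ 1 (pd i u) := fun i => contDiff_pd hu (by norm_num) i
  have hpp : ∀ i l, Continuous (pd l (pd i u)) := fun i l => (contDiff_pd (s := 0) (hp i) (by norm_num) l).continuous
  have hppc : ∀ i l, HasCompactSupport (pd l (pd i u)) := fun i l => pd_hasCompactSupport (pd_hasCompactSupport huc _) _
  have hph : ∀ i, Continuous (pd i h) := fun i => (contDiff_pd (s := 0) hh (by norm_num) i).continuous
  have hpψ : ∀ i, Continuous (pd i ψ) := fun i => (contDiff_pd (s := 0) hψ (by norm_num) i).continuous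
  set uu : ℕ → (Fin n → ℝ) → ℝ := fun N => mol N u with huu
  have uu3 : ∀ N, ContDiff ℝ 3 (uu N) := fun N => mol_contDiff N hu.continuous
  have hess_uu : ∀ N x i l, hess (uu N) x i l = mol N (pd i (pd l u)) x := by
    intro N x i l
    simp only [hess, Matrix.of_apply, huu]
    rw [mol_pd N (hu.of_le (by norm_num)) huc, mol_pd N (hp l) (pd_hasCompactSupport huc _)]
  choose K hK0 hK using fun i l => bounded_of_compact (hpp l i) (hppc l i)
  set Kt := ∑ i, ∑ l, K i l with hKt
  have hKt0 : 0 ≤ Kt := Finset.sum_nonneg fun i _ => Finset.sum_nonneg fun l _ => hK0 i l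
  have hKle : ∀ i l, K i l ≤ Kt := fun i l =>
    (Finset.single_le_sum (f := fun l => K i l) (fun l _ => hK0 i l) (Finset.mem_univ l)).trans
      (Finset.single_le_sum (f := fun i => ∑ l, K i l) (fun i _ => Finset.sum_nonneg fun l _ => hK0 i l) (Finset.mem_univ i))
  set AA : ℕ → (Fin n → ℝ) → Matrix (Fin n) (Fin n) ℝ := fun N x => hess (uu N) x - h x • 1 with hAA
  have AAs : ∀ N x, (AA N x)ᵀ = AA N x := fun N x => augm_symm ((uu3 N).of_le (by norm_num)).contDiffAt _
  set A : (Fin n → ℝ) → Matrix (Fin n) (Fin n) ℝ := fun x => hess u x - h x • 1 with hA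
  have As : ∀ x, (A x)ᵀ = A x := fun x => augm_symm hu.contDiffAt _
  have hlim : ∀ x i l, Filter.Tendsto (fun N => AA N x i l) Filter.atTop (nhds (A x i l)) := by
    intro x i l
    simp only [hAA, hA, Matrix.sub_apply, hess_uu]
    exact (mol_tendsto (hpp l i) x).sub_const _
  have hbd : ∀ N x i l, |AA N x i l| ≤ Kt + |h x| := by
    intro N x i l
    simp only [hAA, Matrix.sub_apply, hess_uu, Matrix.smul_apply, smul_eq_mul]
    refine (abs_sub _ _).trans (add_le_add ?_ ?_)
    · exact mol_bound N (hpp l i) hKt0 fun y _ => (hK i l y).trans (hKle i l)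
    · rw [abs_mul]
      have : |(1 : Matrix (Fin n) (Fin n) ℝ) i l| ≤ 1 := by
        by_cases him : i = l <;> simp [him, Matrix.one_apply]
      nlinarith [abs_nonneg (h x)]
  have AAc : ∀ N i l, Continuous fun x => AA N x i l := by
    intro N i l
    simp only [hAA, Matrix.sub_apply, Matrix.smul_apply, smul_eq_mul, hess, Matrix.of_apply]
    refine Continuous.sub ?_ (hh.continuous.mul continuous_const)
    exact (contDiff_pd (s := 1) (contDiff_pd (s := 2) (uu3 N) (by norm_num) l) (by norm_num) i).continuous
  obtain ⟨C1, hC1, HC1⟩ := newtonT_bound (n := n) j hj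
  obtain ⟨C2, hC2, HC2⟩ := DD_bound (n := n) j hj
  have ccS : ∀ (g : (Fin n → ℝ) → ℝ), Continuous g → (∀ x, ψ x = 0 → (∀ i, pd i ψ x = 0) → g x = 0) → Integrable g := by
    intro g hg hg0
    refine hg.integrable_of_hasCompactSupport ?_
    refine hc.mono' fun x hx => ?_
    by_contra hxx
    apply hx
    refine hg0 x (image_eq_zero_of_notMem_tsupport hxx) fun i => ?_
    by_contra h0
    exact hxx ((tsupport_fderiv_apply_subset ℝ _) (subset_tsupport _ h0))
  have L1 : Filter.Tendsto (fun N => ∫ x, ∑ i, pd i ψ x * newtonT j (AA N x) i m) Filter.atTop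
      (nhds (∫ x, ∑ i, pd i ψ x * newtonT j (A x) i m)) := by
    refine tendsto_integral_of_dominated_convergence
      (fun x => ∑ i, |pd i ψ x| * (C1 * (Kt + |h x|) ^ j)) ?_ ?_ ?_ ?_
    · intro N
      refine Continuous.aestronglyMeasurable ?_
      refine continuous_finset_sum _ fun i _ => (hpψ i).mul ?_
      exact ((newtonT_contDiff (r := 0) (AAs N) (fun i m => contDiff_zero.2 (AAc N i m)) j hj).1 i m).continuous
    · refine ccS _ (continuous_finset_sum _ fun i _ => (hpψ i).abs.mul ?_) fun x _ h0 => by simp [h0]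
      exact continuous_const.mul ((continuous_const.add hh.continuous.abs).pow _)
    · intro N
      refine Filter.Eventually.of_forall fun x => ?_
      rw [Real.norm_eq_abs]
      refine (Finset.abs_sum_le_sum_abs _ _).trans (Finset.sum_le_sum fun i _ => ?_)
      rw [abs_mul]
      exact mul_le_mul_of_nonneg_left ((HC1 _ _ (AAs N x) (by positivity) (hbd N x)).1 i m) (abs_nonneg _)
    · refine Filter.Eventually.of_forall fun x => ?_
      exact tendsto_finsetSum _ fun i _ =>
        ((newtonT_tendsto (fun N => AAs N x) (As x) (hlim x) j hj).1 i m).const_mul _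
  have L2 : Filter.Tendsto (fun N => ∫ x, ψ x * DD (AA N x) (grad h x) j m) Filter.atTop
      (nhds (∫ x, ψ x * DD (A x) (grad h x) j m)) := by
    refine tendsto_integral_of_dominated_convergence
      (fun x => |ψ x| * (C2 * ((∑ i, |pd i h x|) * (Kt + |h x|) ^ (j-1)))) ?_ ?_ ?_ ?_
    · intro N
      refine Continuous.aestronglyMeasurable ?_
      exact hψ.continuous.mul (DD_cont (AAs N) hph (AAc N) j hj m)
    · refine ccS _ (hψ.continuous.abs.mul ?_) fun x h0 _ => by simp [h0]
      refine continuous_const.mul (Continuous.mul (continuous_finset_sum _ fun i _ => (hph i).abs) ?_)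
      exact ((continuous_const.add hh.continuous.abs).pow _)
    · intro N
      refine Filter.Eventually.of_forall fun x => ?_
      rw [Real.norm_eq_abs, abs_mul]
      refine mul_le_mul_of_nonneg_left (HC2 _ _ _ _ (AAs N x) (by positivity) (hbd N x) (by positivity) (fun i => ?_) m) (abs_nonneg _)
      exact Finset.single_le_sum (f := fun i => |pd i h x|) (fun i _ => abs_nonneg _) (Finset.mem_univ i)
    · refine Filter.Eventually.of_forall fun x => ?_
      exact (DD_tendsto (fun N => AAs N x) (As x) _ (hlim x) j hj m).const_mul _
  refine tendsto_nhds_unique L1 ?_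
  have : (fun N => ∫ x, ∑ i, pd i ψ x * newtonT j (AA N x) i m) =
      (fun N => ∫ x, ψ x * DD (AA N x) (grad h x) j m) := by
    ext N; exact weak_div_smooth (uu3 N) hh hψ hc j hj m
  rw [this]; exact L2

theorem qf_smul_right {n : ℕ} (T : Matrix (Fin n) (Fin n) ℝ) (a b : Fin n → ℝ) (e : ℝ) :
    qf T a (fun i => e * b i) = e * qf T a b := by
  unfold qf; simp only [Finset.mul_sum]
  refine Finset.sum_congr rfl fun i _ => Finset.sum_congr rfl fun j _ => by ring

theorem qf_smul_left {n : ℕ} (T : Matrix (Fin n) (Fin n) ℝ) (a b : Fin n → ℝ) (e : ℝ) :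
    qf T (fun i => e * a i) b = e * qf T a b := by
  unfold qf; simp only [Finset.mul_sum]
  refine Finset.sum_congr rfl fun i _ => Finset.sum_congr rfl fun j _ => by ring

theorem sum_sq_le {n : ℕ} (a : Fin n → ℝ) : (∑ i, |a i|) ^ 2 ≤ n * ∑ i, a i ^ 2 := by
  have := sq_sum_le_card_mul_sum_sq (s := (Finset.univ : Finset (Fin n))) (f := fun i => |a i|)
  simpa using this

theorem qf_abs_le {n : ℕ} (T : Matrix (Fin n) (Fin n) ℝ) {K : ℝ} (hT : ∀ i m, |T i m| ≤ K)
    (a b : Fin n → ℝ) : |qf T a b| ≤ K * ((∑ i, |a i|) * ∑ m, |b m|) := by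
  unfold qf
  refine (Finset.abs_sum_le_sum_abs _ _).trans ?_
  rw [Finset.sum_mul_sum, Finset.mul_sum]
  refine Finset.sum_le_sum fun i _ => (Finset.abs_sum_le_sum_abs _ _).trans ?_
  rw [Finset.mul_sum]
  refine Finset.sum_le_sum fun m _ => ?_
  rw [abs_mul, abs_mul, mul_assoc]
  exact mul_le_mul_of_nonneg_right (hT i m) (by positivity)

theorem qf_diag_le {n : ℕ} (T : Matrix (Fin n) (Fin n) ℝ) {K : ℝ} (hT : ∀ i m, |T i m| ≤ K) (hK : 0 ≤ K)
    (a : Fin n → ℝ) : qf T a a ≤ K * (n * ∑ i, a i ^ 2) := by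
  refine (le_abs_self _).trans ((qf_abs_le T hT a a).trans ?_)
  rw [← sq]
  exact mul_le_mul_of_nonneg_left (sum_sq_le a) hK

theorem sum_abs_le_card {n : ℕ} (a : Fin n → ℝ) {K : ℝ} (h : ∀ i, |a i| ≤ K) : ∑ i, |a i| ≤ n * K := by
  refine (Finset.sum_le_sum fun i _ => h i).trans (le_of_eq (by simp))

/-- The constant in the energy estimate. -/
noncomputable def Cen (n d : ℕ) (L : ℝ) : ℝ :=
  64 * n * L + 16 * n^2 * L^5 + 2 * n * L^3 * 2^(d+1) + L + L * (2 * n^2 * L^2 + 4 * n * L^2) +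
    L * (4 * n^2 * L^2)

set_option maxHeartbeats 1600000 in
theorem energy_pt {n : ℕ} (hn : 1 ≤ n) (d : ℕ) {F T : Matrix (Fin n) (Fin n) ℝ} {D2 b G ge gw : Fin n → ℝ}
    {db : Fin n → Fin n → ℝ} {e w X c p L : ℝ} (hp : 3/2 ≤ p) (hc0 : 0 ≤ c) (hcL : c ≤ L) (hL : 1 ≤ L)
    (hw : 1/2 ≤ w) (hFs : Fᵀ = F) (hF0 : ∀ a, 0 ≤ qf F a a)
    (hFl : ∀ a : Fin n → ℝ, ∑ i, a i ^ 2 ≤ L * w * qf F a a)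
    (hFb : ∀ i m, |F i m| ≤ L * w^(d+1)) (hTb : ∀ i m, |T i m| ≤ L * w^d)
    (hD2 : ∀ m, |D2 m| ≤ L * w^d) (hG : ∀ i, |G i| ≤ L) (hb : ∀ i, |b i| ≤ L)
    (hdb : ∀ i m, |db i m| ≤ L * w)
    (hX : c * qf F G gw - c * qf T gw b - L * (∑ i, |gw i| + w^(d+3)) ≤ X) :
    p/2 * (e^2 * qf F gw gw) ≤ (e^2 * w * X + 2 * e * w * qf F ge gw + p * e^2 * qf F gw gw)
      + (c/(p+1)) * (e^2 * w^2 * (∑ m, ∑ i, db i m * T i m - ∑ m, b m * D2 m) + 2 * e * w^2 * qf T ge b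
        + (p+1) * e^2 * w * qf T gw b) + Cen n d L * ((e^2 + ∑ i, ge i ^2) * w^(d+4)) := by
  have hw0 : 0 < w := by linarith
  have hL0 : 0 < L := by linarith
  have hn1 : (1:ℝ) ≤ n := by exact_mod_cast hn
  set Q := qf F gw gw with hQ
  have Q0 : 0 ≤ Q := hF0 gw
  set Y := w^(d+4) with hY
  have Y0 : 0 < Y := by positivity
  set N := ∑ i, ge i ^ 2 with hN
  have N0 : 0 ≤ N := Finset.sum_nonneg fun i _ => sq_nonneg _
  have y3 : w^(d+3) ≤ 2 * Y := by
    rw [hY, pow_succ w (d+3)]; nlinarith [pow_pos hw0 (d+3)]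
  have y2 : w^(d+2) ≤ 4 * Y := by
    have : w^(d+2) ≤ 2 * w^(d+3) := by rw [pow_succ w (d+2)]; nlinarith [pow_pos hw0 (d+2)]
    linarith
  have y1 : w^3 ≤ 2^(d+1) * Y := by
    have : 1 ≤ (2 * w)^(d+1) := one_le_pow₀ (by linarith)
    calc w^3 = w^3 * 1 := by ring
      _ ≤ w^3 * (2*w)^(d+1) := by gcongr
      _ = 2^(d+1) * Y := by rw [hY, mul_pow]; ring
  -- term 1
  have t1 : |2 * e * w * qf F ge gw| ≤ 64 * n * L * (N * Y) + e^2 * Q / 8 := by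
    have h := qf_cauchy F hFs hF0 ge (fun i => e * gw i) (r := 16 * w) (by positivity)
    rw [qf_smul_right, qf_smul_right, qf_smul_left, ← hQ] at h
    have h2 := qf_diag_le F hFb (by positivity) ge
    have e1 : |2 * e * w * qf F ge gw| = 2 * w * |e * qf F ge gw| := by
      rw [show 2 * e * w * qf F ge gw = (2 * w) * (e * qf F ge gw) by ring, abs_mul,
        abs_of_pos (by positivity : 0 < 2 * w)]
    rw [e1]
    calc 2 * w * |e * qf F ge gw| ≤ 2 * w * (16 * w * qf F ge ge + e * (e * Q) / (16 * w)) := by gcongr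
      _ = 32 * w^2 * qf F ge ge + e^2 * Q / 8 := by field_simp; ring
      _ ≤ 32 * w^2 * (L * w^(d+1) * (n * N)) + e^2 * Q / 8 := by gcongr
      _ = 32 * L * (n * N) * w^(d+3) + e^2 * Q / 8 := by ring
      _ ≤ 32 * L * (n * N) * (2 * Y) + e^2 * Q / 8 := by gcongr
      _ = _ := by ring
  have t2 : |e^2 * w * (c * qf F G gw)| ≤ 16 * n^2 * L^5 * (e^2 * Y) + e^2 * Q / 8 := by
    have h := qf_cauchy F hFs hF0 G gw (r := 8 * L * w) (by positivity)
    rw [← hQ] at h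
    have h2 := qf_diag_le F hFb (by positivity) G
    have h3 : ∑ i, G i ^ 2 ≤ n * L^2 := by
      refine (Finset.sum_le_sum (g := fun _ => L^2) fun i _ => ?_).trans (le_of_eq (by simp))
      exact sq_le_sq' (by linarith [(abs_le.1 (hG i)).1]) (abs_le.1 (hG i)).2
    have e1 : |e^2 * w * (c * qf F G gw)| = e^2 * w * c * |qf F G gw| := by
      rw [show e^2 * w * (c * qf F G gw) = (e^2 * w * c) * (qf F G gw) by ring, abs_mul,
        abs_of_nonneg (by positivity : 0 ≤ e^2 * w * c)]
    rw [e1]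
    calc e^2 * w * c * |qf F G gw| ≤ e^2 * w * L * (8 * L * w * qf F G G + Q / (8 * L * w)) := by gcongr
      _ = 8 * L^2 * w^2 * e^2 * qf F G G + e^2 * Q / 8 := by field_simp
      _ ≤ 8 * L^2 * w^2 * e^2 * (L * w^(d+1) * (n * (n * L^2))) + e^2 * Q / 8 := by
        gcongr; exact h2.trans (by gcongr)
      _ = 8 * n^2 * L^5 * e^2 * w^(d+3) + e^2 * Q / 8 := by ring
      _ ≤ 8 * n^2 * L^5 * e^2 * (2 * Y) + e^2 * Q / 8 := by gcongr
      _ = _ := by ring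
  have t3 : e^2 * w * (L * ∑ i, |gw i|) ≤ 2 * n * L^3 * 2^(d+1) * (e^2 * Y) + e^2 * Q / 8 := by
    have h := hFl gw
    have h1 : w * (L * ∑ i, |gw i|) ≤ Q / 8 + 2 * n * L^3 * w^3 := by
      have h2 : ∀ i, w * L * |gw i| ≤ gw i ^ 2 / (8 * L * w) + 2 * L^3 * w^3 := by
        intro i
        have : 0 ≤ (|gw i| - 4 * L^2 * w^2)^2 / (8 * L * w) := by positivity
        have e2 : (|gw i| - 4 * L^2 * w^2)^2 / (8 * L * w) = gw i ^ 2 / (8 * L * w) - w * L * |gw i|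
            + 2 * L^3 * w^3 := by
          rw [sub_sq, sq_abs]; field_simp; ring
        linarith
      calc w * (L * ∑ i, |gw i|) = ∑ i, w * L * |gw i| := by rw [← mul_assoc, Finset.mul_sum]
        _ ≤ ∑ i, (gw i ^ 2 / (8 * L * w) + 2 * L^3 * w^3) := Finset.sum_le_sum fun i _ => h2 i
        _ = (∑ i, gw i ^ 2) / (8 * L * w) + 2 * n * L^3 * w^3 := by
          rw [Finset.sum_add_distrib, ← Finset.sum_div]; simp; ring
        _ ≤ (L * w * Q) / (8 * L * w) + 2 * n * L^3 * w^3 := by gcongr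
        _ = _ := by field_simp
    calc e^2 * w * (L * ∑ i, |gw i|) = e^2 * (w * (L * ∑ i, |gw i|)) := by ring
      _ ≤ e^2 * (Q / 8 + 2 * n * L^3 * w^3) := by gcongr
      _ ≤ e^2 * (Q / 8 + 2 * n * L^3 * (2^(d+1) * Y)) := by gcongr
      _ = _ := by ring
  have t4 : e^2 * w * (L * w^(d+3)) = L * (e^2 * Y) := by rw [hY]; ring
  have hcp : c / (p+1) ≤ L := by
    rw [div_le_iff₀ (by linarith)]; nlinarith
  have hcp0 : 0 ≤ c / (p+1) := div_nonneg hc0 (by linarith)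
  have t5 : |e^2 * w^2 * (∑ m, ∑ i, db i m * T i m - ∑ m, b m * D2 m)| ≤
      (2 * n^2 * L^2 + 4 * n * L^2) * (e^2 * Y) := by
    have h1 : |∑ m, ∑ i, db i m * T i m| ≤ n^2 * L^2 * w^(d+1) := by
      refine (Finset.abs_sum_le_sum_abs _ _).trans ?_
      refine (Finset.sum_le_sum (g := fun _ => (n:ℝ) * (L * w * (L * w^d))) fun m _ => ?_).trans (le_of_eq (by simp; ring))
      refine (Finset.abs_sum_le_sum_abs _ _).trans ?_
      refine (Finset.sum_le_sum (g := fun _ => (L * w * (L * w^d))) fun i _ => ?_).trans (le_of_eq (by simp))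
      rw [abs_mul]; exact mul_le_mul (hdb i m) (hTb i m) (abs_nonneg _) (by positivity)
    have h2 : |∑ m, b m * D2 m| ≤ n * L^2 * w^d := by
      refine (Finset.abs_sum_le_sum_abs _ _).trans ?_
      refine (Finset.sum_le_sum (g := fun _ => (L * (L * w^d))) fun m _ => ?_).trans (le_of_eq (by simp; ring))
      rw [abs_mul]; exact mul_le_mul (hb m) (hD2 m) (abs_nonneg _) (by positivity)
    rw [abs_mul, abs_of_nonneg (by positivity : 0 ≤ e^2 * w^2)]
    calc e^2 * w^2 * |∑ m, ∑ i, db i m * T i m - ∑ m, b m * D2 m|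
        ≤ e^2 * w^2 * (n^2 * L^2 * w^(d+1) + n * L^2 * w^d) := by
          gcongr; exact (abs_sub _ _).trans (add_le_add h1 h2)
      _ = n^2 * L^2 * e^2 * w^(d+3) + n * L^2 * e^2 * w^(d+2) := by ring
      _ ≤ n^2 * L^2 * e^2 * (2 * Y) + n * L^2 * e^2 * (4 * Y) := by gcongr
      _ = _ := by ring
  have t6 : |2 * e * w^2 * qf T ge b| ≤ 4 * n^2 * L^2 * ((e^2 + N) * Y) := by
    have h1 := qf_abs_le T hTb ge b
    have h2 := sum_abs_le_card b hb
    have h3 : 2 * |e| * ∑ i, |ge i| ≤ n * e^2 + N := by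
      calc 2 * |e| * ∑ i, |ge i| = ∑ i, 2 * |e| * |ge i| := by rw [Finset.mul_sum]
        _ ≤ ∑ i, (e^2 + ge i^2) := Finset.sum_le_sum fun i _ => by
            have := sq_nonneg (|e| - |ge i|); rw [sub_sq, sq_abs, sq_abs] at this; linarith
        _ = _ := by rw [Finset.sum_add_distrib]; simp [hN]
    have h4 : n * e^2 + N ≤ n * (e^2 + N) := by
      have := mul_le_mul_of_nonneg_right hn1 N0; rw [mul_add]; linarith
    rw [show 2 * e * w^2 * qf T ge b = w^2 * (2 * e * qf T ge b) by ring, abs_mul, abs_mul, abs_mul,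
      abs_of_pos (by positivity : 0 < w^2), abs_two]
    calc w^2 * (2 * |e| * |qf T ge b|) ≤ w^2 * (2 * |e| * (L * w^d * ((∑ i, |ge i|) * (n * L)))) := by
          gcongr; exact h1.trans (by gcongr)
      _ = n * L^2 * w^(d+2) * (2 * |e| * ∑ i, |ge i|) := by ring
      _ ≤ n * L^2 * (4 * Y) * (n * (e^2 + N)) := by
          exact mul_le_mul (by gcongr) (h3.trans h4) (by positivity) (by positivity)
      _ = _ := by ring
  have hX2 := mul_le_mul_of_nonneg_left hX (by positivity : 0 ≤ e^2 * w)
  have u1 := (abs_le.1 t1).1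
  have u2 := (abs_le.1 t2).1
  have u5 : -(L * ((2 * n^2 * L^2 + 4 * n * L^2) * (e^2 * Y))) ≤
      c/(p+1) * (e^2 * w^2 * (∑ m, ∑ i, db i m * T i m - ∑ m, b m * D2 m)) := by
    have : |c/(p+1) * (e^2 * w^2 * (∑ m, ∑ i, db i m * T i m - ∑ m, b m * D2 m))| ≤
      L * ((2 * n^2 * L^2 + 4 * n * L^2) * (e^2 * Y)) := by
      rw [abs_mul, abs_of_nonneg hcp0]; gcongr
    exact (abs_le.1 this).1
  have u6 : -(L * (4 * n^2 * L^2 * ((e^2 + N) * Y))) ≤ c/(p+1) * (2 * e * w^2 * qf T ge b) := by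
    have : |c/(p+1) * (2 * e * w^2 * qf T ge b)| ≤ L * (4 * n^2 * L^2 * ((e^2 + N) * Y)) := by
      rw [abs_mul, abs_of_nonneg hcp0]; gcongr
    exact (abs_le.1 this).1
  have e7 : c/(p+1) * ((p+1) * e^2 * w * qf T gw b) = e^2 * w * (c * qf T gw b) := by
    have : p + 1 ≠ 0 := by linarith
    field_simp
  have hNY : 0 ≤ N * Y := by positivity
  have heY : 0 ≤ e^2 * Y := by positivity
  have a1 : 0 ≤ 64 * n * L * (e^2 * Y) := by positivity
  have a2 : 0 ≤ (16 * n^2 * L^5 + 2 * n * L^3 * 2^(d+1) + L + L * (2 * n^2 * L^2 + 4 * n * L^2)) * (N * Y) := by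
    positivity
  have hpe : 3/4 * (e^2 * Q) ≤ p/2 * (e^2 * Q) := by
    have : 0 ≤ e^2 * Q := by positivity
    nlinarith
  unfold Cen
  rw [mul_add (c/(p+1)), mul_add (c/(p+1)), e7]
  have hX3 : e^2 * w * (c * qf F G gw) - e^2 * w * (c * qf T gw b) - (e^2 * w * (L * ∑ i, |gw i|) + e^2 * w * (L * w^(d+3))) ≤ e^2 * w * X := by
    refine le_trans (le_of_eq ?_) hX2; ring
  rw [t4] at hX3
  have : (64 * n * L + 16 * n^2 * L^5 + 2 * n * L^3 * 2^(d+1) + L + L * (2 * n^2 * L^2 + 4 * n * L^2) +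
    L * (4 * n^2 * L^2)) * ((e^2 + N) * Y) = 64 * n * L * (e^2 * Y) + 64 * n * L * (N * Y) +
    (16 * n^2 * L^5 + 2 * n * L^3 * 2^(d+1) + L + L * (2 * n^2 * L^2 + 4 * n * L^2)) * (N * Y) +
    16 * n^2 * L^5 * (e^2 * Y) + 2 * n * L^3 * 2^(d+1) * (e^2 * Y) + L * (e^2 * Y) +
    L * ((2 * n^2 * L^2 + 4 * n * L^2) * (e^2 * Y)) + L * (4 * n^2 * L^2 * ((e^2 + N) * Y)) := by ring
  rw [this]
  have e8 : p * e^2 * Q = p/2 * (e^2 * Q) + p/2 * (e^2 * Q) := by ring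
  rw [e8]
  have heQ : 0 ≤ e^2 * Q := by positivity
  linarith

theorem pd_cont {n : ℕ} {w : (Fin n → ℝ) → ℝ} (h : ContDiff ℝ 1 w) (i : Fin n) : Continuous (pd i w) :=
  (contDiff_pd h (s := 0) (by norm_num) i).continuous

theorem pd_rpow {n : ℕ} {w : (Fin n → ℝ) → ℝ} (h : ContDiff ℝ 1 w) {p : ℝ} (hp : 1 ≤ p) (i : Fin n) (x : Fin n → ℝ) :
    pd i (fun y => w y ^ p) x = p * w x ^ (p-1) * pd i w x := by
  unfold pd
  have := ((h.differentiable (by norm_num) x).hasFDerivAt.rpow_const (p := p) (Or.inr hp)).fderiv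
  rw [this]; simp

theorem contDiff_rpow1 {n : ℕ} {w : (Fin n → ℝ) → ℝ} (h : ContDiff ℝ 1 w) {p : ℝ} (hp : 1 ≤ p) :
    ContDiff ℝ 1 (fun y => w y ^ p) :=
  (Real.contDiff_rpow_const_of_le (n := 1) (by simpa using hp)).comp h

theorem pd_test {n : ℕ} {η w g : (Fin n → ℝ) → ℝ} (hη : ContDiff ℝ 1 η) (hw : ContDiff ℝ 1 w) (hg : ContDiff ℝ 1 g)
    {p : ℝ} (hp : 1 ≤ p) (i : Fin n) (x : Fin n → ℝ) :
    pd i (fun y => (η y * η y) * w y ^ p * g y) x =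
      (2 * η x * pd i η x * w x ^ p + p * η x ^ 2 * w x ^ (p-1) * pd i w x) * g x + η x ^ 2 * w x ^ p * pd i g x := by
  have h1 := (contDiff_rpow1 hw hp)
  have d1 : DifferentiableAt ℝ η x := hη.differentiable (by norm_num) x
  have d2 : DifferentiableAt ℝ (fun y => w y ^ p) x := h1.differentiable (by norm_num) x
  have d3 : DifferentiableAt ℝ g x := hg.differentiable (by norm_num) x
  rw [pd_mul ((d1.fun_mul d1).fun_mul d2) d3, pd_mul (d1.fun_mul d1) d2, pd_mul d1 d1, pd_rpow hw hp]
  ring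

theorem pd_zero_off {n : ℕ} {η : (Fin n → ℝ) → ℝ} (i : Fin n) {x : Fin n → ℝ} (h : x ∉ tsupport η) : pd i η x = 0 := by
  unfold pd
  have : fderiv ℝ η x = 0 := by
    by_contra hne
    exact h (support_fderiv_subset ℝ hne)
  rw [this]; simp

theorem weak_sum {n : ℕ} {F : (Fin n → ℝ) → Matrix (Fin n) (Fin n) ℝ} {D : (Fin n → ℝ) → Fin n → ℝ}
    (hF : ∀ i m, Continuous fun x => F x i m) (hD : ∀ m, Continuous fun x => D x m)
    (W : ∀ (ψ : (Fin n → ℝ) → ℝ) (m : Fin n), ContDiff ℝ 1 ψ → HasCompactSupport ψ →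
      ∫ x, ∑ i, pd i ψ x * F x i m = ∫ x, ψ x * D x m)
    (ψ : Fin n → (Fin n → ℝ) → ℝ) (h1 : ∀ m, ContDiff ℝ 1 (ψ m)) (h2 : ∀ m, HasCompactSupport (ψ m)) :
    Integrable (fun x => ∑ m, (∑ i, pd i (ψ m) x * F x i m - ψ m x * D x m)) ∧
      ∫ x, ∑ m, (∑ i, pd i (ψ m) x * F x i m - ψ m x * D x m) = 0 := by
  have i1 : ∀ m, Integrable (fun x => ∑ i, pd i (ψ m) x * F x i m) := fun m =>
    integrable_finset_sum _ fun i _ => ((pd_cont (h1 m) i).mul (hF i m)).integrable_of_hasCompactSupport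
      ((pd_hasCompactSupport (h2 m) i).mul_right)
  have i2 : ∀ m, Integrable (fun x => ψ m x * D x m) := fun m =>
    ((h1 m).continuous.mul (hD m)).integrable_of_hasCompactSupport ((h2 m).mul_right)
  refine ⟨integrable_finset_sum _ fun m _ => (i1 m).sub (i2 m), ?_⟩
  calc ∫ x, ∑ m, (∑ i, pd i (ψ m) x * F x i m - ψ m x * D x m)
      = ∑ m, ∫ x, (∑ i, pd i (ψ m) x * F x i m - ψ m x * D x m) :=
        integral_finsetSum _ fun m _ => (i1 m).sub (i2 m)
    _ = ∑ m, 0 := Finset.sum_congr rfl fun m _ => by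
        rw [integral_sub (i1 m) (i2 m), W _ m (h1 m) (h2 m), sub_self]
    _ = 0 := by simp

theorem J1_pt {n : ℕ} (F : Matrix (Fin n) (Fin n) ℝ) (D1 ge gw : Fin n → ℝ) (H : Fin n → Fin n → ℝ) (e w P p : ℝ) :
    ∑ m, (∑ i, ((2 * e * ge i * (P * w) + p * e ^ 2 * P * gw i) * gw m + e ^ 2 * (P * w) * H i m) * F i m
      - (e * e) * (P * w) * gw m * D1 m) =
    P * (e^2 * w * (∑ i, ∑ m, F i m * H i m - ∑ m, D1 m * gw m) + 2 * e * w * qf F ge gw + p * e^2 * qf F gw gw) := by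
  unfold qf
  rw [Finset.sum_comm (f := fun i m => F i m * H i m), Finset.sum_comm (f := fun i m => F i m * ge i * gw m),
    Finset.sum_comm (f := fun i m => F i m * gw i * gw m), ← Finset.sum_sub_distrib, Finset.mul_sum, Finset.mul_sum, Finset.mul_sum,
    ← Finset.sum_add_distrib, ← Finset.sum_add_distrib, Finset.mul_sum]
  refine Finset.sum_congr rfl fun m _ => ?_
  have : ∑ i, ((2 * e * ge i * (P * w) + p * e ^ 2 * P * gw i) * gw m + e ^ 2 * (P * w) * H i m) * F i m =
    P * (e^2 * w * ∑ i, F i m * H i m + 2 * e * w * ∑ i, F i m * ge i * gw m + p * e^2 * ∑ i, F i m * gw i * gw m) := by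
    simp only [Finset.mul_sum, ← Finset.sum_add_distrib]
    exact Finset.sum_congr rfl fun i _ => by ring
  rw [this]; ring

theorem J2_pt {n : ℕ} (T : Matrix (Fin n) (Fin n) ℝ) (D2 b ge gw : Fin n → ℝ) (db : Fin n → Fin n → ℝ) (e w P p : ℝ) :
    ∑ m, (∑ i, ((2 * e * ge i * (P * w^2) + (p+1) * e ^ 2 * (P * w) * gw i) * b m + e ^ 2 * (P * w^2) * db i m) * T i m
      - (e * e) * (P * w^2) * b m * D2 m) =
    P * (e^2 * w^2 * (∑ m, ∑ i, db i m * T i m - ∑ m, b m * D2 m) + 2 * e * w^2 * qf T ge b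
        + (p+1) * e^2 * w * qf T gw b) := by
  unfold qf
  rw [Finset.sum_comm (f := fun i m => T i m * ge i * b m),
    Finset.sum_comm (f := fun i m => T i m * gw i * b m), ← Finset.sum_sub_distrib, Finset.mul_sum, Finset.mul_sum, Finset.mul_sum,
    ← Finset.sum_add_distrib, ← Finset.sum_add_distrib, Finset.mul_sum]
  refine Finset.sum_congr rfl fun m _ => ?_
  have : ∑ i, ((2 * e * ge i * (P * w^2) + (p+1) * e ^ 2 * (P * w) * gw i) * b m + e ^ 2 * (P * w^2) * db i m) * T i m =
    P * (e^2 * w^2 * ∑ i, db i m * T i m + 2 * e * w^2 * ∑ i, T i m * ge i * b m + (p+1) * e^2 * w * ∑ i, T i m * gw i * b m) := by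
    simp only [Finset.mul_sum, ← Finset.sum_add_distrib]
    exact Finset.sum_congr rfl fun i _ => by ring
  rw [this]; ring

set_option maxHeartbeats 1000000 in
theorem energy_int {n : ℕ} (hn : 1 ≤ n) (d : ℕ) {F T : (Fin n → ℝ) → Matrix (Fin n) (Fin n) ℝ}
    {D1 D2 : (Fin n → ℝ) → Fin n → ℝ}
    (hFc : ∀ i m, Continuous fun x => F x i m) (hD1c : ∀ m, Continuous fun x => D1 x m)
    (hTc : ∀ i m, Continuous fun x => T x i m) (hD2c : ∀ m, Continuous fun x => D2 x m)
    (W1 : ∀ (ψ : (Fin n → ℝ) → ℝ) (m : Fin n), ContDiff ℝ 1 ψ → HasCompactSupport ψ →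
      ∫ x, ∑ i, pd i ψ x * F x i m = ∫ x, ψ x * D1 x m)
    (W2 : ∀ (ψ : (Fin n → ℝ) → ℝ) (m : Fin n), ContDiff ℝ 1 ψ → HasCompactSupport ψ →
      ∫ x, ∑ i, pd i ψ x * T x i m = ∫ x, ψ x * D2 x m)
    {w η : (Fin n → ℝ) → ℝ} (hw : ContDiff ℝ 2 w) (hη : ContDiff ℝ 1 η) (hηc : HasCompactSupport η)
    {S : Set (Fin n → ℝ)} (hS : tsupport η ⊆ S)
    {b G : (Fin n → ℝ) → Fin n → ℝ} (hbc : ∀ m, ContDiff ℝ 1 (fun x => b x m))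
    {c p L : ℝ} (hp : 3/2 ≤ p) (hc0 : 0 ≤ c) (hcL : c ≤ L) (hL : 1 ≤ L)
    (hwS : ∀ x ∈ S, 1/2 ≤ w x) (hFs : ∀ x ∈ S, (F x)ᵀ = F x) (hF0 : ∀ x ∈ S, ∀ a, 0 ≤ qf (F x) a a)
    (hFl : ∀ x ∈ S, ∀ a : Fin n → ℝ, ∑ i, a i ^ 2 ≤ L * w x * qf (F x) a a)
    (hFb : ∀ x ∈ S, ∀ i m, |F x i m| ≤ L * w x^(d+1)) (hTb : ∀ x ∈ S, ∀ i m, |T x i m| ≤ L * w x^d)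
    (hD2 : ∀ x ∈ S, ∀ m, |D2 x m| ≤ L * w x^d) (hG : ∀ x ∈ S, ∀ i, |G x i| ≤ L) (hb : ∀ x ∈ S, ∀ i, |b x i| ≤ L)
    (hdb : ∀ x ∈ S, ∀ i m, |pd i (fun y => b y m) x| ≤ L * w x)
    (hX : ∀ x ∈ S, c * qf (F x) (G x) (grad w x) - c * qf (T x) (grad w x) (b x)
      - L * (∑ i, |pd i w x| + w x^(d+3)) ≤ ∑ i, ∑ m, F x i m * pd i (pd m w) x - ∑ m, D1 x m * pd m w x) :
    p * ∫ x, η x ^ 2 * (max (w x) (1/2)) ^ (p-2) * ∑ i, pd i w x ^ 2 ≤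
      2 * L * Cen n d L * ∫ x, (η x ^ 2 + ∑ i, pd i η x ^ 2) * (max (w x) (1/2)) ^ (p + (d + 3 : ℝ)) := by
  have hw1 : ContDiff ℝ 1 w := hw.of_le (by norm_num)
  have hwi : ∀ m, ContDiff ℝ 1 (pd m w) := fun m => contDiff_pd hw (by norm_num) m
  have hcs : ∀ (s : ℝ) (g : (Fin n → ℝ) → ℝ), HasCompactSupport (fun y => (η y * η y) * w y ^ s * g y) := fun s g =>
    ((hηc.mul_right (f' := η)).mul_right (f' := fun y => w y ^ s)).mul_right
  obtain ⟨i1, z1⟩ := weak_sum hFc hD1c W1 (fun m y => (η y * η y) * w y ^ p * pd m w y)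
    (fun m => ((hη.mul hη).mul (contDiff_rpow1 hw1 (by linarith))).mul (hwi m)) (fun m => hcs _ _)
  obtain ⟨i2, z2⟩ := weak_sum hTc hD2c W2 (fun m y => (η y * η y) * w y ^ (p+1) * b y m)
    (fun m => ((hη.mul hη).mul (contDiff_rpow1 hw1 (by linarith))).mul (hbc m)) (fun m => hcs _ _)
  have e1 : ∀ x m i, pd i (fun y => (η y * η y) * w y ^ p * pd m w y) x = _ := fun x m i =>
    pd_test hη hw1 (hwi m) (by linarith) i x
  have e2 : ∀ x m i, pd i (fun y => (η y * η y) * w y ^ (p+1) * b y m) x = _ := fun x m i =>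
    pd_test hη hw1 (hbc m) (by linarith) i x
  simp only [e1] at i1 z1
  simp only [e2] at i2 z2
  set J1 : (Fin n → ℝ) → ℝ := fun x => ∑ m, (∑ i, ((2 * η x * pd i η x * w x ^ p + p * η x ^ 2 * w x ^ (p - 1) * pd i w x) * pd m w x +
                η x ^ 2 * w x ^ p * pd i (pd m w) x) * F x i m - η x * η x * w x ^ p * pd m w x * D1 x m) with hJ1
  set J2 : (Fin n → ℝ) → ℝ := fun x => ∑ m, (∑ i, ((2 * η x * pd i η x * w x ^ (p+1) + (p+1) * η x ^ 2 * w x ^ (p + 1 - 1) * pd i w x) * b x m +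
                η x ^ 2 * w x ^ (p+1) * pd i (fun y => b y m) x) * T x i m - η x * η x * w x ^ (p+1) * b x m * D2 x m) with hJ2
  set R1 : (Fin n → ℝ) → ℝ := fun x => (η x ^ 2 + ∑ i, pd i η x ^ 2) * (max (w x) (1/2)) ^ (p + (d + 3 : ℝ)) with hR1
  set L1 : (Fin n → ℝ) → ℝ := fun x => η x ^ 2 * (max (w x) (1/2)) ^ (p-2) * ∑ i, pd i w x ^ 2 with hL1
  have mc : Continuous fun x => max (w x) (1/2) := hw1.continuous.max continuous_const
  have mp : ∀ x, 0 < max (w x) (1/2) := fun x => lt_of_lt_of_le (by norm_num) (le_max_right _ _)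
  have iL : Integrable L1 := by
    refine Continuous.integrable_of_hasCompactSupport ?_ ?_
    · refine (((hη.continuous.pow 2).mul (mc.rpow_const fun x => Or.inl (mp x).ne')).mul
        (continuous_finset_sum _ fun i _ => (pd_cont hw1 i).pow 2))
    · refine HasCompactSupport.mul_right (HasCompactSupport.mul_right ?_)
      refine HasCompactSupport.intro hηc fun x hx => ?_
      simp [image_eq_zero_of_notMem_tsupport hx]
  have iR : Integrable R1 := by
    refine Continuous.integrable_of_hasCompactSupport ?_ ?_
    · refine (((hη.continuous.pow 2).add (continuous_finset_sum _ fun i _ => (pd_cont hη i).pow 2)).mul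
        (mc.rpow_const fun x => Or.inl (mp x).ne'))
    · refine HasCompactSupport.mul_right ?_
      refine HasCompactSupport.intro hηc fun x hx => ?_
      simp [image_eq_zero_of_notMem_tsupport hx, pd_zero_off _ hx]
  have key : ∀ x, p/(2 * L) * L1 x ≤ (J1 x + c/(p+1) * J2 x) + Cen n d L * R1 x := by
    intro x
    by_cases hx : x ∈ tsupport η
    · have hxS := hS hx
      have w0 : 0 < w x := lt_of_lt_of_le (by norm_num) (hwS x hxS)
      have mw : max (w x) (1/2) = w x := max_eq_left (hwS x hxS)
      have hpt := energy_pt hn d (e := η x) (ge := grad η x) hp hc0 hcL hL (hwS x hxS) (hFs x hxS) (hF0 x hxS)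
        (hFl x hxS) (hFb x hxS) (hTb x hxS) (hD2 x hxS) (hG x hxS) (hb x hxS) (hdb x hxS) (hX x hxS)
      set P := w x ^ (p-1) with hP
      have P0 : 0 < P := Real.rpow_pos_of_pos w0 _
      have pw1 : w x ^ p = P * w x := by
        rw [hP, ← Real.rpow_add_one w0.ne']; congr 1; ring
      have pw2 : w x ^ (p+1) = P * w x ^ 2 := by
        rw [Real.rpow_add_one w0.ne', pw1]; ring
      have pw3 : w x ^ (p+1-1) = P * w x := by rw [add_sub_cancel_right, pw1]
      have pw4 : w x ^ (p-2) = P / w x := by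
        rw [hP, ← Real.rpow_sub_one w0.ne']; congr 1; ring
      have pw5 : w x ^ (p + (d+3:ℝ)) = P * w x ^ (d+4) := by
        rw [hP, ← Real.rpow_natCast, ← Real.rpow_add w0]; congr 1; push_cast; ring
      have a1 : J1 x = P * (η x ^ 2 * w x * (∑ i, ∑ m, F x i m * pd i (pd m w) x - ∑ m, D1 x m * pd m w x) +
            2 * η x * w x * qf (F x) (grad η x) (grad w x) +
          p * η x ^ 2 * qf (F x) (grad w x) (grad w x)) := by
        simp only [hJ1]; rw [pw1]
        exact J1_pt (F x) (D1 x) (grad η x) (grad w x) (fun i m => pd i (pd m w) x) (η x) (w x) P p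
      have a2 : J2 x = P * (η x ^ 2 * w x ^ 2 * (∑ m, ∑ i, pd i (fun y => b y m) x * T x i m - ∑ m, b x m * D2 x m) +
              2 * η x * w x ^ 2 * qf (T x) (grad η x) (b x) +
            (p + 1) * η x ^ 2 * w x * qf (T x) (grad w x) (b x)) := by
        simp only [hJ2]; rw [pw2, pw3]
        exact J2_pt (T x) (D2 x) (b x) (grad η x) (grad w x) (fun i m => pd i (fun y => b y m) x) (η x) (w x) P p
      have a3 : R1 x = P * ((η x ^2 + ∑ i, grad η x i ^ 2) * w x ^ (d+4)) := by
        simp only [hR1, mw, pw5, grad]; ring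
      have a4 : L1 x ≤ L * P * (η x ^2 * qf (F x) (grad w x) (grad w x)) := by
        simp only [hL1, mw, pw4]
        calc η x ^ 2 * (P / w x) * ∑ i, pd i w x ^ 2 ≤ η x ^ 2 * (P / w x) * (L * w x * qf (F x) (grad w x) (grad w x)) := by
              gcongr; exact hFl x hxS (grad w x)
          _ = _ := by field_simp
      rw [a1, a2, a3]
      have h5 := mul_le_mul_of_nonneg_left hpt P0.le
      calc p/(2 * L) * L1 x ≤ p/(2*L) * (L * P * (η x ^2 * qf (F x) (grad w x) (grad w x))) := by
            gcongr
        _ = P * (p/2 * (η x ^2 * qf (F x) (grad w x) (grad w x))) := by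
            have : L ≠ 0 := by linarith
            field_simp
        _ ≤ _ := h5
        _ = _ := by ring
    · have h0 := image_eq_zero_of_notMem_tsupport hx
      simp [hJ1, hJ2, hR1, hL1, h0, pd_zero_off _ hx]
  have h1 := integral_mono (iL.const_mul (p/(2*L))) ((i1.add (i2.const_mul (c/(p+1)))).add (iR.const_mul (Cen n d L))) key
  have h2 : ∫ x, ((J1 x + c/(p+1) * J2 x) + Cen n d L * R1 x) = Cen n d L * ∫ x, R1 x := by
    have i3 : Integrable (fun x => J1 x + c/(p+1) * J2 x) := i1.add (i2.const_mul (c/(p+1)))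
    rw [integral_add i3 (iR.const_mul (Cen n d L)), integral_add i1 (i2.const_mul _),
      integral_const_mul, integral_const_mul, z1, z2]
    simp
  have h3 : p/(2*L) * ∫ x, L1 x ≤ Cen n d L * ∫ x, R1 x := by
    rw [← h2, ← integral_const_mul]; exact h1
  have hL0 : 0 < L := by linarith
  calc p * ∫ x, L1 x = 2 * L * (p/(2*L) * ∫ x, L1 x) := by field_simp
    _ ≤ 2 * L * (Cen n d L * ∫ x, R1 x) := by gcongr
    _ = _ := by ring

theorem sob_real {n : ℕ} (hn : 1 ≤ n) (s s' : ℝ) (hs : 1 ≤ s) (hs' : 0 < s') (h : s'⁻¹ = s⁻¹ - (n:ℝ)⁻¹) :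
    ∃ K : ℝ, 0 ≤ K ∧ ∀ g : (Fin n → ℝ) → ℝ, ContDiff ℝ 1 g → HasCompactSupport g →
      (∫ x, |g x| ^ s') ^ s'⁻¹ ≤ K * (∫ x, ‖fderiv ℝ g x‖ ^ s) ^ s⁻¹ := by
  lift s to NNReal using (by linarith)
  lift s' to NNReal using hs'.le
  refine ⟨SNormLESNormFDerivOfEqConst ℝ (volume : Measure (Fin n → ℝ)) s, NNReal.coe_nonneg _, fun g hg hgc => ?_⟩
  have h1 := eLpNorm_le_eLpNorm_fderiv_of_eq (F := ℝ) (volume : Measure (Fin n → ℝ)) hg hgc (p := s) (p' := s')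
    (by exact_mod_cast hs) (by simp; omega) (by simpa using h)
  have m1 : MemLp g s' volume := hg.continuous.memLp_of_hasCompactSupport hgc
  have m2 : MemLp (fderiv ℝ g) s volume :=
    (hg.continuous_fderiv (by norm_num)).memLp_of_hasCompactSupport (hgc.fderiv ℝ)
  have s0 : (s : ENNReal) ≠ 0 := by
    have : (0:ℝ) < s := by linarith
    have : s ≠ 0 := by intro h; simp [h] at this
    exact_mod_cast this
  have s0' : (s' : ENNReal) ≠ 0 := by
    have : s' ≠ 0 := by intro h; simp [h] at hs'
    exact_mod_cast this
  rw [m1.eLpNorm_eq_integral_rpow_norm s0' (by simp), m2.eLpNorm_eq_integral_rpow_norm s0 (by simp),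
    ← ENNReal.ofReal_coe_nnreal (p := SNormLESNormFDerivOfEqConst ℝ (volume : Measure (Fin n → ℝ)) s), ← ENNReal.ofReal_mul (NNReal.coe_nonneg _)] at h1
  simp only [ENNReal.coe_toReal, Real.norm_eq_abs] at h1
  rwa [ENNReal.ofReal_le_ofReal_iff] at h1
  exact mul_nonneg (NNReal.coe_nonneg _) (Real.rpow_nonneg (integral_nonneg fun x => by positivity) _)

theorem holder_w {n : ℕ} {m : ℝ} (hm : 0 < m) {g W : (Fin n → ℝ) → ℝ} (hg : ContDiff ℝ 1 g)
    (hgc : HasCompactSupport g) (hW : Continuous W) (hW0 : ∀ x, 0 < W x) {S : Set (Fin n → ℝ)} (hS : IsCompact S)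
    (hgS : tsupport g ⊆ S) :
    (∫ x, ‖fderiv ℝ g x‖ ^ (2*m/(m+2))) ^ ((m+2)/m) ≤
      (∫ x, ‖fderiv ℝ g x‖ ^ 2 * (W x)⁻¹) * (∫ x in S, W x ^ (m/2)) ^ (2/m) := by
  have cD : Continuous fun x => ‖fderiv ℝ g x‖ := (hg.continuous_fderiv (by norm_num)).norm
  have hD0 : ∀ x, x ∉ S → fderiv ℝ g x = 0 := by
    intro x hx
    by_contra hne
    exact hx (hgS (support_fderiv_subset ℝ hne))
  have hpq : ((m+2)/m).HolderConjugate ((m+2)/2) := by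
    refine Real.holderConjugate_iff.2 ⟨?_, ?_⟩
    · rw [lt_div_iff₀ hm]; linarith
    · field_simp
  set A : (Fin n → ℝ) → ℝ := fun x => (‖fderiv ℝ g x‖ ^ 2 * (W x)⁻¹) ^ (m/(m+2)) with hA
  set B : (Fin n → ℝ) → ℝ := fun x => W x ^ (m/(m+2)) with hB
  have cA : Continuous A := ((cD.pow 2).mul (hW.inv₀ fun x => (hW0 x).ne')).rpow_const fun x => Or.inr (by positivity)
  have cB : Continuous B := hW.rpow_const fun x => Or.inl (hW0 x).ne'
  haveI : IsFiniteMeasure (volume.restrict S) := ⟨by simpa using hS.measure_lt_top⟩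
  have mk : ∀ (f : (Fin n → ℝ) → ℝ) (p : ENNReal), Continuous f → MemLp f p (volume.restrict S) := by
    intro f p hf
    obtain ⟨C, hC⟩ := hS.exists_bound_of_continuousOn hf.continuousOn
    exact MemLp.of_bound hf.aestronglyMeasurable C ((ae_restrict_iff' hS.measurableSet).2 (.of_forall fun x hx => hC x hx))
  have h := integral_mul_le_Lp_mul_Lq_of_nonneg (μ := volume.restrict S) hpq (f := A) (g := B)
    (.of_forall fun x => by simp only [hA]; have := hW0 x; positivity)
    (.of_forall fun x => by simp only [hB]; have := hW0 x; positivity) (mk A _ cA) (mk B _ cB)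
  have e1 : ∀ x, A x * B x = ‖fderiv ℝ g x‖ ^ (2*m/(m+2)) := by
    intro x
    have w0 := hW0 x
    simp only [hA, hB]
    rw [← Real.mul_rpow (by positivity) w0.le, mul_assoc, inv_mul_cancel₀ w0.ne', mul_one, ← Real.rpow_natCast,
      ← Real.rpow_mul (norm_nonneg _)]
    congr 1; push_cast; ring
  have e2 : ∀ x, A x ^ ((m+2)/m) = ‖fderiv ℝ g x‖ ^ 2 * (W x)⁻¹ := by
    intro x
    have w0 := hW0 x
    simp only [hA]
    rw [← Real.rpow_mul (by positivity), show m/(m+2) * ((m+2)/m) = 1 by field_simp, Real.rpow_one]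
  have e3 : ∀ x, B x ^ ((m+2)/2) = W x ^ (m/2) := by
    intro x
    have w0 := hW0 x
    simp only [hB]
    rw [← Real.rpow_mul w0.le]
    congr 1; field_simp
  simp only [e1, e2, e3] at h
  have z1 : ∫ x in S, ‖fderiv ℝ g x‖ ^ (2*m/(m+2)) = ∫ x, ‖fderiv ℝ g x‖ ^ (2*m/(m+2)) :=
    setIntegral_eq_integral_of_forall_compl_eq_zero fun x hx => by
      rw [hD0 x hx, norm_zero, Real.zero_rpow (by positivity)]
  have z2 : ∫ x in S, ‖fderiv ℝ g x‖ ^ 2 * (W x)⁻¹ = ∫ x, ‖fderiv ℝ g x‖ ^ 2 * (W x)⁻¹ :=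
    setIntegral_eq_integral_of_forall_compl_eq_zero fun x hx => by
      rw [hD0 x hx]; simp
  rw [z1, z2] at h
  have i1 : 0 ≤ ∫ x, ‖fderiv ℝ g x‖ ^ 2 * (W x)⁻¹ := integral_nonneg fun x => by have := hW0 x; positivity
  have i2 : 0 ≤ ∫ x in S, W x ^ (m/2) := integral_nonneg fun x => by have := hW0 x; positivity
  have h2 := Real.rpow_le_rpow (integral_nonneg fun x => by positivity) h (by positivity : 0 ≤ (m+2)/m)
  refine h2.trans (le_of_eq ?_)
  rw [Real.mul_rpow (by positivity) (by positivity), ← Real.rpow_mul i1, ← Real.rpow_mul i2]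
  congr 1
  · rw [one_div_mul_cancel (by positivity), Real.rpow_one]
  · congr 1; field_simp

theorem norm_fderiv_sq_le {n : ℕ} (g : (Fin n → ℝ) → ℝ) (x : Fin n → ℝ) :
    ‖fderiv ℝ g x‖ ^ 2 ≤ n * ∑ i, pd i g x ^ 2 := by
  refine le_trans ?_ (sum_sq_le (fun i => pd i g x))
  refine pow_le_pow_left₀ (norm_nonneg _) ?_ 2
  refine ContinuousLinearMap.opNorm_le_bound _ (Finset.sum_nonneg fun i _ => abs_nonneg _) fun v => ?_
  have : v = ∑ i, v i • (Pi.single i 1 : Fin n → ℝ) := by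
    ext j; simp [Finset.sum_apply, Pi.single_apply]
  have h2 : fderiv ℝ g x v = ∑ i, v i * pd i g x := by
    conv_lhs => rw [this]
    rw [map_sum]; simp [pd]
  rw [h2, Finset.sum_mul]
  refine (norm_sum_le _ _).trans (Finset.sum_le_sum fun i _ => ?_)
  rw [norm_mul, mul_comm]
  exact mul_le_mul_of_nonneg_left (norm_le_pi_norm v i) (abs_nonneg _)

set_option maxHeartbeats 2000000 in
theorem sob_step {n k : ℕ} (hn : 3 ≤ n) (hk : 2 ≤ k) (hkn : k ≤ n) {m β : ℝ} (hm : m = ((k:ℝ)+1) * n)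
    (hβ : β = m / (m - 2 * k)) :
    ∃ K : ℝ, 0 ≤ K ∧ ∀ (w η : (Fin n → ℝ) → ℝ) (S : Set (Fin n → ℝ)) (q CE M' : ℝ), ContDiff ℝ 2 w → ContDiff ℝ 1 η →
      HasCompactSupport η → tsupport η ⊆ S → IsCompact S → (∀ x ∈ S, 1/2 ≤ w x) → 5/2 ≤ q → 0 ≤ CE →
      (∫ x in S, (max (w x) (1/2)) ^ (m/2)) ≤ M' →
      ((q-1) * ∫ x, η x ^ 2 * (max (w x) (1/2)) ^ (q-3) * ∑ i, pd i w x ^ 2 ≤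
        CE * ∫ x, (η x ^ 2 + ∑ i, pd i η x ^ 2) * (max (w x) (1/2)) ^ (q + (k : ℝ))) →
      (∫ x, |η x * w x ^ (q/2)| ^ (2*β)) ^ β⁻¹ ≤
        K * (1 + CE) * M' ^ (2/m) * q * ∫ x, (η x ^ 2 + ∑ i, pd i η x ^ 2) * (max (w x) (1/2)) ^ (q + (k : ℝ)) := by
  have hn' : (3:ℝ) ≤ n := by exact_mod_cast hn
  have hk' : (2:ℝ) ≤ k := by exact_mod_cast hk
  have hkn' : (k:ℝ) ≤ n := by exact_mod_cast hkn
  have hm9 : 9 ≤ m := by rw [hm]; nlinarith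
  have hm2 : 0 < m - 2 * k := by rw [hm]; nlinarith
  have hm0 : 0 < m := by linarith
  have hβ0 : 0 < β := by rw [hβ]; positivity
  obtain ⟨K, hK, hsob⟩ := sob_real (n := n) (by omega) (2*m/(m+2)) (2*β) (by rw [le_div_iff₀] <;> linarith) (by positivity) (by
    rw [hβ]
    have : (n:ℝ) = m / (k+1) := by rw [hm]; field_simp
    rw [this]; field_simp; ring)
  refine ⟨K^2 * (n * (2 * 2^(k+1) + 1)), by positivity, ?_⟩
  intro w η S q CE M' hw hη hηc hηS hS hwS hq hCE hM hE
  have hw1 : ContDiff ℝ 1 w := hw.of_le (by norm_num)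
  set g : (Fin n → ℝ) → ℝ := fun x => η x * w x ^ (q/2) with hg
  set W : (Fin n → ℝ) → ℝ := fun x => max (w x) (1/2) with hWdef
  have gC : ContDiff ℝ 1 g := hη.mul (contDiff_rpow1 hw1 (by linarith))
  have gc : HasCompactSupport g := hηc.mul_right
  have gS : tsupport g ⊆ S := (tsupport_mul_subset_left).trans hηS
  have mc : Continuous W := hw1.continuous.max continuous_const
  have mp : ∀ x, 0 < W x := fun x => lt_of_lt_of_le (by norm_num) (le_max_right _ _)
  have mh : ∀ x, 1/2 ≤ W x := fun x => le_max_right _ _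
  have h1 := hsob g gC gc
  have h2 := holder_w hm0 gC gc mc mp hS gS
  set I := ∫ x, (η x ^ 2 + ∑ i, pd i η x ^ 2) * W x ^ (q + (k : ℝ)) with hI
  have I0 : 0 ≤ I := integral_nonneg fun x => by
    have := mp x
    have : 0 ≤ ∑ i, pd i η x ^ 2 := Finset.sum_nonneg fun i _ => sq_nonneg _
    positivity
  set L1 : (Fin n → ℝ) → ℝ := fun x => η x ^ 2 * (W x) ^ (q-3) * ∑ i, pd i w x ^ 2 with hL1
  set R1 : (Fin n → ℝ) → ℝ := fun x => (η x ^ 2 + ∑ i, pd i η x ^ 2) * W x ^ (q + (k : ℝ)) with hR1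
  have iL : Integrable L1 := by
    refine Continuous.integrable_of_hasCompactSupport ?_ ?_
    · refine (((hη.continuous.pow 2).mul (mc.rpow_const fun x => Or.inl (mp x).ne')).mul
        (continuous_finset_sum _ fun i _ => (pd_cont hw1 i).pow 2))
    · refine HasCompactSupport.mul_right (HasCompactSupport.mul_right ?_)
      refine HasCompactSupport.intro hηc fun x hx => ?_
      simp [image_eq_zero_of_notMem_tsupport hx]
  have iR : Integrable R1 := by
    refine Continuous.integrable_of_hasCompactSupport ?_ ?_
    · refine (((hη.continuous.pow 2).add (continuous_finset_sum _ fun i _ => (pd_cont hη i).pow 2)).mul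
        (mc.rpow_const fun x => Or.inl (mp x).ne'))
    · refine HasCompactSupport.mul_right ?_
      refine HasCompactSupport.intro hηc fun x hx => ?_
      simp [image_eq_zero_of_notMem_tsupport hx, pd_zero_off _ hx]
  have iG : Integrable fun x => ‖fderiv ℝ g x‖ ^ 2 * (W x)⁻¹ := by
    refine Continuous.integrable_of_hasCompactSupport ?_ ?_
    · exact ((gC.continuous_fderiv (by norm_num)).norm.pow 2).mul (mc.inv₀ fun x => (mp x).ne')
    · refine HasCompactSupport.mul_right ?_
      refine HasCompactSupport.intro (gc.fderiv ℝ) fun x hx => ?_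
      simp [image_eq_zero_of_notMem_tsupport hx]
  have key : ∀ x, ‖fderiv ℝ g x‖ ^ 2 * (W x)⁻¹ ≤ (n * (2 * 2^(k+1))) * R1 x + (n * (q^2/2)) * L1 x := by
    intro x
    by_cases hx : x ∈ tsupport η
    · have hxS := hηS hx
      have w0 : 0 < w x := lt_of_lt_of_le (by norm_num) (hwS x hxS)
      have mw : W x = w x := max_eq_left (hwS x hxS)
      have pg : ∀ i, pd i g x ^ 2 ≤ 2 * pd i η x ^ 2 * w x ^ q + (q^2/2) * (η x ^ 2 * w x ^ (q-2) * pd i w x ^ 2) := by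
        intro i
        have e1 : pd i g x = η x * (q/2 * w x ^ (q/2-1) * pd i w x) + pd i η x * w x ^ (q/2) := by
          rw [hg, pd_mul (hη.differentiable (by norm_num) x)
            ((contDiff_rpow1 hw1 (by linarith : 1 ≤ q/2)).differentiable (by norm_num) x), pd_rpow hw1 (by linarith)]
        have e2 : w x ^ q = (w x ^ (q/2))^2 := by
          rw [← Real.rpow_natCast, ← Real.rpow_mul w0.le]; congr 1; push_cast; ring
        have e3 : w x ^ (q-2) = (w x ^ (q/2-1))^2 := by
          rw [← Real.rpow_natCast, ← Real.rpow_mul w0.le]; congr 1; push_cast; ring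
        rw [e1, e2, e3]
        nlinarith [sq_nonneg (η x * (q/2 * w x ^ (q/2-1) * pd i w x) - pd i η x * w x ^ (q/2))]
      have e4 : w x ^ q * (w x)⁻¹ ≤ 2^(k+1) * w x ^ (q + (k:ℝ)) := by
        have : 1 ≤ (2 * w x) ^ (k+1) := one_le_pow₀ (by linarith [hwS x hxS])
        rw [mul_pow] at this
        have e5 : w x ^ (q + (k:ℝ)) = w x ^ q * (w x)⁻¹ * w x ^ (k+1) := by
          rw [Real.rpow_add w0, Real.rpow_natCast]; field_simp; ring
        rw [e5]
        have : 0 ≤ w x ^ q * (w x)⁻¹ := by positivity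
        nlinarith
      have e6 : w x ^ (q-2) * (w x)⁻¹ = w x ^ (q-3) := by
        rw [← div_eq_mul_inv, ← Real.rpow_sub_one w0.ne']; congr 1; ring
      have N0 : 0 ≤ ∑ i, pd i η x ^ 2 := Finset.sum_nonneg fun i _ => sq_nonneg _
      calc ‖fderiv ℝ g x‖ ^ 2 * (W x)⁻¹ ≤ (n * ∑ i, pd i g x ^ 2) * (w x)⁻¹ := by
            rw [mw]; gcongr; exact norm_fderiv_sq_le g x
        _ ≤ (n * ∑ i, (2 * pd i η x ^ 2 * w x ^ q + (q^2/2) * (η x ^ 2 * w x ^ (q-2) * pd i w x ^ 2))) * (w x)⁻¹ := by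
            gcongr with i _; exact pg i
        _ = n * 2 * (∑ i, pd i η x ^ 2) * (w x ^ q * (w x)⁻¹) + n * (q^2/2) * (η x ^ 2 * (w x ^ (q-2) * (w x)⁻¹) * ∑ i, pd i w x ^ 2) := by
            rw [Finset.sum_add_distrib, ← Finset.mul_sum, ← Finset.mul_sum, ← Finset.sum_mul, ← Finset.mul_sum]; ring
        _ ≤ n * 2 * (η x ^ 2 + ∑ i, pd i η x ^ 2) * (2^(k+1) * w x ^ (q + (k:ℝ))) + n * (q^2/2) * (η x ^ 2 * w x ^ (q-3) * ∑ i, pd i w x ^ 2) := by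
            rw [e6]; gcongr; linarith [sq_nonneg (η x)]
        _ = _ := by simp only [hR1, hL1, mw]; ring
    · have hg0 : fderiv ℝ g x = 0 := by
        by_contra hne
        exact hx ((tsupport_mul_subset_left) (support_fderiv_subset ℝ hne))
      have := mp x
      have N0 : 0 ≤ ∑ i, pd i η x ^ 2 := Finset.sum_nonneg fun i _ => sq_nonneg _
      have N1 : 0 ≤ ∑ i, pd i w x ^ 2 := Finset.sum_nonneg fun i _ => sq_nonneg _
      rw [hg0]; simp only [hR1, hL1, norm_zero]
      rw [zero_pow (by norm_num), zero_mul]; positivity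
  have h3 : ∫ x, ‖fderiv ℝ g x‖ ^ 2 * (W x)⁻¹ ≤ (n * (2 * 2^(k+1))) * I + (n * (q^2/2)) * ∫ x, L1 x := by
    have := integral_mono iG ((iR.const_mul _).add (iL.const_mul _)) key
    refine this.trans (le_of_eq ?_)
    simp only [Pi.add_apply]
    rw [integral_add (iR.const_mul _) (iL.const_mul _), integral_const_mul, integral_const_mul]
  have h4 : q^2/2 * ∫ x, L1 x ≤ q * (CE * I) := by
    have L0 : 0 ≤ ∫ x, L1 x := integral_nonneg fun x => by
      have := mp x
      have N1 : 0 ≤ ∑ i, pd i w x ^ 2 := Finset.sum_nonneg fun i _ => sq_nonneg _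
      simp only [hL1]; positivity
    calc q^2/2 * ∫ x, L1 x ≤ q * (q-1) * ∫ x, L1 x := by
          refine mul_le_mul_of_nonneg_right ?_ L0; nlinarith
      _ = q * ((q-1) * ∫ x, L1 x) := by ring
      _ ≤ _ := mul_le_mul_of_nonneg_left hE (by linarith)
  have h5 : ∫ x, ‖fderiv ℝ g x‖ ^ 2 * (W x)⁻¹ ≤ n * (2 * 2^(k+1) + 1) * (1 + CE) * q * I := by
    have a1 : (n:ℝ) * (q^2/2) * ∫ x, L1 x ≤ n * (q * (CE * I)) := by
      rw [mul_assoc]; exact mul_le_mul_of_nonneg_left h4 (by positivity)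
    have a2 : (n * (2 * 2^(k+1))) * I ≤ (n * (2 * 2^(k+1))) * ((1 + CE) * q * I) := by
      refine mul_le_mul_of_nonneg_left ?_ (by positivity)
      have : 1 ≤ (1 + CE) * q := by nlinarith
      nlinarith
    have a3 : (n:ℝ) * (q * (CE * I)) ≤ n * ((1 + CE) * q * I) := by
      refine mul_le_mul_of_nonneg_left ?_ (by positivity)
      have : 0 ≤ q * I := by positivity
      nlinarith
    linarith
  have D0 : 0 ≤ ∫ x, ‖fderiv ℝ g x‖ ^ (2*m/(m+2)) := integral_nonneg fun x => by positivity
  have G0 : 0 ≤ ∫ x, |g x| ^ (2*β) := integral_nonneg fun x => by positivity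
  have h6 : (∫ x, |g x| ^ (2*β)) ^ β⁻¹ ≤ K^2 * (∫ x, ‖fderiv ℝ g x‖ ^ (2*m/(m+2))) ^ ((m+2)/m) := by
    have := Real.rpow_le_rpow (Real.rpow_nonneg G0 _) h1 (by norm_num : (0:ℝ) ≤ 2)
    rw [Real.mul_rpow hK (Real.rpow_nonneg D0 _), ← Real.rpow_mul G0, ← Real.rpow_mul D0, Real.rpow_two] at this
    convert this using 2
    · field_simp
    · congr 1; field_simp
  have W0 : 0 ≤ ∫ x in S, W x ^ (m/2) := integral_nonneg fun x => by have := mp x; positivity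
  have h7 := Real.rpow_le_rpow W0 hM (by positivity : 0 ≤ 2/m)
  have hM0 : 0 ≤ M' := W0.trans hM
  calc (∫ x, |g x| ^ (2*β)) ^ β⁻¹ ≤ K^2 * (∫ x, ‖fderiv ℝ g x‖ ^ (2*m/(m+2))) ^ ((m+2)/m) := h6
    _ ≤ K^2 * ((n * (2 * 2^(k+1) + 1) * (1 + CE) * q * I) * M' ^ (2/m)) := by
        refine mul_le_mul_of_nonneg_left (h2.trans ?_) (by positivity)
        exact mul_le_mul h5 h7 (by positivity) (by positivity)
    _ = _ := by ring

/-- Quantitative `C^{1,1}` control on a compact convex subset. -/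
theorem c11_bounds {Z : Type*} [NormedAddCommGroup Z] [NormedSpace ℝ Z] {g : Z → ℝ} {D K0 : Set Z}
    (hD : IsOpen D) (hg : C11On g D) (hK : IsCompact K0) (hKc : Convex ℝ K0) (hKD : K0 ⊆ D) :
    ∃ K : ℝ, 0 ≤ K ∧ (∀ y ∈ K0, |g y| ≤ K) ∧ (∀ y ∈ K0, ‖fderiv ℝ g y‖ ≤ K) ∧
      (∀ y ∈ K0, ∀ z ∈ K0, ‖fderiv ℝ g y - fderiv ℝ g z‖ ≤ K * ‖y - z‖) ∧
      (∀ y ∈ K0, ∀ z ∈ K0, |g z - g y - fderiv ℝ g y (z - y)| ≤ K * ‖z - y‖ ^ 2) := by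
  obtain ⟨h1, h2⟩ := hg
  have hdiff : ∀ y ∈ K0, DifferentiableAt ℝ g y := fun y hy =>
    (h1.contDiffAt (hD.mem_nhds (hKD hy))).differentiableAt (by norm_num)
  have hfc : ContinuousOn (fderiv ℝ g) D := h1.continuousOn_fderiv_of_isOpen hD (by norm_num)
  obtain ⟨C1, hC1⟩ := hK.exists_bound_of_continuousOn (h1.continuousOn.mono hKD)
  obtain ⟨C2, hC2⟩ := hK.exists_bound_of_continuousOn (hfc.mono hKD)
  have hll : LocallyLipschitzOn K0 (fderiv ℝ g) := by
    intro y hy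
    obtain ⟨K, t, ht, hL⟩ := h2 y (hKD hy)
    refine ⟨K, t ∩ K0, ?_, ?_⟩
    · rw [hD.nhdsWithin_eq (hKD hy)] at ht
      exact Filter.inter_mem (mem_nhdsWithin_of_mem_nhds ht) self_mem_nhdsWithin
    · intro a ha b hb
      have := hL ha.1 hb.1
      rwa [fderivWithin_of_isOpen hD (hKD ha.2), fderivWithin_of_isOpen hD (hKD hb.2)] at this
  obtain ⟨C3, hC3⟩ := hll.exists_lipschitzOnWith_of_compact hK
  refine ⟨max (max C1 C2) C3, le_max_of_le_right C3.2, ?_, ?_, ?_, ?_⟩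
  · exact fun y hy => (hC1 y hy).trans ((le_max_left _ _).trans (le_max_left _ _))
  · exact fun y hy => (hC2 y hy).trans ((le_max_right _ _).trans (le_max_left _ _))
  · intro y hy z hz
    have := hC3.dist_le_mul y hy z hz
    rw [dist_eq_norm, dist_eq_norm] at this
    exact this.trans (mul_le_mul_of_nonneg_right (le_max_right _ _) (norm_nonneg _))
  · intro y hy z hz
    have hseg : segment ℝ y z ⊆ K0 := hKc.segment_subset hy hz
    have := (convex_segment y z).norm_image_sub_le_of_norm_hasFDerivWithin_le' (f := g) (f' := fderiv ℝ g)
      (φ := fderiv ℝ g y) (C := C3 * ‖z - y‖)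
      (fun x hx => (hdiff x (hseg hx)).hasFDerivAt.hasFDerivWithinAt) (fun x hx => by
        have h3 := hC3.dist_le_mul x (hseg hx) y hy
        rw [dist_eq_norm, dist_eq_norm] at h3
        refine h3.trans (mul_le_mul_of_nonneg_left ?_ C3.2)
        obtain ⟨θ, hθ, rfl⟩ := (segment_eq_image' ℝ y z) ▸ hx
        rw [add_sub_cancel_left, norm_smul, Real.norm_of_nonneg hθ.1]
        exact mul_le_of_le_one_left (norm_nonneg _) hθ.2)
      (left_mem_segment ℝ y z) (right_mem_segment ℝ y z)
    rw [Real.norm_eq_abs] at this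
    refine this.trans ?_
    rw [mul_assoc, ← sq]
    exact mul_le_mul_of_nonneg_right (le_max_right _ _) (by positivity)

/-- Algebra of the divergence term. -/
theorem DD_grad {n d : ℕ} (hd : d + 2 ≤ n) (A : Matrix (Fin n) (Fin n) ℝ) (hA : Aᵀ = A) (dh G b a : Fin n → ℝ)
    (h : ∀ i, dh i = ∑ l, A i l * G l + b i) :
    ∑ m, DD A dh (d+1) m * a m = ((n:ℝ) - d - 1) * (esymmMat (d+1) A * ∑ m, G m * a m
      - qf (newtonT (d+1) A) G a + qf (newtonT d A) a b) := by
  have hTs := newtonT_symm A hA (j := d) (by omega)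
  have h1 : ∀ l m, ∑ i, A i l * newtonT d A i m = esymmMat (d+1) A * (1 : Matrix (Fin n) (Fin n) ℝ) l m - newtonT (d+1) A l m := by
    intro l m
    have e : newtonT (d+1) A = esymmMat (d+1) A • (1 : Matrix (Fin n) (Fin n) ℝ) - A * newtonT d A := by
      rw [newtonT_comm A d]; rfl
    rw [e]
    simp only [Matrix.sub_apply, Matrix.smul_apply, smul_eq_mul, Matrix.mul_apply]
    rw [sub_sub_cancel]
    refine Finset.sum_congr rfl fun i _ => ?_
    rw [← congrFun (congrFun hA l) i, Matrix.transpose_apply]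
  have h2 : ∀ m, ∑ i, dh i * newtonT d A i m = esymmMat (d+1) A * G m - ∑ l, newtonT (d+1) A l m * G l + ∑ i, b i * newtonT d A i m := by
    intro m
    have e1 : ∑ i, dh i * newtonT d A i m = ∑ i, (∑ l, A i l * G l) * newtonT d A i m + ∑ i, b i * newtonT d A i m := by
      rw [← Finset.sum_add_distrib]; exact Finset.sum_congr rfl fun i _ => by rw [h i]; ring
    have e2 : ∑ i, (∑ l, A i l * G l) * newtonT d A i m = ∑ l, G l * ∑ i, A i l * newtonT d A i m := by
      simp only [Finset.sum_mul, Finset.mul_sum]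
      rw [Finset.sum_comm]
      exact Finset.sum_congr rfl fun l _ => Finset.sum_congr rfl fun i _ => by ring
    rw [e1, e2]
    simp only [h1, mul_sub, Finset.sum_sub_distrib]
    congr 2
    · rw [Finset.sum_eq_single m]
      · simp; ring
      · intro l _ hl; simp [Matrix.one_apply_ne hl]
      · simp
    · exact Finset.sum_congr rfl fun l _ => by ring
  have h3 : qf (newtonT d A) a b = ∑ m, (∑ i, b i * newtonT d A i m) * a m := by
    unfold qf
    refine Finset.sum_congr rfl fun m _ => ?_
    rw [Finset.sum_mul]
    refine Finset.sum_congr rfl fun i _ => ?_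
    rw [← congrFun (congrFun hTs m) i, Matrix.transpose_apply]; ring
  have h4 : qf (newtonT (d+1) A) G a = ∑ m, (∑ l, newtonT (d+1) A l m * G l) * a m := by
    unfold qf
    rw [Finset.sum_comm]
    exact Finset.sum_congr rfl fun m _ => by rw [Finset.sum_mul]
  rw [h3, h4, Finset.mul_sum, ← Finset.sum_sub_distrib, ← Finset.sum_add_distrib, Finset.mul_sum]
  refine Finset.sum_congr rfl fun m _ => ?_
  simp only [DD]
  rw [h2]; ring

/-- Quantitative control of a function with Lipschitz derivative on a set. -/
def Ctl {Z : Type*} [NormedAddCommGroup Z] [NormedSpace ℝ Z] (g : Z → ℝ) (K0 : Set Z) (K : ℝ) : Prop :=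
  (∀ y ∈ K0, DifferentiableAt ℝ g y) ∧ (∀ y ∈ K0, |g y| ≤ K) ∧ (∀ y ∈ K0, ‖fderiv ℝ g y‖ ≤ K) ∧
      (∀ y ∈ K0, ∀ z ∈ K0, ‖fderiv ℝ g y - fderiv ℝ g z‖ ≤ K * ‖y - z‖) ∧
      (∀ y ∈ K0, ∀ z ∈ K0, |g y - g z| ≤ K * ‖y - z‖) ∧
      (∀ y ∈ K0, ∀ z ∈ K0, |g z - g y - fderiv ℝ g y (z - y)| ≤ K * ‖z - y‖ ^ 2)

theorem Ctl.mono {Z : Type*} [NormedAddCommGroup Z] [NormedSpace ℝ Z] {g : Z → ℝ} {K0 : Set Z} {K K' : ℝ}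
    (h : Ctl g K0 K) (hK : K ≤ K') : Ctl g K0 K' := by
  obtain ⟨h0, h1, h2, h3, h4, h5⟩ := h
  refine ⟨h0, fun y hy => (h1 y hy).trans hK, fun y hy => (h2 y hy).trans hK, fun y hy z hz => (h3 y hy z hz).trans ?_,
    fun y hy z hz => (h4 y hy z hz).trans ?_, fun y hy z hz => (h5 y hy z hz).trans ?_⟩ <;>
  exact mul_le_mul_of_nonneg_right hK (by positivity)

theorem ctl_of_c11 {Z : Type*} [NormedAddCommGroup Z] [NormedSpace ℝ Z] {g : Z → ℝ} {D K0 : Set Z}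
    (hD : IsOpen D) (hg : C11On g D) (hK : IsCompact K0) (hKc : Convex ℝ K0) (hKD : K0 ⊆ D) :
    ∃ K : ℝ, 0 ≤ K ∧ Ctl g K0 K := by
  obtain ⟨K, hK0, h1, h2, h3, h5⟩ := c11_bounds hD hg hK hKc hKD
  have hdiff : ∀ y ∈ K0, DifferentiableAt ℝ g y := fun y hy =>
    (hg.1.contDiffAt (hD.mem_nhds (hKD hy))).differentiableAt (by norm_num)
  refine ⟨K, hK0, hdiff, h1, h2, h3, fun y hy z hz => ?_, h5⟩
  exact hKc.norm_image_sub_le_of_norm_hasFDerivWithin_le (f := g) (f' := fderiv ℝ g)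
    (fun x hx => (hdiff x hx).hasFDerivAt.hasFDerivWithinAt) h2 hz hy

/-- Second differences. -/
theorem Ctl.second {Z : Type*} [NormedAddCommGroup Z] [NormedSpace ℝ Z] {g : Z → ℝ} {K0 : Set Z} {K : ℝ}
    (h : Ctl g K0 K) (hK : 0 ≤ K) {y z z' : Z} (hy : y ∈ K0) (hz : z ∈ K0) (hz' : z' ∈ K0) {e : ℝ}
    (he : ‖z - y‖ ≤ e) (he' : ‖z' - y‖ ≤ e) :
    |g z - 2 * g y + g z' - fderiv ℝ g y (z - 2 • y + z')| ≤ 2 * K * e ^ 2 := by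
  obtain ⟨_, _, _, _, _, h5⟩ := h
  have a := h5 y hy z hz
  have b := h5 y hy z' hz'
  have a' : K * ‖z - y‖ ^ 2 ≤ K * e ^ 2 := by gcongr
  have b' : K * ‖z' - y‖ ^ 2 ≤ K * e ^ 2 := by gcongr
  have e1 : z - 2 • y + z' = (z - y) + (z' - y) := by rw [two_smul]; abel
  rw [e1, map_add]
  rw [abs_le] at *
  constructor <;> linarith [a.1, a.2, b.1, b.2]

theorem conc {n d : ℕ} (hd : d + 2 ≤ n) (A B C : Matrix (Fin n) (Fin n) ℝ) (hA : Aᵀ = A) (hB : Bᵀ = B) (hC : Cᵀ = C)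
    (gA : GammaPlus (d+2) A) (gB : GammaPlus (d+2) B) (gC : GammaPlus (d+2) C) {a b c : ℝ}
    (ha : 0 < a) (hb : 0 < b) (hc : 0 < c) (hAa : esymmMat (d+2) A = a ^ (d+2))
    (hBb : esymmMat (d+2) B = b ^ (d+2)) (hCc : esymmMat (d+2) C = c ^ (d+2)) :
    (d + 2) * a ^ (d+1) * (b - 2 * a + c) ≤ ∑ i, ∑ m, newtonT (d+1) A i m * (B i m - 2 * A i m + C i m) := by
  have h1 := garding_mat (k := d+1) A B hA hB (by omega) gA gB ha hb hAa hBb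
  have h2 := garding_mat (k := d+1) A C hA hC (by omega) gA gC ha hc hAa hCc
  have h3 := trace_newtonT_mul A hA (j := d+1) (by omega)
  rw [hAa] at h3
  have e : ∀ X : Matrix (Fin n) (Fin n) ℝ, Xᵀ = X → trace (newtonT (d+1) A * X) = ∑ i, ∑ m, newtonT (d+1) A i m * X i m := by
    intro X hX
    unfold Matrix.trace
    refine Finset.sum_congr rfl fun i _ => ?_
    rw [Matrix.diag_apply, Matrix.mul_apply]
    exact Finset.sum_congr rfl fun m _ => by rw [← congrFun (congrFun hX i) m]; rfl
  rw [e B hB] at h1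
  rw [e C hC] at h2
  rw [e A hA] at h3
  have e2 : ∑ i, ∑ m, newtonT (d+1) A i m * (B i m - 2 * A i m + C i m) = ∑ i, ∑ m, newtonT (d+1) A i m * B i m
     - 2 * (∑ i, ∑ m, newtonT (d+1) A i m * A i m) + ∑ i, ∑ m, newtonT (d+1) A i m * C i m := by
    rw [Finset.mul_sum, ← Finset.sum_sub_distrib, ← Finset.sum_add_distrib]
    refine Finset.sum_congr rfl fun i _ => ?_
    rw [Finset.mul_sum, ← Finset.sum_sub_distrib, ← Finset.sum_add_distrib]
    exact Finset.sum_congr rfl fun m _ => by ring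
  rw [e2, h3]
  push_cast at h1 h2 ⊢
  have : a ^ (d+1+1) = a ^ (d+1) * a := pow_succ _ _
  rw [show d + 2 = d + 1 + 1 from rfl, this]
  nlinarith

theorem X_pt {n d : ℕ} (hd : d + 2 ≤ n) (A : Matrix (Fin n) (Fin n) ℝ) (Ap Am : Fin n → Matrix (Fin n) (Fin n) ℝ)
    (hA : Aᵀ = A) (hAp : ∀ l, (Ap l)ᵀ = Ap l) (hAm : ∀ l, (Am l)ᵀ = Am l)
    (gA : GammaPlus (d+2) A) (gAp : ∀ l, GammaPlus (d+2) (Ap l)) (gAm : ∀ l, GammaPlus (d+2) (Am l))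
    {f h t Kf Kh : ℝ} {fp fm hp hm : Fin n → ℝ}
    (f0 : 0 < f) (fp0 : ∀ l, 0 < fp l) (fm0 : ∀ l, 0 < fm l)
    (hAa : esymmMat (d+2) A = f ^ (d+2)) (hApa : ∀ l, esymmMat (d+2) (Ap l) = fp l ^ (d+2))
    (hAma : ∀ l, esymmMat (d+2) (Am l) = fm l ^ (d+2)) (ht : 0 < t)
    {dh G b a : Fin n → ℝ} (hdh : ∀ i, dh i = ∑ l, A i l * G l + b i) {W : Fin n → Fin n → ℝ}
    (hW : ∀ i m, W i m = ∑ l, ((Ap l i m + hp l * (1 : Matrix (Fin n) (Fin n) ℝ) i m) - 2 * (A i m + h * (1 : Matrix (Fin n) (Fin n) ℝ) i m)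
      + (Am l i m + hm l * (1 : Matrix (Fin n) (Fin n) ℝ) i m)) / t ^ 2)
    (hKf : -Kf ≤ ∑ l, (fp l - 2 * f + fm l) / t ^ 2) (hKh : ∑ m, G m * a m - Kh ≤ ∑ l, (hp l - 2 * h + hm l) / t ^ 2) :
    ((n:ℝ) - d - 1) * qf (newtonT (d+1) A) G a - ((n:ℝ) - d - 1) * qf (newtonT d A) a b
      - ((d + 2) * f ^ (d+1) * Kf + ((n:ℝ) - d - 1) * esymmMat (d+1) A * Kh) ≤
      ∑ i, ∑ m, newtonT (d+1) A i m * W i m - ∑ m, DD A dh (d+1) m * a m := by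
  rw [DD_grad hd A hA dh G b a hdh]
  have hσ : 0 < esymmMat (d+1) A := gA (d+1) (by omega) (by omega)
  have hnd : (0:ℝ) ≤ (n:ℝ) - d - 1 := by
    have : ((d + 2 : ℕ) : ℝ) ≤ n := by exact_mod_cast hd
    push_cast at this; linarith
  have htr := trace_newtonT A hA (j := d+1) (by omega)
  have e1 : ∑ i, ∑ m, newtonT (d+1) A i m * W i m =
      ∑ l, (∑ i, ∑ m, newtonT (d+1) A i m * (Ap l i m - 2 * A i m + Am l i m)) / t ^ 2
      + trace (newtonT (d+1) A) * ∑ l, (hp l - 2 * h + hm l) / t ^ 2 := by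
    have s1 : ∀ i m, newtonT (d+1) A i m * W i m = ∑ l, (newtonT (d+1) A i m * (Ap l i m - 2 * A i m + Am l i m) / t^2
       + newtonT (d+1) A i m * (1 : Matrix (Fin n) (Fin n) ℝ) i m * ((hp l - 2 * h + hm l) / t ^ 2)) := by
      intro i m
      rw [hW, Finset.mul_sum]
      refine Finset.sum_congr rfl fun l _ => by ring
    have s2 : trace (newtonT (d+1) A) = ∑ i, ∑ m, newtonT (d+1) A i m * (1 : Matrix (Fin n) (Fin n) ℝ) i m := by
      unfold Matrix.trace
      refine Finset.sum_congr rfl fun i _ => ?_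
      rw [Finset.sum_eq_single i]
      · simp
      · intro m _ hm; simp [Matrix.one_apply_ne hm.symm]
      · simp
    have s3 : ∀ l, (∑ i, ∑ m, newtonT (d+1) A i m * (Ap l i m - 2 * A i m + Am l i m)) / t ^ 2
       + trace (newtonT (d+1) A) * ((hp l - 2 * h + hm l) / t ^ 2)
       = ∑ i, ∑ m, (newtonT (d+1) A i m * (Ap l i m - 2 * A i m + Am l i m) / t^2
       + newtonT (d+1) A i m * (1 : Matrix (Fin n) (Fin n) ℝ) i m * ((hp l - 2 * h + hm l) / t ^ 2)) := by
      intro l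
      rw [s2]
      simp only [Finset.sum_add_distrib, Finset.sum_div, Finset.sum_mul]
    rw [Finset.mul_sum, ← Finset.sum_add_distrib]
    simp only [s1, s3]
    rw [Finset.sum_comm (s := Finset.univ) (t := Finset.univ) (f := fun l i => ∑ m, (newtonT (d+1) A i m * (Ap l i m - 2 * A i m + Am l i m) / t^2
       + newtonT (d+1) A i m * (1 : Matrix (Fin n) (Fin n) ℝ) i m * ((hp l - 2 * h + hm l) / t ^ 2)))]
    exact Finset.sum_congr rfl fun i _ => Finset.sum_comm
  have e2 : (d + 2) * f ^ (d+1) * ∑ l, (fp l - 2 * f + fm l) / t ^ 2 ≤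
      ∑ l, (∑ i, ∑ m, newtonT (d+1) A i m * (Ap l i m - 2 * A i m + Am l i m)) / t ^ 2 := by
    rw [Finset.mul_sum]
    refine Finset.sum_le_sum fun l _ => ?_
    rw [← mul_div_assoc]
    have := conc hd A (Ap l) (Am l) hA (hAp l) (hAm l) gA (gAp l) (gAm l) f0 (fp0 l) (fm0 l) hAa (hApa l) (hAma l)
    gcongr
  have e3 : (d + 2) * f ^ (d+1) * (-Kf) ≤ (d + 2) * f ^ (d+1) * ∑ l, (fp l - 2 * f + fm l) / t ^ 2 := by gcongr
  have e4 : trace (newtonT (d+1) A) * (∑ m, G m * a m - Kh) ≤ trace (newtonT (d+1) A) * ∑ l, (hp l - 2 * h + hm l) / t ^ 2 := by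
    apply mul_le_mul_of_nonneg_left hKh
    rw [htr]; push_cast
    have : (n:ℝ) - (d + 1) = n - d - 1 := by ring
    rw [this]; positivity
  have e5 : trace (newtonT (d+1) A) = ((n:ℝ) - d - 1) * esymmMat (d+1) A := by
    rw [htr]; push_cast; ring
  rw [e1]
  rw [e5] at e4 ⊢
  nlinarith

/-- Smooth cutoffs between concentric cubes. -/
theorem cutoff {n : ℕ} (x₀ : Fin n → ℝ) {r δ : ℝ} (hδ : 0 < δ) :
    ∃ η : (Fin n → ℝ) → ℝ, ContDiff ℝ 3 η ∧ (∀ x ∈ ball x₀ r, η x = 1) ∧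
      tsupport η ⊆ closedBall x₀ (r + δ) ∧ (∀ x, |η x| ≤ 1) ∧ (∀ i x, |pd i η x| ≤ 2 / δ) := by
  set g : (Fin n → ℝ) → ℝ := fun x => max 0 (min 1 ((r + 3 * δ / 4 - ‖x - x₀‖) * (2 / δ))) with hg
  have hgc : Continuous g := by fun_prop
  obtain ⟨N, hN⟩ := exists_nat_one_div_lt (show 0 < δ / 4 by positivity)
  have tri : ∀ x y : Fin n → ℝ, y ∈ ball x (1 / ((N:ℝ)+1)) → |‖y - x₀‖ - ‖x - x₀‖| < δ / 4 := by
    intro x y hy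
    have h1 := abs_norm_sub_norm_le (y - x₀) (x - x₀)
    rw [sub_sub_sub_cancel_right, ← dist_eq_norm] at h1
    exact h1.trans_lt ((mem_ball.1 hy).trans hN)
  refine ⟨mol N g, mol_contDiff N hgc, ?_, ?_, ?_, ?_⟩
  · intro x hx
    have : |mol N g x - 1| ≤ 0 := by
      refine mol_dist N hgc le_rfl fun y hy => ?_
      have h1 := tri x y hy
      have h2 : ‖x - x₀‖ < r := by rw [← dist_eq_norm]; exact hx
      have h3 : g y = 1 := by
        simp only [hg]
        rw [min_eq_left, max_eq_right zero_le_one]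
        rw [mul_div_assoc', le_div_iff₀ hδ]
        linarith [(abs_lt.1 h1).2]
      rw [h3]; simp
    linarith [abs_nonpos_iff.1 this]
  · refine closure_minimal ?_ isClosed_closedBall
    intro x hx
    by_contra hxc
    apply hx
    have hlt : r + δ < ‖x - x₀‖ := by rw [← dist_eq_norm]; simpa using hxc
    have : |mol N g x - 0| ≤ 0 := by
      refine mol_dist N hgc le_rfl fun y hy => ?_
      have h1 := tri x y hy
      have h3 : g y = 0 := by
        simp only [hg]
        apply max_eq_left
        refine (min_le_right _ _).trans ?_
        apply mul_nonpos_of_nonpos_of_nonneg _ (by positivity)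
        linarith [(abs_lt.1 h1).1]
      rw [h3]; simp
    linarith [abs_nonpos_iff.1 this]
  · intro x
    refine mol_bound N hgc zero_le_one fun y _ => ?_
    rw [abs_of_nonneg (le_max_left _ _)]
    exact max_le zero_le_one (min_le_left _ _)
  · intro i x
    refine mol_lip N hgc (by positivity) hN (fun y _ z _ => ?_) i
    simp only [hg]
    have h1 := abs_max_sub_max_le_max (0:ℝ) (min 1 ((r + 3 * δ / 4 - ‖y - x₀‖) * (2 / δ))) 0 (min 1 ((r + 3 * δ / 4 - ‖z - x₀‖) * (2 / δ)))
    have h2 := abs_min_sub_min_le_max (1:ℝ) (((r + 3 * δ / 4 - ‖y - x₀‖) * (2 / δ))) 1 (((r + 3 * δ / 4 - ‖z - x₀‖) * (2 / δ)))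
    have hmx : ∀ z : ℝ, max 0 |z| = |z| := fun z => max_eq_right (abs_nonneg z)
    rw [sub_self, abs_zero, hmx] at h1 h2
    refine h1.trans (h2.trans ?_)
    rw [← sub_mul, abs_mul, abs_of_nonneg (show 0 ≤ 2 / δ by positivity), mul_comm]
    apply mul_le_mul_of_nonneg_left _ (by positivity)
    have := abs_norm_sub_norm_le (z - x₀) (y - x₀)
    rw [sub_sub_sub_cancel_right, norm_sub_rev z y] at this
    have e9 : (r + 3 * δ / 4 - ‖y - x₀‖) - (r + 3 * δ / 4 - ‖z - x₀‖) = ‖z - x₀‖ - ‖y - x₀‖ := by ring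
    rw [e9]; exact this

theorem fderiv_eq_sum {n : ℕ} (g : (Fin n → ℝ) → ℝ) (y v : Fin n → ℝ) :
    fderiv ℝ g y v = ∑ i, v i * pd i g y := by
  conv_lhs => rw [pi_eq_sum_univ' v]
  rw [map_sum]
  refine Finset.sum_congr rfl fun i _ => ?_
  rw [map_smul, smul_eq_mul]
  unfold pd
  congr 2

theorem lip_of_pd {n : ℕ} {g : (Fin n → ℝ) → ℝ} {x : Fin n → ℝ} {r B : ℝ} 
    (hd : ∀ y ∈ ball x r, DifferentiableAt ℝ g y) (h : ∀ y ∈ ball x r, ∀ i, |pd i g y| ≤ B) :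
    ∀ y ∈ ball x r, ∀ z ∈ ball x r, |g y - g z| ≤ n * B * ‖y - z‖ := by
  intro y hy z hz
  refine (convex_ball x r).norm_image_sub_le_of_norm_fderiv_le (f := g) hd (fun y hy => ?_) hz hy
  rcases Nat.eq_zero_or_pos n with h0 | hn
  · subst h0
    simp only [CharP.cast_eq_zero, zero_mul]
    refine ContinuousLinearMap.opNorm_le_bound _ le_rfl fun v => ?_
    rw [fderiv_eq_sum]; simp
  · have hB : 0 ≤ B := (abs_nonneg _).trans (h y hy ⟨0, hn⟩)
    refine ContinuousLinearMap.opNorm_le_bound _ (by positivity) fun v => ?_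
    rw [fderiv_eq_sum, Real.norm_eq_abs]
    refine (Finset.abs_sum_le_sum_abs _ _).trans ?_
    have : ∀ i ∈ Finset.univ, |v i * pd i g y| ≤ ‖v‖ * B := fun i _ => by
      rw [abs_mul]
      exact mul_le_mul (norm_le_pi_norm v i) (h y hy i) (abs_nonneg _) (norm_nonneg _)
    refine (Finset.sum_le_card_nsmul _ _ _ this).trans (le_of_eq ?_)
    simp; ring

theorem hasDerivAt_line {n : ℕ} {g : (Fin n → ℝ) → ℝ} (hg : Differentiable ℝ g) (x : Fin n → ℝ) (l : Fin n) (s : ℝ) :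
    HasDerivAt (fun s : ℝ => g (x + s • (Pi.single l 1 : Fin n → ℝ))) (pd l g (x + s • (Pi.single l 1 : Fin n → ℝ))) s := by
  have h1 : HasDerivAt (fun s : ℝ => x + s • (Pi.single l 1 : Fin n → ℝ)) (Pi.single l 1) s := by
    have := ((hasDerivAt_id s).smul_const (Pi.single l 1 : Fin n → ℝ)).const_add x
    simpa using this
  exact (hg _).hasFDerivAt.comp_hasDerivAt s h1

theorem norm_single {n : ℕ} (l : Fin n) (s : ℝ) : ‖s • (Pi.single l 1 : Fin n → ℝ)‖ = |s| := by
  rw [norm_smul, Pi.norm_single]; simp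

theorem ddq_approx {n : ℕ} {g : (Fin n → ℝ) → ℝ} (hg : ContDiff ℝ 2 g) (l : Fin n) {x : Fin n → ℝ} {ε t : ℝ} (ht : 0 < t)
    (h : ∀ y, ‖y - x‖ ≤ t → |pd l (pd l g) y - pd l (pd l g) x| ≤ ε) : |ddq l t g x - pd l (pd l g) x| ≤ 2 * ε := by
  set e : Fin n → ℝ := Pi.single l 1 with he
  set c := pd l (pd l g) x with hc
  have hg1 : Differentiable ℝ g := hg.differentiable (by norm_num)
  have hg2 : Differentiable ℝ (pd l g) := (contDiff_pd (s := 1) hg (by norm_num) l).differentiable (by norm_num)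
  have L1 := fun s => hasDerivAt_line hg1 x l s
  have L2 := fun s => hasDerivAt_line hg2 x l s
  rw [← he] at L1 L2
  have N1 : ∀ s : ℝ, HasDerivAt (fun s : ℝ => g (x + (-s) • e)) (-pd l g (x + (-s) • e)) s := fun s => by
    exact ((L1 (-s)).scomp s (hasDerivAt_neg s)).congr_deriv (by rw [neg_one_smul])
  have N2 : ∀ s : ℝ, HasDerivAt (fun s : ℝ => pd l g (x + (-s) • e)) (-pd l (pd l g) (x + (-s) • e)) s := fun s => by
    exact ((L2 (-s)).scomp s (hasDerivAt_neg s)).congr_deriv (by rw [neg_one_smul])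
  have hε : 0 ≤ ε := (abs_nonneg _).trans (h x (by simpa using ht.le))
  have hb : ∀ s : ℝ, |s| ≤ t → |pd l (pd l g) (x + s • e) - c| ≤ ε := fun s hs => h _ (by
    rw [add_sub_cancel_left, he, norm_single]; exact hs)
  have Q : ∀ s ∈ Icc 0 t, |pd l g (x + s • e) - pd l g (x + (-s) • e) - 2 * c * s| ≤ 2 * ε * s := by
    intro s hs
    have := norm_image_sub_le_of_norm_deriv_le_segment' (a := 0) (b := t)
      (f := fun s => pd l g (x + s • e) - pd l g (x + (-s) • e) - 2 * c * s)
      (f' := fun s => pd l (pd l g) (x + s • e) - -pd l (pd l g) (x + (-s) • e) - 2 * c * 1) (C := 2 * ε)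
      (fun s _ => (((L2 s).sub (N2 s)).sub ((hasDerivAt_id s).const_mul (2 * c))).hasDerivWithinAt)
      (fun s hs => by
        have a := hb s (by rw [abs_of_nonneg hs.1]; exact hs.2.le)
        have b := hb (-s) (by rw [abs_neg, abs_of_nonneg hs.1]; exact hs.2.le)
        rw [Real.norm_eq_abs]
        rw [abs_le] at *
        constructor <;> linarith [a.1, a.2, b.1, b.2]) s hs
    simpa using this
  have P := norm_image_sub_le_of_norm_deriv_le_segment' (a := 0) (b := t)
      (f := fun s => g (x + s • e) + g (x + (-s) • e) - c * (s * s))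
      (f' := fun s => pd l g (x + s • e) + -pd l g (x + (-s) • e) - c * (1 * s + s * 1)) (C := 2 * ε * t)
      (fun s _ => (((L1 s).add (N1 s)).sub (((hasDerivAt_id s).mul (hasDerivAt_id s)).const_mul c)).hasDerivWithinAt)
      (fun s hs => by
        have a := Q s ⟨hs.1, hs.2.le⟩
        have : 2 * ε * s ≤ 2 * ε * t := by have := hs.2.le; gcongr
        rw [Real.norm_eq_abs]
        have e : pd l g (x + s • e) + -pd l g (x + (-s) • e) - c * (1 * s + s * 1) = pd l g (x + s • e) - pd l g (x + (-s) • e) - 2 * c * s := by ring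
        rw [e]; linarith) t ⟨ht.le, le_rfl⟩
  simp only [neg_zero, zero_smul, add_zero, mul_zero, sub_zero, Real.norm_eq_abs] at P
  unfold ddq
  rw [← he]
  have e2 : x + -t • e = x - t • e := by rw [neg_smul, sub_eq_add_neg]
  rw [e2] at P
  have e3 : (g (x + t • e) - 2 * g x + g (x - t • e)) / t ^ 2 - c = (g (x + t • e) + g (x - t • e) - c * (t * t) - (g x + g x)) / t ^ 2 := by
    field_simp; ring
  rw [e3, abs_div, abs_of_pos (show 0 < t ^ 2 by positivity), div_le_iff₀ (by positivity)]
  linarith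

theorem contDiff_ddq {n : ℕ} {r : WithTop ℕ∞} {g : (Fin n → ℝ) → ℝ} (hg : ContDiff ℝ r g) (l : Fin n) (t : ℝ) : ContDiff ℝ r (ddq l t g) := by
  unfold ddq
  have h1 : ContDiff ℝ r fun x => g (x + t • (Pi.single l 1 : Fin n → ℝ)) := hg.comp (contDiff_id.add contDiff_const)
  have h2 : ContDiff ℝ r fun x => g (x - t • (Pi.single l 1 : Fin n → ℝ)) := hg.comp (contDiff_id.sub contDiff_const)
  exact ((h1.sub (contDiff_const.mul hg)).add h2).div_const _

theorem pd_ddq {n : ℕ} {g : (Fin n → ℝ) → ℝ} (hg : Differentiable ℝ g) (i l : Fin n) (t : ℝ) (x : Fin n → ℝ) :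
    pd i (ddq l t g) x = ddq l t (pd i g) x := by
  have h1 : HasFDerivAt (fun x => g (x + t • (Pi.single l 1 : Fin n → ℝ))) (fderiv ℝ g (x + t • (Pi.single l 1 : Fin n → ℝ))) x :=
    (HasFDerivAt.comp (g := g) x (hg _).hasFDerivAt ((hasFDerivAt_id x).add_const _)).congr_fderiv (ContinuousLinearMap.comp_id _)
  have h2 : HasFDerivAt (fun x => g (x - t • (Pi.single l 1 : Fin n → ℝ))) (fderiv ℝ g (x - t • (Pi.single l 1 : Fin n → ℝ))) x :=
    (HasFDerivAt.comp (g := g) x (hg _).hasFDerivAt ((hasFDerivAt_id x).sub_const _)).congr_fderiv (ContinuousLinearMap.comp_id _)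
  have h3 := ((h1.sub ((hg x).hasFDerivAt.const_mul 2)).add h2).mul_const ((t ^ 2)⁻¹)
  have : ddq l t g = fun x => (g (x + t • (Pi.single l 1 : Fin n → ℝ)) - 2 * g x + g (x - t • (Pi.single l 1 : Fin n → ℝ))) * (t^2)⁻¹ := by
    ext x; unfold ddq; rw [div_eq_mul_inv]
  rw [this]
  have e : pd i (fun x => (g (x + t • (Pi.single l 1 : Fin n → ℝ)) - 2 * g x + g (x - t • (Pi.single l 1 : Fin n → ℝ))) * (t^2)⁻¹) x = _ :=
    congrArg (fun T => T (Pi.single i 1)) h3.fderiv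
  rw [e]
  unfold ddq pd
  simp only [ContinuousLinearMap.add_apply, ContinuousLinearMap.smul_apply, ContinuousLinearMap.sub_apply, smul_eq_mul]
  rw [div_eq_mul_inv]; ring

/-- Second difference approximation of the Laplacian. -/
noncomputable def wt {n : ℕ} (U : (Fin n → ℝ) → ℝ) (c t : ℝ) : (Fin n → ℝ) → ℝ := fun x => ∑ l, ddq l t U x + c

theorem wt_contDiff {n : ℕ} {r : WithTop ℕ∞} {U : (Fin n → ℝ) → ℝ} (hU : ContDiff ℝ r U) (c t : ℝ) : ContDiff ℝ r (wt U c t) := by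
  unfold wt
  exact (ContDiff.sum fun l _ => contDiff_ddq hU l t).add contDiff_const

theorem pd_wt {n : ℕ} {U : (Fin n → ℝ) → ℝ} (hU : Differentiable ℝ U) (c t : ℝ) (i : Fin n) :
    pd i (wt U c t) = wt (pd i U) 0 t := by
  ext x
  have hd : ∀ l, DifferentiableAt ℝ (ddq l t U) x := fun l => by
    unfold ddq
    have h1 : Differentiable ℝ fun x => U (x + t • (Pi.single l 1 : Fin n → ℝ)) := hU.comp (differentiable_id.add_const _)
    have h2 : Differentiable ℝ fun x => U (x - t • (Pi.single l 1 : Fin n → ℝ)) := hU.comp (differentiable_id.sub_const _)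
    have h3 : Differentiable ℝ fun x => U (x + t • (Pi.single l 1 : Fin n → ℝ)) - 2 * U x + U (x - t • (Pi.single l 1 : Fin n → ℝ)) :=
      (h1.sub (hU.const_mul 2)).add h2
    simp only [div_eq_mul_inv]
    exact (h3 x).mul_const _
  have : HasFDerivAt (wt U c t) (∑ l, fderiv ℝ (ddq l t U) x) x := 
    (HasFDerivAt.fun_sum fun l _ => (hd l).hasFDerivAt).add_const c
  have e : pd i (wt U c t) x = _ := congrArg (fun T => T (Pi.single i 1)) this.fderiv
  rw [e]
  unfold wt
  simp only [ContinuousLinearMap.sum_apply, add_zero]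
  exact Finset.sum_congr rfl fun l _ => pd_ddq hU i l t x

theorem wt_approx {n : ℕ} {U : (Fin n → ℝ) → ℝ} (hU : ContDiff ℝ 2 U) (hc : HasCompactSupport U) (c : ℝ) {ε : ℝ} (hε : 0 < ε) :
    ∃ τ > 0, ∀ t, 0 < t → t < τ → ∀ x, |wt U c t x - (lapl U x + c)| ≤ ε := by
  have huc : ∀ l, UniformContinuous (pd l (pd l U)) := fun l => by
    have h1 : ContDiff ℝ 1 (pd l U) := contDiff_pd hU (by norm_num) l
    exact (pd_hasCompactSupport (pd_hasCompactSupport hc l) l).uniformContinuous_of_continuous (pd_cont h1 l)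
  set ε' := ε / (2 * ((n:ℝ) + 1)) with hε'
  have hε0 : 0 < ε' := by positivity
  choose δ hδ hh using fun l => Metric.uniformContinuous_iff.1 (huc l) ε' hε0
  obtain ⟨τ, hτ, hτ2⟩ : ∃ τ > 0, ∀ l, τ ≤ δ l := by
    rcases Nat.eq_zero_or_pos n with h0 | hn
    · subst h0; exact ⟨1, one_pos, fun l => l.elim0⟩
    · haveI : Nonempty (Fin n) := ⟨⟨0, hn⟩⟩
      obtain ⟨l0, hl0⟩ := Finite.exists_min δ
      exact ⟨δ l0, hδ l0, hl0⟩
  refine ⟨τ, hτ, fun t ht htt x => ?_⟩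
  have : wt U c t x - (lapl U x + c) = ∑ l, (ddq l t U x - pd l (pd l U) x) := by
    unfold wt lapl; rw [Finset.sum_sub_distrib]; ring
  rw [this]
  refine (Finset.abs_sum_le_sum_abs _ _).trans ?_
  have h2 : ∀ l ∈ Finset.univ, |ddq l t U x - pd l (pd l U) x| ≤ 2 * ε' := fun l _ => by
    refine ddq_approx hU l ht fun y hy => ?_
    have := hh l (a := y) (b := x) (by rw [dist_eq_norm]; exact hy.trans_lt (htt.trans_le (hτ2 l)))
    rw [Real.dist_eq] at this; exact this.le
  refine (Finset.sum_le_card_nsmul _ _ _ h2).trans ?_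
  simp only [Finset.card_univ, Fintype.card_fin, nsmul_eq_mul]
  rw [hε']
  have : (n:ℝ) * (2 * (ε / (2 * ((n:ℝ) + 1)))) = ε * (n / (n+1)) := by field_simp
  rw [this]
  exact mul_le_of_le_one_right hε.le ((div_le_one (by positivity)).2 (by linarith))

/-- The one-jet. -/
noncomputable def Jt {n : ℕ} (U : (Fin n → ℝ) → ℝ) (x : Fin n → ℝ) : (Fin n → ℝ) × ℝ × (Fin n → ℝ) := (x, U x, grad U x)

noncomputable def Gv {n : ℕ} (H : ((Fin n → ℝ) × ℝ × (Fin n → ℝ)) → ℝ) (U : (Fin n → ℝ) → ℝ) (x : Fin n → ℝ) (j : Fin n) : ℝ :=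
  fderiv ℝ H (Jt U x) (0, 0, Pi.single j 1)

noncomputable def bv {n : ℕ} (H : ((Fin n → ℝ) × ℝ × (Fin n → ℝ)) → ℝ) (U : (Fin n → ℝ) → ℝ) (x : Fin n → ℝ) (i : Fin n) : ℝ :=
  fderiv ℝ H (Jt U x) (Pi.single i 1, pd i U x, 0) + H (Jt U x) * Gv H U x i

theorem jet_lip {n : ℕ} {U : (Fin n → ℝ) → ℝ} (hU : ContDiff ℝ 2 U) {x : Fin n → ℝ} {r M B : ℝ} (hM : 0 ≤ M) (hB : 0 ≤ B)
    (h1 : ∀ y ∈ ball x r, ∀ i, |pd i U y| ≤ M) (h2 : ∀ y ∈ ball x r, ∀ i j, |pd i (pd j U) y| ≤ B) :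
    ∀ y ∈ ball x r, ∀ z ∈ ball x r, ‖Jt U y - Jt U z‖ ≤ (1 + n * M + n * B) * ‖y - z‖ := by
  intro y hy z hz
  have a := lip_of_pd (fun y _ => (hU.differentiable (by norm_num)) y) h1 y hy z hz
  have b := fun j => lip_of_pd (g := pd j U) (fun y _ => ((contDiff_pd (s := 1) hU (by norm_num) j).differentiable (by norm_num)) y)
    (fun y hy i => h2 y hy i j) y hy z hz
  have p1 : 0 ≤ (n:ℝ) * M * ‖y - z‖ := by positivity
  have p2 : 0 ≤ (n:ℝ) * B * ‖y - z‖ := by positivity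
  have p3 := norm_nonneg (y - z)
  refine norm_prod_le_iff.2 ⟨?_, norm_prod_le_iff.2 ⟨?_, ?_⟩⟩
  · change ‖y - z‖ ≤ _; nlinarith
  · change |U y - U z| ≤ _; nlinarith
  · change ‖grad U y - grad U z‖ ≤ _
    refine (pi_norm_le_iff_of_nonneg (by positivity)).2 fun j => ?_
    change |pd j U y - pd j U z| ≤ _
    have := b j
    nlinarith

theorem jet_hasFDerivAt {n : ℕ} {U : (Fin n → ℝ) → ℝ} (hU : ContDiff ℝ 2 U) (x : Fin n → ℝ) :
    HasFDerivAt (Jt U) ((ContinuousLinearMap.id ℝ _).prod ((fderiv ℝ U x).prod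
      (ContinuousLinearMap.pi fun j => fderiv ℝ (pd j U) x))) x := by
  refine (hasFDerivAt_id x).prodMk (HasFDerivAt.prodMk ((hU.differentiable (by norm_num)) x).hasFDerivAt ?_)
  exact hasFDerivAt_pi.2 fun j => (((contDiff_pd (s := 1) hU (by norm_num) j).differentiable (by norm_num)) x).hasFDerivAt

theorem clm_vec {n : ℕ} (T : ((Fin n → ℝ) × ℝ × (Fin n → ℝ)) →L[ℝ] ℝ) (v : Fin n → ℝ) :
    T (0, 0, v) = ∑ j, v j * T (0, 0, Pi.single j 1) := by
  have : ((0, 0, v) : (Fin n → ℝ) × ℝ × (Fin n → ℝ)) = ∑ j, v j • ((0, 0, Pi.single j 1) : (Fin n → ℝ) × ℝ × (Fin n → ℝ)) := by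
    refine Prod.ext ?_ (Prod.ext ?_ ?_)
    · simp [Prod.fst_sum]
    · simp [Prod.snd_sum, Prod.fst_sum]
    · simp only [Prod.snd_sum, Prod.smul_snd]
      exact pi_eq_sum_univ' v
  rw [this, map_sum]
  exact Finset.sum_congr rfl fun j _ => by rw [map_smul, smul_eq_mul]

theorem pd_jet {n : ℕ} {U h : (Fin n → ℝ) → ℝ} (hU : ContDiff ℝ 2 U) {H : ((Fin n → ℝ) × ℝ × (Fin n → ℝ)) → ℝ} {x : Fin n → ℝ}
    (hH : DifferentiableAt ℝ H (Jt U x)) (he : h =ᶠ[nhds x] fun y => H (Jt U y)) (i : Fin n) :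
    pd i h x = fderiv ℝ H (Jt U x) (Pi.single i 1, pd i U x, fun j => pd i (pd j U) x) := by
  have h1 := hH.hasFDerivAt.comp x (jet_hasFDerivAt hU x)
  unfold pd
  rw [he.fderiv_eq]
  have h2 : fderiv ℝ (fun y => H (Jt U y)) x = _ := h1.fderiv
  rw [h2]
  rfl

theorem pd_jet2 {n : ℕ} {U h : (Fin n → ℝ) → ℝ} (hU : ContDiff ℝ 2 U) {H : ((Fin n → ℝ) × ℝ × (Fin n → ℝ)) → ℝ} {x : Fin n → ℝ}
    (hH : DifferentiableAt ℝ H (Jt U x)) (he : h =ᶠ[nhds x] fun y => H (Jt U y)) (i : Fin n) :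
    grad h x i = ∑ l, (hess U x - h x • (1 : Matrix (Fin n) (Fin n) ℝ)) i l * Gv H U x l + bv H U x i := by
  have e1 : h x = H (Jt U x) := he.eq_of_nhds
  unfold grad
  rw [pd_jet hU hH he i]
  have e2 : ((Pi.single i 1, pd i U x, fun j => pd i (pd j U) x) : (Fin n → ℝ) × ℝ × (Fin n → ℝ)) =
      (Pi.single i 1, pd i U x, 0) + (0, 0, fun j => pd i (pd j U) x) := by simp
  rw [e2, map_add, clm_vec]
  unfold bv
  rw [← e1]
  have e3 : ∑ l, (hess U x - h x • (1 : Matrix (Fin n) (Fin n) ℝ)) i l * Gv H U x l =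
     ∑ l, pd i (pd l U) x * Gv H U x l - h x * Gv H U x i := by
    simp only [Matrix.sub_apply, sub_mul, Finset.sum_sub_distrib, Matrix.smul_apply, smul_eq_mul]
    congr 1
    rw [Finset.sum_eq_single i]
    · simp
    · intro l _ hl; simp [Matrix.one_apply_ne hl.symm]
    · simp
  rw [e3]
  unfold Gv
  ring

theorem Gv_bound {n : ℕ} {U : (Fin n → ℝ) → ℝ} {H : ((Fin n → ℝ) × ℝ × (Fin n → ℝ)) → ℝ} {K0 : Set ((Fin n → ℝ) × ℝ × (Fin n → ℝ))} {K : ℝ}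
    (hH : Ctl H K0 K) {x : Fin n → ℝ} (hx : Jt U x ∈ K0) (j : Fin n) : |Gv H U x j| ≤ K := by
  have h := hH.2.2.1 _ hx
  have := (fderiv ℝ H (Jt U x)).le_of_opNorm_le h (0, 0, Pi.single j 1)
  have e : ‖((0, 0, Pi.single j 1) : (Fin n → ℝ) × ℝ × (Fin n → ℝ))‖ = 1 := by
    simp [Prod.norm_def, Pi.norm_single]
  rw [e, mul_one] at this
  exact this

theorem norm_e2 {n : ℕ} (i : Fin n) (a : ℝ) {M : ℝ} (ha : |a| ≤ M) :
    ‖((Pi.single i 1, a, 0) : (Fin n → ℝ) × ℝ × (Fin n → ℝ))‖ ≤ 1 + M := by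
  have hM := (abs_nonneg a).trans ha
  refine norm_prod_le_iff.2 ⟨?_, norm_prod_le_iff.2 ⟨?_, ?_⟩⟩
  · change ‖(Pi.single i 1 : Fin n → ℝ)‖ ≤ _
    rw [Pi.norm_single]; simp [hM]
  · change |a| ≤ _; linarith
  · change ‖(0 : Fin n → ℝ)‖ ≤ _; rw [norm_zero]; positivity

theorem bv_bound {n : ℕ} {U : (Fin n → ℝ) → ℝ} {H : ((Fin n → ℝ) × ℝ × (Fin n → ℝ)) → ℝ} {K0 : Set ((Fin n → ℝ) × ℝ × (Fin n → ℝ))} {K M : ℝ}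
    (hK : 0 ≤ K)
    (hH : Ctl H K0 K) {x : Fin n → ℝ} (hx : Jt U x ∈ K0) (i : Fin n) (hM : |pd i U x| ≤ M) : |bv H U x i| ≤ K * (1 + M) + K * K := by
  unfold bv
  refine (abs_add_le _ _).trans (add_le_add ?_ ?_)
  · have h := hH.2.2.1 _ hx
    have := (fderiv ℝ H (Jt U x)).le_of_opNorm_le h (Pi.single i 1, pd i U x, 0)
    exact this.trans (mul_le_mul_of_nonneg_left (norm_e2 i _ hM) hK)
  · rw [abs_mul]
    exact mul_le_mul (hH.2.1 _ hx) (Gv_bound hH hx i) (abs_nonneg _) hK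

theorem bv_lip {n : ℕ} {U : (Fin n → ℝ) → ℝ} {H : ((Fin n → ℝ) × ℝ × (Fin n → ℝ)) → ℝ} {K0 : Set ((Fin n → ℝ) × ℝ × (Fin n → ℝ))} {K M : ℝ}
    (hK : 0 ≤ K) (hH : Ctl H K0 K) {y z : Fin n → ℝ} (hy : Jt U y ∈ K0) (hz : Jt U z ∈ K0) (i : Fin n) (hM : |pd i U y| ≤ M) {D : ℝ}
    (hD : ‖Jt U y - Jt U z‖ ≤ D) :
    |bv H U y i - bv H U z i| ≤ (K * (1 + M) + K + 2 * K * K) * D := by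
  have hM0 := (abs_nonneg _).trans hM
  have hD0 := (norm_nonneg _).trans hD
  have hH' := hH
  obtain ⟨_, k1, k2, k3, k4, _⟩ := hH'
  have f3 : ‖fderiv ℝ H (Jt U y) - fderiv ℝ H (Jt U z)‖ ≤ K * D := (k3 _ hy _ hz).trans (by gcongr)
  have f4 : |H (Jt U y) - H (Jt U z)| ≤ K * D := (k4 _ hy _ hz).trans (by gcongr)
  have fp : |pd i U y - pd i U z| ≤ D := by
    refine le_trans ?_ hD
    have a1 := norm_le_pi_norm (grad U y - grad U z) i
    have a2 : ‖grad U y - grad U z‖ ≤ ‖Jt U y - Jt U z‖ := (norm_snd_le (Jt U y - Jt U z).2).trans (norm_snd_le (Jt U y - Jt U z))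
    exact le_trans a1 a2
  have fG : |Gv H U y i - Gv H U z i| ≤ K * D := by
    have := (fderiv ℝ H (Jt U y) - fderiv ℝ H (Jt U z)).le_of_opNorm_le f3 (0, 0, Pi.single i 1)
    have e : ‖((0, 0, Pi.single i 1) : (Fin n → ℝ) × ℝ × (Fin n → ℝ))‖ = 1 := by
      simp [Prod.norm_def, Pi.norm_single]
    rw [e, mul_one] at this
    exact this
  have t1 : |(fderiv ℝ H (Jt U y) - fderiv ℝ H (Jt U z)) (Pi.single i 1, pd i U y, 0)| ≤ K * D * (1 + M) :=
    ((fderiv ℝ H (Jt U y) - fderiv ℝ H (Jt U z)).le_of_opNorm_le f3 _).trans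
      (mul_le_mul_of_nonneg_left (norm_e2 i _ hM) (by positivity))
  have t2 : |fderiv ℝ H (Jt U z) (0, pd i U y - pd i U z, 0)| ≤ K * D := by
    refine ((fderiv ℝ H (Jt U z)).le_of_opNorm_le (k2 _ hz) _).trans (mul_le_mul_of_nonneg_left ?_ hK)
    simpa [Prod.norm_def, hD0] using fp
  have t3 : |(H (Jt U y) - H (Jt U z)) * Gv H U y i| ≤ K * D * K := by
    rw [abs_mul]; exact mul_le_mul f4 (Gv_bound hH hy i) (abs_nonneg _) (by positivity)
  have t4 : |H (Jt U z) * (Gv H U y i - Gv H U z i)| ≤ K * (K * D) := by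
    rw [abs_mul]; exact mul_le_mul (k1 _ hz) fG (abs_nonneg _) (by positivity)
  have e : bv H U y i - bv H U z i = (fderiv ℝ H (Jt U y) - fderiv ℝ H (Jt U z)) (Pi.single i 1, pd i U y, 0)
     + fderiv ℝ H (Jt U z) (0, pd i U y - pd i U z, 0) + (H (Jt U y) - H (Jt U z)) * Gv H U y i + H (Jt U z) * (Gv H U y i - Gv H U z i) := by
    have : ((0, pd i U y - pd i U z, 0) : (Fin n → ℝ) × ℝ × (Fin n → ℝ)) = (Pi.single i 1, pd i U y, 0) - (Pi.single i 1, pd i U z, 0) := by simp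
    rw [this, map_sub, ContinuousLinearMap.sub_apply]
    unfold bv; ring
  rw [e]
  refine (abs_add_le _ _).trans ?_
  refine (add_le_add_left (abs_add_three _ _ _) _).trans ?_
  nlinarith

theorem second_jet {n : ℕ} {U : (Fin n → ℝ) → ℝ} (hU : Differentiable ℝ U) {g : ((Fin n → ℝ) × ℝ × (Fin n → ℝ)) → ℝ}
    {K0 : Set ((Fin n → ℝ) × ℝ × (Fin n → ℝ))} {K : ℝ} (hK : 0 ≤ K) (hg : Ctl g K0 K) {x : Fin n → ℝ} {t Λ c : ℝ} (ht : 0 < t)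
    (hx : Jt U x ∈ K0) (hp : ∀ l, Jt U (x + t • (Pi.single l 1 : Fin n → ℝ)) ∈ K0) (hm : ∀ l, Jt U (x - t • (Pi.single l 1 : Fin n → ℝ)) ∈ K0)
    (hpl : ∀ l, ‖Jt U (x + t • (Pi.single l 1 : Fin n → ℝ)) - Jt U x‖ ≤ Λ * t)
    (hml : ∀ l, ‖Jt U (x - t • (Pi.single l 1 : Fin n → ℝ)) - Jt U x‖ ≤ Λ * t) :
    |∑ l, (g (Jt U (x + t • (Pi.single l 1 : Fin n → ℝ))) - 2 * g (Jt U x) + g (Jt U (x - t • (Pi.single l 1 : Fin n → ℝ)))) / t ^ 2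
      - ((wt U c t x - c) * fderiv ℝ g (Jt U x) (0, 1, 0) + ∑ j, Gv g U x j * pd j (wt U c t) x)| ≤ n * (2 * K * Λ ^ 2) := by
  have key : ∀ l, |(g (Jt U (x + t • (Pi.single l 1 : Fin n → ℝ))) - 2 * g (Jt U x) + g (Jt U (x - t • (Pi.single l 1 : Fin n → ℝ)))) / t ^ 2
      - (ddq l t U x * fderiv ℝ g (Jt U x) (0, 1, 0) + ∑ j, Gv g U x j * ddq l t (pd j U) x)| ≤ 2 * K * Λ ^ 2 := by
    intro l
    have := hg.second hK hx (hp l) (hm l) (hpl l) (hml l)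
    have e : Jt U (x + t • (Pi.single l 1 : Fin n → ℝ)) - 2 • Jt U x + Jt U (x - t • (Pi.single l 1 : Fin n → ℝ)) =
        t ^ 2 • (ddq l t U x • ((0, 1, 0) : (Fin n → ℝ) × ℝ × (Fin n → ℝ)) + (0, 0, fun j => ddq l t (pd j U) x)) := by
      have ht2 : t ^ 2 ≠ 0 := by positivity
      rw [two_smul]
      refine Prod.ext ?_ (Prod.ext ?_ ?_)
      · simp [Jt]
      · simp only [Jt, Prod.snd_add, Prod.fst_add, Prod.snd_sub, Prod.fst_sub, Prod.smul_fst, Prod.smul_snd, smul_eq_mul, ddq]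
        field_simp
        push_cast; ring
      · funext j
        simp only [Jt, Prod.snd_add, Prod.snd_sub, Prod.smul_snd, Pi.add_apply, Pi.sub_apply, Pi.smul_apply, smul_eq_mul, ddq, grad]
        simp only [Pi.zero_apply]
        field_simp
        push_cast; ring
    rw [e, map_smul, map_add, map_smul, clm_vec] at this
    have e2 : (g (Jt U (x + t • (Pi.single l 1 : Fin n → ℝ))) - 2 * g (Jt U x) + g (Jt U (x - t • (Pi.single l 1 : Fin n → ℝ)))) / t ^ 2
      - (ddq l t U x * fderiv ℝ g (Jt U x) (0, 1, 0) + ∑ j, Gv g U x j * ddq l t (pd j U) x) =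
      (g (Jt U (x + t • (Pi.single l 1 : Fin n → ℝ))) - 2 * g (Jt U x) + g (Jt U (x - t • (Pi.single l 1 : Fin n → ℝ)))
       - t ^ 2 • (ddq l t U x • fderiv ℝ g (Jt U x) (0, 1, 0) + ∑ j, ddq l t (pd j U) x * fderiv ℝ g (Jt U x) (0, 0, Pi.single j 1))) / t ^ 2 := by
      have : ∑ j, Gv g U x j * ddq l t (pd j U) x = ∑ j, ddq l t (pd j U) x * fderiv ℝ g (Jt U x) (0, 0, Pi.single j 1) :=
        Finset.sum_congr rfl fun j _ => by unfold Gv; ring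
      rw [this]
      simp only [smul_eq_mul]
      field_simp
    rw [e2, abs_div, abs_of_pos (show 0 < t ^ 2 by positivity), div_le_iff₀ (by positivity)]
    refine this.trans (le_of_eq ?_)
    ring
  have e1 : ∑ j, Gv g U x j * pd j (wt U c t) x = ∑ l, ∑ j, Gv g U x j * ddq l t (pd j U) x := by
    rw [Finset.sum_comm]
    refine Finset.sum_congr rfl fun j _ => ?_
    rw [pd_wt hU]; unfold wt; rw [add_zero, Finset.mul_sum]
  have e2 : (wt U c t x - c) * fderiv ℝ g (Jt U x) (0, 1, 0) = ∑ l, ddq l t U x * fderiv ℝ g (Jt U x) (0, 1, 0) := by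
    unfold wt; rw [add_sub_cancel_right, Finset.sum_mul]
  rw [e1, e2, ← Finset.sum_add_distrib, ← Finset.sum_sub_distrib]
  refine (Finset.abs_sum_le_sum_abs _ _).trans ?_
  refine (Finset.sum_le_card_nsmul _ _ _ fun l _ => key l).trans (le_of_eq ?_)
  simp

set_option maxHeartbeats 1000000 in
theorem core_pt {n d : ℕ} (hd : d + 2 ≤ n) {K M c0 lam : ℝ} (hK : 0 ≤ K) (hM : 0 ≤ M) (hc0 : 0 < c0) (hlam : 0 ≤ lam) :
    ∃ L : ℝ, 1 ≤ L ∧ (n:ℝ) ≤ L ∧ K ≤ L ∧ K * (1 + M) + K * K ≤ L ∧ (K * (1 + M) + K + 2 * K * K) * lam ≤ L ∧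
    ∀ (A : Matrix (Fin n) (Fin n) ℝ) (f w : ℝ) (G b dh a : Fin n → ℝ), Aᵀ = A → 1/2 ≤ w →
      (∀ i m, |A i m| ≤ 2 * (1 + K) * w) → c0 ≤ f → f ≤ K → esymmMat (d+2) A = f ^ (d+2) → GammaPlus (d+2) A →
      (∀ i, |G i| ≤ K) → (∀ i, |b i| ≤ K * (1 + M) + K * K) → (∀ i, dh i = ∑ l, A i l * G l + b i) →
      (∀ a' : Fin n → ℝ, ∑ i, a' i ^ 2 ≤ L * w * qf (newtonT (d+1) A) a' a') ∧
      (∀ i m, |newtonT (d+1) A i m| ≤ L * w ^ (d+1)) ∧ (∀ i m, |newtonT d A i m| ≤ L * w ^ d) ∧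
      (∀ m, |DD A dh d m| ≤ L * w ^ d) ∧
      (d + 2) * f ^ (d+1) * (K * (w + M) + K * (∑ i, |a i|) + n * (2 * K * (lam * w) ^ 2)) +
        ((n:ℝ) - d - 1) * esymmMat (d+1) A * (K * (w + M) + n * (2 * K * (lam * w) ^ 2)) + ∑ i, |a i| ≤
        L * (∑ i, |a i| + w ^ (d+3)) := by
  obtain ⟨CF, hCF, bF⟩ := newtonT_bound (n := n) (d+1) (by omega)
  obtain ⟨CT, hCT, bT⟩ := newtonT_bound (n := n) d (by omega)
  obtain ⟨C1, hC1, b1⟩ := newtonT_bound (n := n) 1 (by omega)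
  obtain ⟨CD, hCD, bD⟩ := DD_bound (n := n) d (by omega)
  set al := 2 * (1 + K) with hal
  have hal0 : 0 ≤ al := by positivity
  set Kb := K * (1 + M) + K * K with hKb
  have hKb0 : 0 ≤ Kb := by positivity
  set ka := n * al * K + 2 * Kb with hka
  have hka0 : 0 ≤ ka := by positivity
  set E := 2 * (K * (1 + 2 * M)) + n * (2 * K * lam ^ 2) with hE
  have hE0 : 0 ≤ E := by positivity
  set l1 := C1 * al / c0 ^ (d+2)
  set l2 := CF * al ^ (d+1)
  set l3 := CT * al ^ d
  set l4 := CD * (ka * al ^ (d-1))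
  set l5 := (d + 2) * K ^ (d+1) * K
  set l6 := (d + 2) * K ^ (d+1) * E * 2 ^ (d+1) + n * l2 * E
  have p1 : 0 ≤ l1 := by positivity
  have p2 : 0 ≤ l2 := by positivity
  have p3 : 0 ≤ l3 := by positivity
  have p4 : 0 ≤ l4 := by positivity
  have p5 : 0 ≤ l5 := by positivity
  have p6 : 0 ≤ l6 := by positivity
  have p7 : 0 ≤ (K * (1 + M) + K + 2 * K * K) * lam := by positivity
  have p8 : (0:ℝ) ≤ n := by positivity
  refine ⟨1 + n + K + Kb + (K * (1 + M) + K + 2 * K * K) * lam + l1 + l2 + l3 + l4 + l5 + l6, by linarith, by linarith, by linarith,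
    by linarith, by linarith, ?_⟩
  set L := 1 + n + K + Kb + (K * (1 + M) + K + 2 * K * K) * lam + l1 + l2 + l3 + l4 + l5 + l6 with hL
  intro A f w G b dh a hA hw hAb hf0 hfK hσ gA hG hb hdh
  have hw0 : 0 < w := by linarith
  have haw : 0 ≤ al * w := by positivity
  obtain ⟨F1, F2⟩ := bF A (al * w) hA haw hAb
  obtain ⟨T1, T2⟩ := bT A (al * w) hA haw hAb
  obtain ⟨_, s1⟩ := b1 A (al * w) hA haw hAb
  have hf : 0 < f := hc0.trans_le hf0
  refine ⟨?_, ?_, ?_, ?_, ?_⟩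
  · intro a'
    have h1 := newtonT_lower (k := d+1) A hA (by omega) gA a'
    have h2 := qf_nonneg (k := d+1) A hA (by omega) gA a'
    set Q := qf (newtonT (d+1) A) a' a'
    set Z := ∑ i, a' i ^ 2 with hZ
    have hZ0 : 0 ≤ Z := Finset.sum_nonneg fun i _ => sq_nonneg _
    have h3 : c0 ^ (d+2) * Z ≤ C1 * (al * w) * Q := by
      calc c0 ^ (d+2) * Z ≤ esymmMat (d+1+1) A * Z := by
            apply mul_le_mul_of_nonneg_right _ hZ0
            rw [show d+1+1 = d+2 from rfl, hσ]; gcongr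
        _ ≤ esymmMat 1 A * Q := h1
        _ ≤ _ := by
            apply mul_le_mul_of_nonneg_right _ h2
            rw [pow_one] at s1
            exact (le_abs_self _).trans s1
    have h4 : Z ≤ l1 * w * Q := by
      have : l1 * w * Q = C1 * (al * w) * Q / c0 ^ (d+2) := by simp only [l1]; ring
      rw [this, le_div_iff₀ (by positivity)]; linarith
    refine h4.trans ?_
    have : l1 ≤ L := by linarith
    gcongr
  · intro i m
    refine (F1 i m).trans ?_
    rw [mul_pow, ← mul_assoc]
    have : l2 ≤ L := by linarith
    exact mul_le_mul_of_nonneg_right this (by positivity)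
  · intro i m
    refine (T1 i m).trans ?_
    rw [mul_pow, ← mul_assoc]
    have : l3 ≤ L := by linarith
    exact mul_le_mul_of_nonneg_right this (by positivity)
  · intro m
    have hdhb : ∀ i, |dh i| ≤ ka * w := by
      intro i
      rw [hdh i]
      refine (abs_add_le _ _).trans ?_
      have e1 : |∑ l, A i l * G l| ≤ n * (al * w * K) := by
        refine (Finset.abs_sum_le_sum_abs _ _).trans ?_
        refine (Finset.sum_le_card_nsmul _ _ (al * w * K) fun l _ => ?_).trans (le_of_eq (by simp))
        rw [abs_mul]; exact mul_le_mul (hAb i l) (hG l) (abs_nonneg _) haw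
      have e2 := hb i
      have e3 : Kb ≤ 2 * Kb * w := by nlinarith
      have e4 : ka * w = n * (al * w * K) + 2 * Kb * w := by rw [hka]; ring
      linarith
    have h1 := bD A dh (al * w) (ka * w) hA haw hAb (by positivity) hdhb m
    rcases Nat.eq_zero_or_pos d with h0 | hpos
    · subst h0
      simp only [DD, abs_zero]; positivity
    · refine h1.trans ?_
      have e : w ^ d = w * w ^ (d-1) := by rw [← pow_succ', Nat.sub_add_cancel hpos]
      have : l4 ≤ L := by linarith
      calc CD * (ka * w * (al * w) ^ (d-1)) = l4 * w ^ d := by rw [e, mul_pow]; simp only [l4]; ring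
        _ ≤ L * w ^ d := by gcongr
  · set S := ∑ i, |a i| with hS
    have hS0 : 0 ≤ S := Finset.sum_nonneg fun i _ => abs_nonneg _
    have hEw : K * (w + M) + n * (2 * K * (lam * w) ^ 2) ≤ E * w ^ 2 := by
      have : K * (w + M) ≤ 2 * (K * (1 + 2 * M)) * w ^ 2 := by
        have h1 : w + M ≤ 2 * (1 + 2 * M) * w ^ 2 := by
          have i1 : w ≤ 2 * w ^ 2 := by nlinarith
          have i2 : M ≤ 4 * M * w ^ 2 := by
            have i3 : 1 ≤ 4 * w ^ 2 := by nlinarith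
            have i4 := mul_le_mul_of_nonneg_left i3 hM
            linarith
          have e0 : 2 * (1 + 2 * M) * w ^ 2 = 2 * w ^ 2 + 4 * M * w ^ 2 := by ring
          linarith
        have h2 := mul_le_mul_of_nonneg_left h1 hK
        have e0 : 2 * (K * (1 + 2 * M)) * w ^ 2 = K * (2 * (1 + 2 * M) * w ^ 2) := by ring
        linarith
      have e0 : (n:ℝ) * (2 * K * (lam * w) ^ 2) = n * (2 * K * lam ^ 2) * w ^ 2 := by ring
      have e1 : E * w ^ 2 = 2 * (K * (1 + 2 * M)) * w ^ 2 + n * (2 * K * lam ^ 2) * w ^ 2 := by rw [hE]; ring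
      rw [e0, e1]; linarith
    have hw2 : w ^ 2 ≤ 2 ^ (d+1) * w ^ (d+3) := by
      have : (1:ℝ) ≤ (2 * w) ^ (d+1) := one_le_pow₀ (by linarith)
      rw [mul_pow] at this
      have e : w ^ (d+3) = w ^ (d+1) * w ^ 2 := by rw [← pow_add]
      rw [e, ← mul_assoc]
      exact le_mul_of_one_le_left (sq_nonneg w) this
    have hfK' : (d + 2) * f ^ (d+1) ≤ (d+2) * K ^ (d+1) := by gcongr
    have hnn : (0:ℝ) ≤ (n:ℝ) - d - 1 := by
      have : ((d + 2 : ℕ) : ℝ) ≤ n := by exact_mod_cast hd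
      push_cast at this; linarith
    have hσ1 := gA (d+1) (by omega) (by omega)
    have hσ2 : ((n:ℝ) - d - 1) * esymmMat (d+1) A ≤ n * (l2 * w ^ (d+1)) := by
      have i1 : esymmMat (d+1) A ≤ l2 * w ^ (d+1) := by
        refine ((le_abs_self _).trans F2).trans (le_of_eq ?_)
        rw [mul_pow, ← mul_assoc]
      have : (0:ℝ) ≤ d := by positivity
      exact mul_le_mul (by linarith) i1 hσ1.le p8
    have t1 : (d + 2) * f ^ (d+1) * (K * (w + M) + K * S + n * (2 * K * (lam * w) ^ 2)) ≤ l5 * S + (d + 2) * K ^ (d+1) * E * 2 ^ (d+1) * w ^ (d+3) := by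
      calc _ ≤ (d+2) * K ^ (d+1) * (K * S + E * (2 ^ (d+1) * w ^ (d+3))) := by
            apply mul_le_mul hfK' _ (by positivity) (by positivity)
            have := mul_le_mul_of_nonneg_left hw2 hE0
            linarith
        _ = _ := by simp only [l5]; ring
    have t2 : ((n:ℝ) - d - 1) * esymmMat (d+1) A * (K * (w + M) + n * (2 * K * (lam * w) ^ 2)) ≤ n * l2 * E * w ^ (d+3) := by
      calc _ ≤ n * (l2 * w ^ (d+1)) * (E * w ^ 2) := by
            apply mul_le_mul hσ2 hEw (by positivity) (by positivity)
        _ = _ := by ring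
    have t3 : l5 * S + l6 * w ^ (d+3) + S ≤ L * (S + w ^ (d+3)) := by
      have hwp : 0 ≤ w ^ (d+3) := by positivity
      have i1 : (l5 + 1) * S ≤ L * S := mul_le_mul_of_nonneg_right (by linarith) hS0
      have i2 : l6 * w ^ (d+3) ≤ L * w ^ (d+3) := mul_le_mul_of_nonneg_right (by linarith) hwp
      linarith
    have e6 : l6 * w ^ (d+3) = (d + 2) * K ^ (d+1) * E * 2 ^ (d+1) * w ^ (d+3) + n * l2 * E * w ^ (d+3) := by simp only [l6]; ring
    linarith

def Good {n : ℕ} (d : ℕ) (f H : ((Fin n → ℝ) × ℝ × (Fin n → ℝ)) → ℝ) (K0 : Set ((Fin n → ℝ) × ℝ × (Fin n → ℝ)))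
    (U h : (Fin n → ℝ) → ℝ) (C1 M : ℝ) (y : Fin n → ℝ) : Prop :=
  Jt U y ∈ K0 ∧ h y = H (Jt U y) ∧
  esymmMat (d+2) (hess U y - h y • (1 : Matrix (Fin n) (Fin n) ℝ)) = f (Jt U y) ^ (d+2) ∧
  GammaPlus (d+2) (hess U y - h y • (1 : Matrix (Fin n) (Fin n) ℝ)) ∧
  1 ≤ lapl U y + C1 ∧ (∀ i j, |pd i (pd j U) y| ≤ lapl U y + C1) ∧ ∀ i, |pd i U y| ≤ M

set_option maxHeartbeats 2000000 in
theorem core_x {n d : ℕ} (hd : d + 2 ≤ n) {K M c0 : ℝ} (hK : 0 ≤ K) (hM : 0 ≤ M) (hc0 : 0 < c0)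
    {f H : ((Fin n → ℝ) × ℝ × (Fin n → ℝ)) → ℝ} {K0 : Set ((Fin n → ℝ) × ℝ × (Fin n → ℝ))}
    (hf : Ctl f K0 K) (hH : Ctl H K0 K) (hf0 : ∀ y ∈ K0, c0 ≤ f y) {U h : (Fin n → ℝ) → ℝ} (hU : ContDiff ℝ 2 U)
    {C1 : ℝ} (hC0 : 0 ≤ C1) (hC1 : C1 ≤ M) {x : Fin n → ℝ} {r t : ℝ} (ht : 0 < t) (htr : t < r)
    (hg : ∀ y ∈ ball x r, Good d f H K0 U h C1 M y) (hv : ∀ y ∈ ball x r, lapl U y + C1 ≤ 2 * (lapl U x + C1))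
    {w : (Fin n → ℝ) → ℝ} (hwt : w = wt U C1 t) (hw : |w x - (lapl U x + C1)| ≤ 1/2) :
    1/2 ≤ w x ∧ (∀ i m, |(hess U x - h x • (1 : Matrix (Fin n) (Fin n) ℝ)) i m| ≤ 2 * (1 + K) * w x) ∧
    (∀ y ∈ ball x r, ∀ z ∈ ball x r, ‖Jt U y - Jt U z‖ ≤ (2 * (1 + n * M + 2 * n)) * w x * ‖y - z‖) ∧
    (∀ i, grad h x i = ∑ l, (hess U x - h x • (1 : Matrix (Fin n) (Fin n) ℝ)) i l * Gv H U x l + bv H U x i) ∧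
    ((n:ℝ) - d - 1) * qf (newtonT (d+1) (hess U x - h x • (1 : Matrix (Fin n) (Fin n) ℝ))) (Gv H U x) (grad w x)
      - ((n:ℝ) - d - 1) * qf (newtonT d (hess U x - h x • (1 : Matrix (Fin n) (Fin n) ℝ))) (grad w x) (bv H U x)
      - ((d + 2) * f (Jt U x) ^ (d+1) * (K * (w x + M) + K * (∑ i, |grad w x i|) + n * (2 * K * ((2 * (1 + n * M + 2 * n)) * w x) ^ 2)) +
        ((n:ℝ) - d - 1) * esymmMat (d+1) (hess U x - h x • (1 : Matrix (Fin n) (Fin n) ℝ)) * (K * (w x + M) + n * (2 * K * ((2 * (1 + n * M + 2 * n)) * w x) ^ 2)))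
      ≤ ∑ i, ∑ m, newtonT (d+1) (hess U x - h x • (1 : Matrix (Fin n) (Fin n) ℝ)) i m * pd i (pd m w) x
        - ∑ m, DD (hess U x - h x • (1 : Matrix (Fin n) (Fin n) ℝ)) (grad h x) (d+1) m * grad w x m := by
  have hr : 0 < r := ht.trans htr
  have hxr : x ∈ ball x r := mem_ball_self hr
  obtain ⟨g1, g2, g3, g4, g5, g6, g7⟩ := hg x hxr
  set v := lapl U x + C1 with hvd
  have hw' := abs_le.1 hw
  have hw12 : 1/2 ≤ w x := by linarith [hw'.1]
  have hvw : v ≤ 2 * w x := by linarith [hw'.1]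
  have n0 : (0:ℝ) ≤ n := Nat.cast_nonneg n
  set lam := 2 * (1 + (n:ℝ) * M + 2 * n) with hlam
  have hlam0 : 0 ≤ lam := by positivity
  have hJ : ∀ y ∈ ball x r, ∀ z ∈ ball x r, ‖Jt U y - Jt U z‖ ≤ lam * w x * ‖y - z‖ := by
    intro y hy z hz
    have := jet_lip hU hM (B := 2 * v) (by linarith) (fun y hy => (hg y hy).2.2.2.2.2.2)
      (fun y hy i j => ((hg y hy).2.2.2.2.2.1 i j).trans (hv y hy)) y hy z hz
    refine this.trans (mul_le_mul_of_nonneg_right ?_ (norm_nonneg _))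
    have a1 : (1 + (n:ℝ) * M) * 1 ≤ (1 + (n:ℝ) * M) * (2 * w x) := mul_le_mul_of_nonneg_left (by linarith) (by positivity)
    have a2 : (n:ℝ) * (2 * v) ≤ n * (2 * (2 * w x)) := mul_le_mul_of_nonneg_left (by linarith) n0
    rw [hlam]; linarith
  have hpB : ∀ l, x + t • (Pi.single l 1 : Fin n → ℝ) ∈ ball x r := fun l => by
    rw [mem_ball, dist_eq_norm, add_sub_cancel_left, norm_single, abs_of_pos ht]; exact htr
  have hmB : ∀ l, x - t • (Pi.single l 1 : Fin n → ℝ) ∈ ball x r := fun l => by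
    rw [mem_ball, dist_eq_norm, sub_sub_cancel_left, norm_neg, norm_single, abs_of_pos ht]; exact htr
  have hpl : ∀ l, ‖Jt U (x + t • (Pi.single l 1 : Fin n → ℝ)) - Jt U x‖ ≤ (lam * w x) * t := fun l => by
    have := hJ _ (hpB l) _ hxr
    rwa [add_sub_cancel_left, norm_single, abs_of_pos ht] at this
  have hml : ∀ l, ‖Jt U (x - t • (Pi.single l 1 : Fin n → ℝ)) - Jt U x‖ ≤ (lam * w x) * t := fun l => by
    have := hJ _ (hmB l) _ hxr
    rwa [sub_sub_cancel_left, norm_neg, norm_single, abs_of_pos ht] at this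
  have hU1 : Differentiable ℝ U := hU.differentiable (by norm_num)
  have he : h =ᶠ[nhds x] fun y => H (Jt U y) := by
    filter_upwards [ball_mem_nhds x hr] with y hy using (hg y hy).2.1
  have hdh := pd_jet2 hU (hH.1 _ g1) he
  have hsm := fun y => augm_symm (w := U) (x := y) hU.contDiffAt (h y)
  have hT : ∀ {g : ((Fin n → ℝ) × ℝ × (Fin n → ℝ)) → ℝ}, Ctl g K0 K → |(wt U C1 t x - C1) * fderiv ℝ g (Jt U x) (0, 1, 0)| ≤ K * (w x + M) := by
    intro g hg'
    have h1 := (fderiv ℝ g (Jt U x)).le_of_opNorm_le (hg'.2.2.1 _ g1) (0, 1, 0)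
    have e : ‖((0, 1, 0) : (Fin n → ℝ) × ℝ × (Fin n → ℝ))‖ = 1 := by simp [Prod.norm_def]
    rw [e, mul_one, Real.norm_eq_abs] at h1
    rw [abs_mul, mul_comm K]
    refine mul_le_mul ?_ h1 (abs_nonneg _) (by linarith)
    rw [← hwt]
    rw [abs_le]; constructor <;> linarith
  have sf := second_jet (c := C1) hU1 hK hf ht g1 (fun l => (hg _ (hpB l)).1) (fun l => (hg _ (hmB l)).1) hpl hml
  have sH := second_jet (c := C1) hU1 hK hH ht g1 (fun l => (hg _ (hpB l)).1) (fun l => (hg _ (hmB l)).1) hpl hml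
  have tf := abs_le.1 (hT hf)
  have tH := abs_le.1 (hT hH)
  rw [← hwt] at sf sH tf tH
  have sf' := abs_le.1 sf
  have sH' := abs_le.1 sH
  have hGf : |∑ j, Gv f U x j * pd j w x| ≤ K * ∑ i, |grad w x i| := by
    refine (Finset.abs_sum_le_sum_abs _ _).trans ?_
    rw [Finset.mul_sum]
    refine Finset.sum_le_sum fun j _ => ?_
    rw [abs_mul]
    exact mul_le_mul_of_nonneg_right (Gv_bound hf g1 j) (abs_nonneg _)
  have hGf' := abs_le.1 hGf
  refine ⟨hw12, ?_, hJ, hdh, ?_⟩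
  · intro i m
    have e : (hess U x - h x • (1 : Matrix (Fin n) (Fin n) ℝ)) i m = pd i (pd m U) x - h x * (1 : Matrix (Fin n) (Fin n) ℝ) i m := rfl
    rw [e]
    have b1 : |h x * (1 : Matrix (Fin n) (Fin n) ℝ) i m| ≤ K := by
      rw [abs_mul, g2]
      have : |(1 : Matrix (Fin n) (Fin n) ℝ) i m| ≤ 1 := by
        by_cases hh : i = m
        · subst hh; simp
        · simp [Matrix.one_apply_ne hh]
      calc _ ≤ K * 1 := mul_le_mul (hH.2.1 _ g1) this (abs_nonneg _) hK
        _ = K := mul_one _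
    have b2 := abs_sub (pd i (pd m U) x) (h x * (1 : Matrix (Fin n) (Fin n) ℝ) i m)
    have b3 := g6 i m
    have b4 : K * 1 ≤ K * (2 * w x) := mul_le_mul_of_nonneg_left (by linarith) hK
    linarith
  · refine X_pt hd _ (fun l => hess U (x + t • (Pi.single l 1 : Fin n → ℝ)) - h (x + t • (Pi.single l 1 : Fin n → ℝ)) • (1 : Matrix (Fin n) (Fin n) ℝ))
      (fun l => hess U (x - t • (Pi.single l 1 : Fin n → ℝ)) - h (x - t • (Pi.single l 1 : Fin n → ℝ)) • (1 : Matrix (Fin n) (Fin n) ℝ))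
      (hsm x) (fun l => hsm _) (fun l => hsm _) g4 (fun l => (hg _ (hpB l)).2.2.2.1) (fun l => (hg _ (hmB l)).2.2.2.1)
      (hc0.trans_le (hf0 _ g1)) (fun l => hc0.trans_le (hf0 _ (hg _ (hpB l)).1)) (fun l => hc0.trans_le (hf0 _ (hg _ (hmB l)).1))
      g3 (fun l => (hg _ (hpB l)).2.2.1) (fun l => (hg _ (hmB l)).2.2.1) ht
      (h := h x) (hp := fun l => h (x + t • (Pi.single l 1 : Fin n → ℝ))) (hm := fun l => h (x - t • (Pi.single l 1 : Fin n → ℝ)))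
      hdh ?_ ?_ ?_
    · intro i m
      have e : pd i (pd m w) x = wt (pd i (pd m U)) 0 t x := by
        rw [hwt, pd_wt hU1, pd_wt ((contDiff_pd (s := 1) hU (by norm_num) m).differentiable (by norm_num))]
      rw [e]
      unfold wt
      rw [add_zero]
      refine Finset.sum_congr rfl fun l _ => ?_
      unfold ddq
      simp only [Matrix.sub_apply, Matrix.smul_apply, smul_eq_mul, hess, Matrix.of_apply, sub_add_cancel]
    · linarith [sf'.1, tf.1, hGf'.1]
    · have e1 : ∀ l, h (x + t • (Pi.single l 1 : Fin n → ℝ)) = H (Jt U (x + t • (Pi.single l 1 : Fin n → ℝ))) := fun l => (hg _ (hpB l)).2.1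
      have e2 : ∀ l, h (x - t • (Pi.single l 1 : Fin n → ℝ)) = H (Jt U (x - t • (Pi.single l 1 : Fin n → ℝ))) := fun l => (hg _ (hmB l)).2.1
      simp only [e1, e2, g2]
      have e3 : ∑ m, Gv H U x m * grad w x m = ∑ m, Gv H U x m * pd m w x := rfl
      rw [e3]
      linarith [sH'.1, tH.1]

set_option maxHeartbeats 2000000 in
theorem core {n d : ℕ} (hn : 1 ≤ n) (hd : d + 2 ≤ n) {K M c0 : ℝ} (hK : 0 ≤ K) (hM : 0 ≤ M) (hc0 : 0 < c0) :
    ∃ L : ℝ, 1 ≤ L ∧ ∀ (f H : ((Fin n → ℝ) × ℝ × (Fin n → ℝ)) → ℝ) (K0 : Set ((Fin n → ℝ) × ℝ × (Fin n → ℝ)))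
      (U h : (Fin n → ℝ) → ℝ) (bb : (Fin n → ℝ) → Fin n → ℝ) (C1 : ℝ) (V S : Set (Fin n → ℝ)),
      Ctl f K0 K → Ctl H K0 K → (∀ y ∈ K0, c0 ≤ f y) → ContDiff ℝ 2 U → HasCompactSupport U → ContDiff ℝ 1 h →
      UniformContinuous bb → IsOpen V → IsCompact S → S ⊆ V → 0 ≤ C1 → C1 ≤ M →
      (∀ x ∈ V, Good d f H K0 U h C1 M x ∧ ∀ i, bb x i = bv H U x i) → ∀ ε > 0,
      ∃ w : (Fin n → ℝ) → ℝ, ContDiff ℝ 2 w ∧ (∀ x ∈ S, |w x - (lapl U x + C1)| ≤ ε) ∧ (∀ x ∈ S, 1/2 ≤ w x) ∧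
        ∀ (η : (Fin n → ℝ) → ℝ) (p : ℝ), ContDiff ℝ 1 η → HasCompactSupport η → tsupport η ⊆ S → 3/2 ≤ p →
          p * ∫ x, η x ^ 2 * (max (w x) (1/2)) ^ (p-2) * ∑ i, pd i w x ^ 2 ≤
            2 * L * Cen n d L * ∫ x, (η x ^ 2 + ∑ i, pd i η x ^ 2) * (max (w x) (1/2)) ^ (p + (d + 3 : ℝ)) := by
  set lam := 2 * (1 + (n:ℝ) * M + 2 * n) with hlam
  have n0 : (0:ℝ) ≤ n := Nat.cast_nonneg n
  have hlam0 : 0 ≤ lam := by positivity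
  obtain ⟨L, hL1, hLn, hLK, hLb, hLl, hLA⟩ := core_pt hd hK hM hc0 hlam0
  refine ⟨L, hL1, ?_⟩
  intro f H K0 U h bb C1 V S hf hH hf0 hU hUc hh hbb hV hS hSV hC0 hC1 hgood ε hε
  obtain ⟨δ1, hδ1, hδV⟩ := hS.exists_thickening_subset_open hV hSV
  have hpp : ∀ i l, Continuous (pd l (pd i U)) := fun i l => pd_cont (contDiff_pd hU (by norm_num) i) l
  have hlc : Continuous (lapl U) := by
    unfold lapl; exact continuous_finset_sum _ fun l _ => hpp l l
  have hlu : UniformContinuous (lapl U) := by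
    have : ∀ l, UniformContinuous (pd l (pd l U)) := fun l =>
      (pd_hasCompactSupport (pd_hasCompactSupport hUc l) l).uniformContinuous_of_continuous (hpp l l)
    have hcs : HasCompactSupport (lapl U) := by
      refine HasCompactSupport.intro hUc.isCompact fun x hx => ?_
      unfold lapl
      refine Finset.sum_eq_zero fun l _ => ?_
      by_contra hne
      have h1 : x ∈ tsupport (pd l (pd l U)) := subset_closure hne
      have h2 : ∀ (g : (Fin n → ℝ) → ℝ), tsupport (pd l g) ⊆ tsupport g := fun g => by
        refine closure_minimal ?_ (isClosed_tsupport g)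
        intro y hy
        by_contra hyn
        apply hy
        have : fderiv ℝ g y = 0 := by
          by_contra hf
          exact hyn (support_fderiv_subset ℝ hf)
        simp [pd, this]
      exact hx (h2 _ (h2 _ h1))
    exact hcs.uniformContinuous_of_continuous hlc
  obtain ⟨δ2, hδ2, hlu2⟩ := Metric.uniformContinuous_iff.1 hlu 1 one_pos
  set r := min δ1 δ2 with hr
  have hr0 : 0 < r := lt_min hδ1 hδ2
  have hbV : ∀ x ∈ S, ∀ y ∈ ball x r, y ∈ V := fun x hx y hy => hδV (mem_thickening_iff.2 ⟨x, hx, (mem_ball.1 hy).trans_le (min_le_left _ _)⟩)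
  have hvv : ∀ x ∈ S, ∀ y ∈ ball x r, lapl U y + C1 ≤ 2 * (lapl U x + C1) := by
    intro x hx y hy
    have h1 := hlu2 ((mem_ball.1 hy).trans_le (min_le_right _ _))
    rw [Real.dist_eq] at h1
    have h2 := (abs_lt.1 h1).2
    have h3 := (hgood x (hSV hx)).1.2.2.2.2.1
    linarith
  obtain ⟨τ, hτ, hτw⟩ := wt_approx hU hUc C1 (ε := min ε (1/2)) (lt_min hε (by norm_num))
  set t := min τ r / 2 with htd
  have hmr : 0 < min τ r := lt_min hτ hr0
  have ht0 : 0 < t := by positivity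
  have htτ : t < τ := by have := min_le_left τ r; rw [htd]; linarith
  have htr : t < r := by have := min_le_right τ r; rw [htd]; linarith
  have hwa := hτw t ht0 htτ
  set w := wt U C1 t with hw
  have hX := fun x hx => core_x hd hK hM hc0 hf hH hf0 hU hC0 hC1 ht0 htr (fun y hy => (hgood y (hbV x hx y hy)).1) (hvv x hx) hw ((hwa x).trans (min_le_right _ _))
  rw [← hlam] at hX
  set A : (Fin n → ℝ) → Matrix (Fin n) (Fin n) ℝ := fun x => hess U x - h x • (1 : Matrix (Fin n) (Fin n) ℝ) with hA
  have hAs : ∀ x, (A x)ᵀ = A x := fun x => augm_symm hU.contDiffAt _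
  have hAc : ∀ i m, Continuous fun x => A x i m := fun i m => by
    have : (fun x => A x i m) = fun x => pd i (pd m U) x - h x * (1 : Matrix (Fin n) (Fin n) ℝ) i m := rfl
    rw [this]
    exact (hpp m i).sub (hh.continuous.mul continuous_const)
  have hNc : ∀ j, j ≤ n → ∀ i m, Continuous fun x => newtonT j (A x) i m := fun j hj i m =>
    ((newtonT_contDiff (r := 0) hAs (fun i m => contDiff_zero.2 (hAc i m)) j hj).1 i m).continuous
  have hgh : ∀ i, Continuous fun x => grad h x i := fun i => pd_cont hh i
  have hw2 : ContDiff ℝ 2 w := wt_contDiff hU C1 t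
  obtain ⟨TB, hTB0, hTB⟩ : ∃ TB : ℝ, 0 ≤ TB ∧ ∀ x ∈ S, ∀ i m, |newtonT d (A x) i m| ≤ TB := by
    choose B hB using fun (im : Fin n × Fin n) => hS.exists_bound_of_continuousOn (hNc d (by omega) im.1 im.2).continuousOn
    refine ⟨∑ im, |B im|, Finset.sum_nonneg fun _ _ => abs_nonneg _, fun x hx i m => ?_⟩
    exact ((hB (i, m) x hx).trans (le_abs_self _)).trans (Finset.single_le_sum (f := fun im => |B im|) (fun _ _ => abs_nonneg _) (Finset.mem_univ (i, m)))
  set c := (n:ℝ) - d - 1 with hc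
  have hc0' : 0 ≤ c := by
    have : ((d + 2 : ℕ) : ℝ) ≤ n := Nat.cast_le.2 hd
    push_cast at this; rw [hc]; linarith
  have hcL : c ≤ L := by
    have : (0:ℝ) ≤ d := Nat.cast_nonneg d
    rw [hc]; linarith
  set ε1 := 1 / (c * TB * n + 1) with hε1
  have hε10 : 0 < ε1 := by positivity
  have hε1b : c * TB * n * ε1 ≤ 1 := by
    rw [hε1, mul_one_div, div_le_one (by positivity)]; linarith
  obtain ⟨δ3, hδ3, hbu⟩ := Metric.uniformContinuous_iff.1 hbb ε1 hε10
  obtain ⟨N, hN⟩ := exists_nat_one_div_lt (lt_min hr0 hδ3)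
  have hNr : 1 / ((N:ℝ) + 1) < r := hN.trans_le (min_le_left _ _)
  have hNδ : 1 / ((N:ℝ) + 1) < δ3 := hN.trans_le (min_le_right _ _)
  have hbbc : ∀ m, Continuous fun x => bb x m := fun m => (continuous_apply m).comp hbb.continuous
  set b : (Fin n → ℝ) → Fin n → ℝ := fun x m => mol N (fun y => bb y m) x with hb
  have hbd : ∀ x m, |b x m - bb x m| ≤ ε1 := fun x m => by
    refine mol_dist N (hbbc m) hε10.le fun y hy => ?_
    have h1 := hbu ((mem_ball.1 hy).trans hNδ)
    exact ((dist_le_pi_dist (bb y) (bb x) m).trans h1.le)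
  have hcore : ∀ x ∈ S, _ := fun x hx => hLA (A x) (f (Jt U x)) (w x) (Gv H U x) (bv H U x) (grad h x) (grad w x) (hAs x)
    (hX x hx).1 (hX x hx).2.1 (hf0 _ (hgood x (hSV hx)).1.1) ((le_abs_self _).trans (hf.2.1 _ (hgood x (hSV hx)).1.1))
    (hgood x (hSV hx)).1.2.2.1 (hgood x (hSV hx)).1.2.2.2.1 (Gv_bound hH (hgood x (hSV hx)).1.1)
    (fun i => bv_bound hK hH (hgood x (hSV hx)).1.1 i ((hgood x (hSV hx)).1.2.2.2.2.2.2 i)) (hX x hx).2.2.2.1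
  refine ⟨w, hw2, fun x _ => (hwa x).trans (min_le_left _ _), fun x hx => (hX x hx).1, ?_⟩
  intro η p hη hηc hηS hp
  refine energy_int hn d (F := fun x => newtonT (d+1) (A x)) (T := fun x => newtonT d (A x)) (D1 := fun x => DD (A x) (grad h x) (d+1))
    (D2 := fun x => DD (A x) (grad h x) d) (hNc (d+1) (by omega)) (DD_cont hAs hgh hAc (d+1) (by omega)) (hNc d (by omega)) (DD_cont hAs hgh hAc d (by omega))
    (fun ψ m hψ hψc => weak_div hU hUc hh hψ hψc (d+1) (by omega) m) (fun ψ m hψ hψc => weak_div hU hUc hh hψ hψc d (by omega) m)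
    hw2 hη hηc hηS (b := b) (G := Gv H U) (fun m => (mol_contDiff N (hbbc m)).of_le (by norm_num)) (c := c) hp hc0' hcL hL1
    (fun x hx => (hX x hx).1) (fun x _ => newtonT_symm _ (hAs x) (by omega)) (fun x hx a => qf_nonneg (k := d+1) _ (hAs x) (by omega) (hgood x (hSV hx)).1.2.2.2.1 a)
    (fun x hx => (hcore x hx).1) (fun x hx => (hcore x hx).2.1) (fun x hx => (hcore x hx).2.2.1) (fun x hx => (hcore x hx).2.2.2.1)
    (fun x hx i => (Gv_bound hH (hgood x (hSV hx)).1.1 i).trans hLK) ?_ ?_ ?_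
  · intro x hx i
    refine (mol_bound N (hbbc i) (by positivity) fun y hy => ?_).trans hLb
    have hy' := hgood y (hbV x hx y (ball_subset_ball hNr.le hy))
    rw [hy'.2 i]
    exact bv_bound hK hH hy'.1.1 i (hy'.1.2.2.2.2.2.2 i)
  · intro x hx i m
    have hwx := (hX x hx).1
    have key : |pd i (mol N (fun y => bb y m)) x| ≤ ((K * (1 + M) + K + 2 * K * K) * lam) * w x := by
      refine mol_lip N (hbbc m) (by positivity) hNr (fun y hy z hz => ?_) i
      have hy' := hgood y (hbV x hx y hy)
      have hz' := hgood z (hbV x hx z hz)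
      have := bv_lip hK hH hy'.1.1 hz'.1.1 m (hy'.1.2.2.2.2.2.2 m) ((hX x hx).2.2.1 y hy z hz)
      simp only [hy'.2 m, hz'.2 m]
      refine this.trans (le_of_eq ?_)
      ring
    exact key.trans (mul_le_mul_of_nonneg_right hLl (by linarith))
  · intro x hx
    have h1 := (hX x hx).2.2.2.2
    have h2 := (hcore x hx).2.2.2.2
    have h3 : |qf (newtonT d (A x)) (grad w x) (fun m => b x m - bv H U x m)| ≤ TB * ((∑ i, |grad w x i|) * ∑ m, |b x m - bv H U x m|) :=
      qf_abs_le _ (hTB x hx) _ _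
    have h4 : ∑ m, |b x m - bv H U x m| ≤ n * ε1 := by
      refine (Finset.sum_le_sum fun m _ => ?_).trans (by simp : ∑ m : Fin n, ε1 ≤ n * ε1)
      rw [← (hgood x (hSV hx)).2 m]; exact hbd x m
    have h5 : qf (newtonT d (A x)) (grad w x) (fun m => b x m - bv H U x m) = qf (newtonT d (A x)) (grad w x) (b x) - qf (newtonT d (A x)) (grad w x) (bv H U x) := by
      unfold qf
      simp only [mul_sub, Finset.sum_sub_distrib]
    have hs0 : 0 ≤ ∑ i, |grad w x i| := Finset.sum_nonneg fun _ _ => abs_nonneg _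
    have h6 : c * |qf (newtonT d (A x)) (grad w x) (b x) - qf (newtonT d (A x)) (grad w x) (bv H U x)| ≤ ∑ i, |grad w x i| := by
      rw [← h5]
      calc _ ≤ c * (TB * ((∑ i, |grad w x i|) * (n * ε1))) := by
            refine mul_le_mul_of_nonneg_left (h3.trans ?_) hc0'
            gcongr
        _ = (c * TB * n * ε1) * ∑ i, |grad w x i| := by ring
        _ ≤ 1 * _ := mul_le_mul_of_nonneg_right hε1b hs0
        _ = _ := one_mul _
    have h7 : c * (qf (newtonT d (A x)) (grad w x) (bv H U x) - qf (newtonT d (A x)) (grad w x) (b x)) ≤ ∑ i, |grad w x i| := by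
      refine (mul_le_mul_of_nonneg_left ?_ hc0').trans h6
      rw [abs_sub_comm]; exact le_abs_self _
    have e1 : ∑ i, |pd i w x| = ∑ i, |grad w x i| := rfl
    have e2 : ∑ m, DD (A x) (grad h x) (d+1) m * pd m w x = ∑ m, DD (A x) (grad h x) (d+1) m * grad w x m := rfl
    rw [e1, e2]
    simp only [mul_sub] at h7
    linarith

theorem cut_contDiff {n : ℕ} {r : WithTop ℕ∞} {χ g : (Fin n → ℝ) → ℝ} {Ω : Set (Fin n → ℝ)} (hχ : ContDiff ℝ r χ)
    (hΩ : IsOpen Ω) (hg : ContDiffOn ℝ r g Ω) (hs : tsupport χ ⊆ Ω) : ContDiff ℝ r (fun x => χ x * g x) := by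
  rw [contDiff_iff_contDiffAt]
  intro x
  by_cases hx : x ∈ Ω
  · exact hχ.contDiffAt.mul (hg.contDiffAt (hΩ.mem_nhds hx))
  · have h1 := notMem_tsupport_iff_eventuallyEq.1 (fun h => hx (hs h))
    have h2 : (fun x => χ x * g x) =ᶠ[nhds x] fun _ => 0 := by
      filter_upwards [h1] with y hy
      rw [hy]; simp
    exact contDiffAt_const.congr_of_eventuallyEq h2

theorem entry_le_matNorm {n : ℕ} (A : Matrix (Fin n) (Fin n) ℝ) (i j : Fin n) : |A i j| ≤ matNorm A := by
  have h1 := ContinuousLinearMap.le_opNorm (LinearMap.toContinuousLinearMap (Matrix.toEuclideanLin A)) (EuclideanSpace.single j (1:ℝ))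
  rw [EuclideanSpace.norm_single, norm_one, mul_one] at h1
  have h2 := PiLp.norm_apply_le ((LinearMap.toContinuousLinearMap (Matrix.toEuclideanLin A)) (EuclideanSpace.single j (1:ℝ))) i
  have e : ((LinearMap.toContinuousLinearMap (Matrix.toEuclideanLin A)) (EuclideanSpace.single j (1:ℝ))) i = A i j := by
    simp [Matrix.toLpLin_apply]
  rw [e, Real.norm_eq_abs] at h2
  exact h2.trans h1

theorem abs_le_vnorm {n : ℕ} (a : Fin n → ℝ) (i : Fin n) : |a i| ≤ vnorm a := by
  unfold vnorm
  apply Real.abs_le_sqrt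
  exact Finset.single_le_sum (f := fun i => a i ^ 2) (fun _ _ => sq_nonneg _) (Finset.mem_univ i)

theorem pd_contDiffOn {n : ℕ} {r s : WithTop ℕ∞} {u : (Fin n → ℝ) → ℝ} {Ω : Set (Fin n → ℝ)} (hΩ : IsOpen Ω) (hu : ContDiffOn ℝ r u Ω)
    (hs : s + 1 ≤ r) (i : Fin n) : ContDiffOn ℝ s (pd i u) Ω := by
  unfold pd
  exact (hu.fderiv_of_isOpen hΩ hs).clm_apply contDiffOn_const

theorem Jt_contDiffOn {n : ℕ} {u : (Fin n → ℝ) → ℝ} {Ω : Set (Fin n → ℝ)} (hΩ : IsOpen Ω) (hu : ContDiffOn ℝ 2 u Ω) :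
    ContDiffOn ℝ 1 (Jt u) Ω := by
  unfold Jt
  refine contDiffOn_id.prodMk ((hu.of_le (by norm_num)).prodMk ?_)
  unfold grad
  exact contDiffOn_pi.2 fun i => pd_contDiffOn hΩ hu (by norm_num) i

theorem Jt_congr {n : ℕ} {U u : (Fin n → ℝ) → ℝ} {x : Fin n → ℝ} (h : U =ᶠ[nhds x] u) :
    Jt U x = Jt u x ∧ (∀ i, pd i U x = pd i u x) ∧ hess U x = hess u x ∧ lapl U x = lapl u x := by
  have h1 : ∀ i, pd i U =ᶠ[nhds x] pd i u := fun i => by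
    filter_upwards [h.eventuallyEq_nhds] with y hy
    unfold pd; rw [hy.fderiv_eq]
  have h2 : ∀ i j, pd i (pd j U) x = pd i (pd j u) x := fun i j => by
    have := (h1 j).fderiv_eq (𝕜 := ℝ)
    change fderiv ℝ (pd j U) x _ = fderiv ℝ (pd j u) x _
    rw [this]
  refine ⟨?_, fun i => (h1 i).eq_of_nhds, ?_, ?_⟩
  · unfold Jt grad
    rw [h.eq_of_nhds]
    simp only [fun i => (h1 i).eq_of_nhds]
  · unfold hess; ext i j; exact h2 i j
  · unfold lapl; simp only [h2]

set_option maxHeartbeats 2000000 in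
theorem localize {n d : ℕ} (hn : 1 ≤ n) (hd : d + 2 ≤ n)
    (Ω : Set (Fin n → ℝ)) (hΩ : IsOpen Ω)
    (f : ((Fin n → ℝ) × ℝ × (Fin n → ℝ)) → ℝ)
    (hfpos : ∀ y ∈ Ω ×ˢ ((univ : Set ℝ) ×ˢ (univ : Set (Fin n → ℝ))), 0 < f y)
    (hf : C11On f (Ω ×ˢ ((univ : Set ℝ) ×ˢ (univ : Set (Fin n → ℝ)))))
    (H : ((Fin n → ℝ) × ℝ × (Fin n → ℝ)) → ℝ)
    (hH : C11On H (Ω ×ˢ ((univ : Set ℝ) ×ˢ (univ : Set (Fin n → ℝ)))))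
    (x₀ : Fin n → ℝ) (R : ℝ) (hR : 0 < R)
    (hball : closure (ball x₀ (2 * R)) ⊆ Ω)
    (M : ℝ) (hM : 0 < M) :
    ∃ L : ℝ, 1 ≤ L ∧ ∀ (u : (Fin n → ℝ) → ℝ) (C1 : ℝ),
      ContDiffOn ℝ 2 u Ω →
      (∀ x ∈ Ω,
        esymmMat (d+2) (hess u x - H (x, u x, grad u x) • (1 : Matrix (Fin n) (Fin n) ℝ)) = f (x, u x, grad u x) ^ (d+2) ∧
        GammaPlus (d+2) (hess u x - H (x, u x, grad u x) • (1 : Matrix (Fin n) (Fin n) ℝ))) →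
      0 ≤ C1 → C1 ≤ M →
      (∀ x ∈ ball x₀ (2 * R), 1 ≤ lapl u x + C1 ∧ matNorm (hess u x) ≤ lapl u x + C1) →
      (∀ x ∈ ball x₀ (2 * R), |u x| + vnorm (grad u x) ≤ M) → ∀ ε > 0,
      ∃ w : (Fin n → ℝ) → ℝ, ContDiff ℝ 2 w ∧ (∀ x ∈ closedBall x₀ (5/3*R), |w x - (lapl u x + C1)| ≤ ε) ∧ (∀ x ∈ closedBall x₀ (5/3*R), 1/2 ≤ w x) ∧
        ∀ (η : (Fin n → ℝ) → ℝ) (p : ℝ), ContDiff ℝ 1 η → HasCompactSupport η → tsupport η ⊆ closedBall x₀ (5/3*R) → 3/2 ≤ p →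
          p * ∫ x, η x ^ 2 * (max (w x) (1/2)) ^ (p-2) * ∑ i, pd i w x ^ 2 ≤
            2 * L * Cen n d L * ∫ x, (η x ^ 2 + ∑ i, pd i η x ^ 2) * (max (w x) (1/2)) ^ (p + (d + 3 : ℝ)) := by
  set D : Set ((Fin n → ℝ) × ℝ × (Fin n → ℝ)) := Ω ×ˢ ((univ : Set ℝ) ×ˢ (univ : Set (Fin n → ℝ))) with hDd
  have hD : IsOpen D := hΩ.prod (isOpen_univ.prod isOpen_univ)
  rw [closure_ball x₀ (by positivity)] at hball
  set K0 : Set ((Fin n → ℝ) × ℝ × (Fin n → ℝ)) := closedBall x₀ (2*R) ×ˢ (closedBall (0:ℝ) M ×ˢ closedBall (0 : Fin n → ℝ) M) with hK0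
  have hK0c : IsCompact K0 := (isCompact_closedBall _ _).prod ((isCompact_closedBall _ _).prod (isCompact_closedBall _ _))
  have hK0v : Convex ℝ K0 := (convex_closedBall _ _).prod ((convex_closedBall _ _).prod (convex_closedBall _ _))
  have hK0D : K0 ⊆ D := fun y hy => ⟨hball hy.1, mem_univ _, mem_univ _⟩
  obtain ⟨Kf, hKf, cf⟩ := ctl_of_c11 hD hf hK0c hK0v hK0D
  obtain ⟨KH, hKH, cH⟩ := ctl_of_c11 hD hH hK0c hK0v hK0D
  replace cf := cf.mono (show Kf ≤ Kf + KH by linarith)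
  replace cH := cH.mono (show KH ≤ Kf + KH by linarith)
  have hK : 0 ≤ Kf + KH := by positivity
  obtain ⟨c0, hc0, hfc⟩ : ∃ c0 > 0, ∀ y ∈ K0, c0 ≤ f y := by
    have hne : K0.Nonempty := ⟨(x₀, 0, 0), mem_closedBall_self (by positivity), mem_closedBall_self hM.le, mem_closedBall_self hM.le⟩
    obtain ⟨y, hy, hmin⟩ := hK0c.exists_isMinOn hne (hf.1.continuousOn.mono hK0D)
    exact ⟨f y, hfpos y (hK0D hy), fun z hz => hmin hz⟩
  obtain ⟨L, hL, hcore⟩ := core (d := d) hn hd hK hM.le hc0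
  refine ⟨L, hL, ?_⟩
  intro u C1 hu heq hC0 hC1 hlap hgr ε hε
  obtain ⟨χ, hχ, hχ1, hχs, -, -⟩ := cutoff x₀ (r := 11/6*R) (δ := 1/12*R) (by positivity)
  have hχΩ : tsupport χ ⊆ Ω := hχs.trans ((closedBall_subset_closedBall (by linarith)).trans hball)
  have hχc : HasCompactSupport χ := (isCompact_closedBall _ _).of_isClosed_subset (isClosed_tsupport _) hχs
  have hJ := Jt_contDiffOn hΩ hu
  have hmap : MapsTo (Jt u) Ω D := fun x hx => ⟨hx, mem_univ _, mem_univ _⟩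
  have hU : ContDiff ℝ 2 (fun x => χ x * u x) := cut_contDiff (hχ.of_le (by norm_num)) hΩ hu hχΩ
  have hh : ContDiff ℝ 1 (fun x => χ x * H (Jt u x)) := cut_contDiff (hχ.of_le (by norm_num)) hΩ (hH.1.comp hJ hmap) hχΩ
  have hfdH : ContinuousOn (fun x => fderiv ℝ H (Jt u x)) Ω :=
    ((hH.1.fderiv_of_isOpen hD (m := 0) (by norm_num)).continuousOn).comp hJ.continuousOn hmap
  have hbvc : ∀ i, ContinuousOn (fun x => bv H u x i) Ω := fun i => by
    unfold bv Gv
    refine (hfdH.clm_apply ?_).add (((hH.1.comp hJ hmap).continuousOn).mul (hfdH.clm_apply continuousOn_const))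
    exact continuousOn_const.prodMk (((pd_contDiffOn (s := 0) hΩ hu (by norm_num) i).continuousOn).prodMk continuousOn_const)
  have hbb : UniformContinuous (fun x i => χ x * bv H u x i) := by
    refine uniformContinuous_pi.2 fun i => ?_
    have h1 : Continuous (fun x => χ x * bv H u x i) :=
      (cut_contDiff (r := 0) (hχ.of_le (by norm_num)) hΩ (contDiffOn_zero.2 (hbvc i)) hχΩ).continuous
    exact HasCompactSupport.uniformContinuous_of_continuous hχc.mul_right h1
  have hev : ∀ x ∈ ball x₀ (11/6*R), (fun x => χ x * u x) =ᶠ[nhds x] u := fun x hx => by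
    filter_upwards [isOpen_ball.mem_nhds hx] with y hy
    rw [hχ1 y hy, one_mul]
  have hVb : ball x₀ (11/6*R) ⊆ ball x₀ (2*R) := ball_subset_ball (by linarith)
  have hSV : closedBall x₀ (5/3*R) ⊆ ball x₀ (11/6*R) := closedBall_subset_ball (by linarith)
  have hgood : ∀ x ∈ ball x₀ (11/6*R), Good d f H K0 (fun x => χ x * u x) (fun x => χ x * H (Jt u x)) C1 M x ∧
      ∀ i, (χ x * bv H u x i) = bv H (fun x => χ x * u x) x i := by
    intro x hx
    obtain ⟨e1, e2, e3, e4⟩ := Jt_congr (hev x hx)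
    have h2 := hgr x (hVb hx)
    have h3 := hlap x (hVb hx)
    have hxO : x ∈ Ω := hball (ball_subset_closedBall (hVb hx))
    have hv0 : 0 ≤ vnorm (grad u x) := Real.sqrt_nonneg _
    have hpd : ∀ i, |pd i u x| ≤ M := fun i => (abs_le_vnorm (grad u x) i).trans (by linarith [abs_nonneg (u x)])
    have hJK : Jt u x ∈ K0 := by
      refine ⟨ball_subset_closedBall (hVb hx), ?_, ?_⟩
      · rw [mem_closedBall_zero_iff]; change |u x| ≤ M; linarith
      · rw [mem_closedBall_zero_iff]; exact (pi_norm_le_iff_of_nonneg hM.le).2 hpd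
    refine ⟨⟨?_, ?_, ?_, ?_, ?_, ?_, ?_⟩, ?_⟩
    · rw [e1]; exact hJK
    · rw [e1]; simp only [hχ1 x hx, one_mul]
    · rw [e1, e3]; simp only [hχ1 x hx, one_mul]; exact (heq x hxO).1
    · rw [e3]; simp only [hχ1 x hx, one_mul]; exact (heq x hxO).2
    · rw [e4]; exact h3.1
    · intro i j
      have : pd i (pd j fun x => χ x * u x) x = hess u x i j := by rw [← e3]; rfl
      rw [this, e4]
      exact (entry_le_matNorm _ i j).trans h3.2
    · intro i; rw [e2]; exact hpd i
    · intro i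
      unfold bv Gv
      rw [e1, e2, hχ1 x hx, one_mul]
  obtain ⟨w, hw1, hw2, hw3, hw4⟩ := hcore f H K0 _ _ _ C1 (ball x₀ (11/6*R)) (closedBall x₀ (5/3*R)) cf cH hfc hU hχc.mul_right hh hbb isOpen_ball
    (isCompact_closedBall _ _) hSV hC0 hC1 hgood ε hε
  refine ⟨w, hw1, fun x hx => ?_, hw3, hw4⟩
  rw [← (Jt_congr (hev x (hSV hx))).2.2.2]
  exact hw2 x hx

theorem Cen_nonneg {n d : ℕ} {L : ℝ} (hL : 1 ≤ L) : 0 ≤ Cen n d L := by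
  unfold Cen
  have : 0 ≤ L := by linarith
  positivity

theorem limit_pow {I J a b : ℝ} (h : ∀ ε : ℝ, 0 < ε → ε ≤ 1/2 → (1 - ε) ^ a * I ≤ (1 + ε) ^ b * J) : I ≤ J := by
  have c1 : Filter.Tendsto (fun ε : ℝ => (1 - ε) ^ a * I) (nhdsWithin 0 (Ioi 0)) (nhds I) := by
    have : ContinuousAt (fun ε : ℝ => (1 - ε) ^ a * I) 0 := by
      refine ContinuousAt.mul (ContinuousAt.rpow_const (by fun_prop) (Or.inl (by norm_num))) continuousAt_const
    have h2 := this.tendsto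
    simp only [sub_zero, Real.one_rpow, one_mul] at h2
    exact h2.mono_left nhdsWithin_le_nhds
  have c2 : Filter.Tendsto (fun ε : ℝ => (1 + ε) ^ b * J) (nhdsWithin 0 (Ioi 0)) (nhds J) := by
    have : ContinuousAt (fun ε : ℝ => (1 + ε) ^ b * J) 0 := by
      refine ContinuousAt.mul (ContinuousAt.rpow_const (by fun_prop) (Or.inl (by norm_num))) continuousAt_const
    have h2 := this.tendsto
    simp only [add_zero, Real.one_rpow, one_mul] at h2
    exact h2.mono_left nhdsWithin_le_nhds
  refine le_of_tendsto_of_tendsto c1 c2 ?_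
  filter_upwards [Ioc_mem_nhdsGT (show (0:ℝ) < 1/2 by norm_num)] with ε hε
  exact h ε hε.1 hε.2

set_option maxHeartbeats 2000000 in
/-- Sobolev step and passage to the limit for fixed data. -/
theorem finish {n : ℕ} {x₀ : Fin n → ℝ} {R ρ β q s Kc : ℝ} (hR : 0 < R) (hρ : 0 < ρ) (hρR : ρ ≤ R / 3)
    (hβ : 0 < β) (hq : 0 < q) (hs : 0 < s) (hKc : 0 ≤ Kc) {v : (Fin n → ℝ) → ℝ}
    (hvc : ContinuousOn v (closedBall x₀ (2 * R))) (hv1 : ∀ x ∈ ball x₀ (2 * R), 1 ≤ v x)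
    {η : (Fin n → ℝ) → ℝ} (hη : ContDiff ℝ 3 η) (hη1 : ∀ x ∈ ball x₀ (R + ρ), η x = 1)
    (hηs : tsupport η ⊆ closedBall x₀ (R + ρ + ρ)) (hηb : ∀ x, |η x| ≤ 1) (hηd : ∀ i x, |pd i η x| ≤ 2 / ρ)
    (hstep : ∀ ε : ℝ, 0 < ε → ε ≤ 1/2 → ∃ w : (Fin n → ℝ) → ℝ, ContDiff ℝ 2 w ∧ (∀ x ∈ closedBall x₀ (5/3*R), |w x - v x| ≤ ε) ∧
      (∫ x, |η x * w x ^ (q/2)| ^ (2*β)) ^ β⁻¹ ≤ Kc * ∫ x, (η x ^ 2 + ∑ i, pd i η x ^ 2) * (max (w x) (1/2)) ^ s) :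
    (∫ x in ball x₀ (R + ρ), v x ^ (β * q)) ^ β⁻¹ ≤ Kc * ((R ^ 2 / 9 + 4 * n) / ρ ^ 2) * ∫ x in ball x₀ (R + 3 * ρ), v x ^ s := by
  have hηc : HasCompactSupport η := (isCompact_closedBall _ _).of_isClosed_subset (isClosed_tsupport _) hηs
  have hvint : ∀ a : ℝ, 0 ≤ a → IntegrableOn (fun x => v x ^ a) (closedBall x₀ (2*R)) := fun a ha =>
    (hvc.rpow_const (fun _ _ => Or.inr ha)).integrableOn_compact (isCompact_closedBall _ _)
  have s1 : closedBall x₀ (R + ρ + ρ) ⊆ closedBall x₀ (5/3*R) := closedBall_subset_closedBall (by linarith)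
  have s2 : closedBall x₀ (5/3*R) ⊆ ball x₀ (2*R) := closedBall_subset_ball (by linarith)
  have s3 : ball x₀ (R + ρ) ⊆ closedBall x₀ (5/3*R) := ball_subset_closedBall.trans (closedBall_subset_closedBall (by linarith))
  have s4 : closedBall x₀ (R + ρ + ρ) ⊆ ball x₀ (R + 3 * ρ) := closedBall_subset_ball (by linarith)
  have s5 : ball x₀ (R + 3 * ρ) ⊆ ball x₀ (2 * R) := ball_subset_ball (by linarith)
  have hI0 : 0 ≤ ∫ x in ball x₀ (R + ρ), v x ^ (β * q) := setIntegral_nonneg measurableSet_ball fun x hx =>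
    Real.rpow_nonneg (by linarith [hv1 x (s2 (s3 hx))]) _
  have hn0 : (0:ℝ) ≤ n := Nat.cast_nonneg n
  have hJle : ∫ x in closedBall x₀ (R + ρ + ρ), v x ^ s ≤ ∫ x in ball x₀ (R + 3 * ρ), v x ^ s := by
    refine setIntegral_mono_set ((hvint s hs.le).mono_set (s5.trans ball_subset_closedBall)) ?_ (HasSubset.Subset.eventuallyLE s4)
    exact (ae_restrict_mem measurableSet_ball).mono fun x hx => Real.rpow_nonneg (by linarith [hv1 x (s5 hx)]) _
  apply limit_pow (a := q) (b := s)
  intro ε hε hε2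
  obtain ⟨w, hw, hwv, hmain⟩ := hstep ε hε hε2
  have hwl : ∀ x ∈ closedBall x₀ (5/3*R), (1 - ε) * v x ≤ w x ∧ w x ≤ (1 + ε) * v x ∧ max (w x) (1/2) = w x ∧ 0 < w x := by
    intro x hx
    have h1 := hv1 x (s2 hx)
    have h2 := abs_le.1 (hwv x hx)
    have h3 : ε * 1 ≤ ε * v x := mul_le_mul_of_nonneg_left h1 hε.le
    have h4 : 1/2 ≤ w x := by linarith
    exact ⟨by linarith, by linarith, max_eq_left h4, by linarith⟩
  have hLc : Continuous fun x => |η x * w x ^ (q/2)| ^ (2*β) := by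
    refine Continuous.rpow_const ?_ (fun _ => Or.inr (by positivity))
    exact (hη.continuous.mul (hw.continuous.rpow_const (fun _ => Or.inr (by positivity)))).abs
  have hLcs : HasCompactSupport fun x => |η x * w x ^ (q/2)| ^ (2*β) := by
    refine HasCompactSupport.intro hηc.isCompact fun x hx => ?_
    rw [image_eq_zero_of_notMem_tsupport hx, zero_mul, abs_zero, Real.zero_rpow (by positivity)]
  have hLi := hLc.integrable_of_hasCompactSupport hLcs (μ := volume)
  have hA : (1 - ε) ^ (β * q) * ∫ x in ball x₀ (R + ρ), v x ^ (β * q) ≤ ∫ x, |η x * w x ^ (q/2)| ^ (2*β) := by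
    rw [← integral_const_mul]
    refine le_trans (setIntegral_mono_on ?_ hLi.integrableOn measurableSet_ball ?_) (setIntegral_le_integral hLi ?_)
    · exact ((hvint (β*q) (by positivity)).mono_set (s3.trans (s2.trans ball_subset_closedBall))).const_mul _
    · intro x hx
      obtain ⟨w1, w2, w3, w4⟩ := hwl x (s3 hx)
      have h1 := hv1 x (s2 (s3 hx))
      rw [hη1 x hx, one_mul, abs_of_pos (Real.rpow_pos_of_pos w4 _), ← Real.rpow_mul w4.le,
        ← Real.mul_rpow (by linarith) (by linarith), show q / 2 * (2 * β) = β * q by ring]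
      exact Real.rpow_le_rpow (mul_nonneg (by linarith) (by linarith)) w1 (by positivity)
    · exact Filter.Eventually.of_forall fun x => Real.rpow_nonneg (abs_nonneg _) _
  have hB : ∫ x, (η x ^ 2 + ∑ i, pd i η x ^ 2) * (max (w x) (1/2)) ^ s ≤
      ((R ^ 2 / 9 + 4 * n) / ρ ^ 2) * ((1 + ε) ^ s * ∫ x in ball x₀ (R + 3 * ρ), v x ^ s) := by
    rw [← setIntegral_eq_integral_of_forall_compl_eq_zero (s := closedBall x₀ (R + ρ + ρ))]
    · refine le_trans ?_ (mul_le_mul_of_nonneg_left (mul_le_mul_of_nonneg_left hJle (Real.rpow_nonneg (by linarith) _)) (by positivity))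
      rw [← integral_const_mul, ← integral_const_mul]
      refine setIntegral_mono_on ?_ ?_ measurableSet_closedBall ?_
      · refine ContinuousOn.integrableOn_compact (isCompact_closedBall _ _) ?_
        refine Continuous.continuousOn ?_
        refine Continuous.mul ?_ (Continuous.rpow_const (hw.continuous.max continuous_const) (fun _ => Or.inr hs.le))
        exact (hη.continuous.pow 2).add (continuous_finset_sum _ fun i _ => (pd_cont (hη.of_le (by norm_num)) i).pow 2)
      · exact (((hvint s hs.le).mono_set (s1.trans (s2.trans ball_subset_closedBall))).const_mul _).const_mul _
      · intro x hx
        obtain ⟨w1, w2, w3, w4⟩ := hwl x (s1 hx)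
        have h1 := hv1 x (s2 (s1 hx))
        rw [w3, ← Real.mul_rpow (by linarith) (by linarith)]
        refine mul_le_mul ?_ (Real.rpow_le_rpow w4.le w2 hs.le) (Real.rpow_nonneg w4.le _) (by positivity)
        have e1 : η x ^ 2 ≤ 1 := by rw [← sq_abs]; exact pow_le_one₀ (abs_nonneg _) (hηb x)
        have e2 : ∑ i, pd i η x ^ 2 ≤ n * (2 / ρ) ^ 2 := by
          refine (Finset.sum_le_sum fun i _ => ?_).trans (by simp : ∑ i : Fin n, (2 / ρ) ^ 2 ≤ n * (2 / ρ) ^ 2)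
          rw [← sq_abs]; exact pow_le_pow_left₀ (abs_nonneg _) (hηd i x) 2
        have e3 : 1 ≤ R ^ 2 / 9 / ρ ^ 2 := by
          rw [one_le_div (by positivity)]
          have : ρ ^ 2 ≤ (R / 3) ^ 2 := pow_le_pow_left₀ hρ.le hρR 2
          linarith [show (R/3)^2 = R^2/9 by ring]
        have e4 : (R ^ 2 / 9 + 4 * n) / ρ ^ 2 = R ^ 2 / 9 / ρ ^ 2 + n * (2 / ρ) ^ 2 := by
          field_simp; ring
        rw [e4]; linarith
    · intro x hx
      have hx' : x ∉ tsupport η := fun h => hx (hηs h)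
      rw [image_eq_zero_of_notMem_tsupport hx']
      simp [pd_zero_off _ hx']
  have h1e : 0 < 1 - ε := by linarith
  calc (1 - ε) ^ q * (∫ x in ball x₀ (R + ρ), v x ^ (β * q)) ^ β⁻¹
      = ((1 - ε) ^ (β * q) * ∫ x in ball x₀ (R + ρ), v x ^ (β * q)) ^ β⁻¹ := by
        rw [Real.mul_rpow (Real.rpow_nonneg h1e.le _) hI0, ← Real.rpow_mul h1e.le]
        congr 2; field_simp
    _ ≤ (∫ x, |η x * w x ^ (q/2)| ^ (2*β)) ^ β⁻¹ := by
        refine Real.rpow_le_rpow (mul_nonneg (Real.rpow_nonneg h1e.le _) hI0) hA (by positivity)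
    _ ≤ _ := hmain
    _ ≤ Kc * (((R ^ 2 / 9 + 4 * n) / ρ ^ 2) * ((1 + ε) ^ s * ∫ x in ball x₀ (R + 3 * ρ), v x ^ s)) := mul_le_mul_of_nonneg_left hB hKc
    _ = _ := by ring

/-- Reverse Hölder inequality, scalar-`H` case (estimate (AB') in
the proof of Theorem 1.4, Case 2, for classical solutions). -/
theorem reverse_holder_scalarH
    {n : ℕ} (hn : 3 ≤ n) (k : ℕ) (hk2 : 2 ≤ k) (hkn : k ≤ n)
    (Ω : Set (Fin n → ℝ)) (hΩ : IsOpen Ω)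
    (f : ((Fin n → ℝ) × ℝ × (Fin n → ℝ)) → ℝ)
    (hfpos : ∀ y ∈ Ω ×ˢ ((univ : Set ℝ) ×ˢ (univ : Set (Fin n → ℝ))), 0 < f y)
    (hf : C11On f (Ω ×ˢ ((univ : Set ℝ) ×ˢ (univ : Set (Fin n → ℝ)))))
    (H₂ : ((Fin n → ℝ) × ℝ × (Fin n → ℝ)) → ℝ)
    (hH₂ : C11On H₂ (Ω ×ˢ ((univ : Set ℝ) ×ˢ (univ : Set (Fin n → ℝ)))))
    (x₀ : Fin n → ℝ) (R : ℝ) (hR : 0 < R)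
    (hball : closure (ball x₀ (2 * R)) ⊆ Ω)
    (M : ℝ) (hM : 0 < M) :
    ∃ C : ℝ, ∀ (u : (Fin n → ℝ) → ℝ) (C₁ q ρ : ℝ),
      ContDiffOn ℝ 2 u Ω →
      (∀ x ∈ Ω,
        esymmMat k (hess u x -
            H₂ (x, u x, grad u x) • (1 : Matrix (Fin n) (Fin n) ℝ))
          = f (x, u x, grad u x) ^ k ∧
        GammaPlus k (hess u x -
            H₂ (x, u x, grad u x) • (1 : Matrix (Fin n) (Fin n) ℝ))) →
      0 ≤ C₁ → C₁ ≤ M →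
      (∀ x ∈ ball x₀ (2 * R), 1 ≤ lapl u x + C₁ ∧ matNorm (hess u x) ≤ lapl u x + C₁) →
      (∀ x ∈ ball x₀ (2 * R), |u x| + vnorm (grad u x) ≤ M) →
      (∫ x in ball x₀ (2 * R), (lapl u x + C₁) ^ (((k : ℝ) + 1) * n / 2)) ≤ M →
      ((k : ℝ) + 1) * n / 2 - k < q →
      0 < ρ → ρ ≤ R / 3 →
      (∫ x in ball x₀ (R + ρ),
          (lapl u x + C₁) ^ ((((k : ℝ) + 1) * n / (((k : ℝ) + 1) * n - 2 * k)) * q))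
            ^ ((((k : ℝ) + 1) * n / (((k : ℝ) + 1) * n - 2 * k))⁻¹)
        ≤ C * q / ρ ^ 2 *
            ∫ x in ball x₀ (R + 3 * ρ), (lapl u x + C₁) ^ (q + (k : ℝ)) := by
  obtain ⟨d, rfl⟩ : ∃ d, k = d + 2 := ⟨k - 2, by omega⟩
  have hk' : (2:ℝ) ≤ ((d + 2 : ℕ) : ℝ) := by exact_mod_cast hk2
  have hn' : (3:ℝ) ≤ n := by exact_mod_cast hn
  have hkn' : ((d + 2 : ℕ) : ℝ) ≤ n := by exact_mod_cast hkn
  have hdk : ((d + 2 : ℕ) : ℝ) = d + 2 := by push_cast; ring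
  set κ : ℝ := ((d + 2 : ℕ) : ℝ) with hκ
  set m : ℝ := (κ + 1) * n with hm
  set β : ℝ := m / (m - 2 * κ) with hβ
  have hmk : 3 * (κ + 1) ≤ m := by
    rw [hm, mul_comm 3]; exact mul_le_mul_of_nonneg_left hn' (by linarith)
  have hm0 : 0 < m := by linarith
  have hβ0 : 0 < β := div_pos hm0 (by linarith)
  obtain ⟨L, hL, hloc⟩ := localize (d := d) (by omega) hkn Ω hΩ f hfpos hf H₂ hH₂ x₀ R hR hball M hM
  obtain ⟨Ks, hKs, hsob⟩ := sob_step hn hk2 hkn hm hβ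
  have hCE : 0 ≤ 2 * L * Cen n d L := mul_nonneg (by linarith) (Cen_nonneg hL)
  have hM'0 : (0:ℝ) ≤ (2 ^ (m/2) * M) ^ (2/m) := by positivity
  refine ⟨Ks * (1 + 2 * L * Cen n d L) * (2 ^ (m/2) * M) ^ (2/m) * (R ^ 2 / 9 + 4 * n), ?_⟩
  intro u C₁ q ρ hu heq hC0 hC1 hlap hgr hvint hq hρ hρR
  have hq52 : 5/2 ≤ q := by linarith
  have hq0 : 0 < q := by linarith
  have hball' : closedBall x₀ (2 * R) ⊆ Ω := by rwa [closure_ball x₀ (by positivity)] at hball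
  have hvc : ContinuousOn (fun x => lapl u x + C₁) (closedBall x₀ (2 * R)) := by
    refine ContinuousOn.mono ?_ hball'
    unfold lapl
    refine ContinuousOn.add (continuousOn_finset_sum _ fun l _ => ?_) continuousOn_const
    exact (pd_contDiffOn (s := 0) hΩ (pd_contDiffOn (s := 1) hΩ hu (by norm_num) l) (by norm_num) l).continuousOn
  obtain ⟨η, hη, hη1, hηs, hηb, hηd⟩ := cutoff x₀ (r := R + ρ) hρ
  have hηc : HasCompactSupport η := (isCompact_closedBall _ _).of_isClosed_subset (isClosed_tsupport _) hηs
  have hSs : closedBall x₀ (5/3*R) ⊆ ball x₀ (2*R) := closedBall_subset_ball (by linarith)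
  have hηS : tsupport η ⊆ closedBall x₀ (5/3*R) := hηs.trans (closedBall_subset_closedBall (by linarith))
  have hfin := finish (β := β) (q := q) (s := q + κ) (Kc := Ks * (1 + 2 * L * Cen n d L) * (2 ^ (m/2) * M) ^ (2/m) * q)
    hR hρ hρR hβ0 hq0 (by linarith) (by positivity) hvc (fun x hx => (hlap x hx).1) hη hη1 hηs hηb hηd ?_
  · refine hfin.trans (le_of_eq ?_)
    ring
  · intro ε hε hε2
    obtain ⟨w, hw, hwv, hw12, hen⟩ := hloc u C₁ hu heq hC0 hC1 hlap hgr ε hε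
    refine ⟨w, hw, hwv, ?_⟩
    refine hsob w η (closedBall x₀ (5/3*R)) q _ _ hw (hη.of_le (by norm_num)) hηc hηS (isCompact_closedBall _ _) hw12 hq52 hCE ?_ ?_
    · have hi : IntegrableOn (fun x => (lapl u x + C₁) ^ (m/2)) (closedBall x₀ (2*R)) :=
        (hvc.rpow_const (fun _ _ => Or.inr (by positivity))).integrableOn_compact (isCompact_closedBall _ _)
      calc ∫ x in closedBall x₀ (5/3*R), (max (w x) (1/2)) ^ (m/2)
          ≤ ∫ x in closedBall x₀ (5/3*R), 2 ^ (m/2) * (lapl u x + C₁) ^ (m/2) := by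
            refine setIntegral_mono_on ?_ ?_ measurableSet_closedBall ?_
            · refine ContinuousOn.integrableOn_compact (isCompact_closedBall _ _) ?_
              refine Continuous.continuousOn ?_
              exact Continuous.rpow_const (hw.continuous.max continuous_const) (fun _ => Or.inr (by positivity))
            · exact (hi.mono_set (hSs.trans ball_subset_closedBall)).const_mul _
            · intro x hx
              have h1 := (hlap x (hSs hx)).1
              have h2 := (abs_le.1 (hwv x hx)).2
              rw [← Real.mul_rpow (by norm_num) (by linarith), max_eq_left (hw12 x hx)]
              exact Real.rpow_le_rpow (by linarith [hw12 x hx]) (by linarith) (by positivity)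
        _ = 2 ^ (m/2) * ∫ x in closedBall x₀ (5/3*R), (lapl u x + C₁) ^ (m/2) := integral_const_mul _ _
        _ ≤ 2 ^ (m/2) * ∫ x in ball x₀ (2*R), (lapl u x + C₁) ^ (m/2) := by
            refine mul_le_mul_of_nonneg_left ?_ (by positivity)
            refine setIntegral_mono_set (hi.mono_set ball_subset_closedBall) ?_ (HasSubset.Subset.eventuallyLE hSs)
            exact (ae_restrict_mem measurableSet_ball).mono fun x hx => Real.rpow_nonneg (by linarith [(hlap x hx).1]) _
        _ ≤ 2 ^ (m/2) * M := mul_le_mul_of_nonneg_left hvint (by positivity)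
    · have := hen η (q-1) (hη.of_le (by norm_num)) hηc hηS (by linarith)
      rw [show q - 1 - 2 = q - 3 by ring, show q - 1 + ((d:ℝ) + 3) = q + κ by rw [hdk]; ring] at this
      exact this
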